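/- Assume the Riemann Hypothesis. There is an absolute constant C such that for every sufficiently large integer N and every real ξ with 0 ≤ ξ ≤ 1/2, ∫_{−ξ}^{ξ} |S̃(α) − 1/z|² dα ≤ C N ξ log² N, where z = 1/N − 2πiα. -/

import Mathlib

open Finset

/-- The von Mangoldt function. -/
noncomputable def vM (n : ℕ) : ℝ := ArithmeticFunction.vonMangoldt n

/-- `z = 1/N - 2πiα`. -/
noncomputable def zOf (N : ℕ) (α : ℝ) : ℂ :=
  1 / (N : ℂ) - 2 * (Real.pi : ℂ) * Complex.I * (α : ℂ)

/-- The weighted exponential sum `S̃(α) = ∑_{n ≥ 1} Λ(n) e^{-n/N} e(nα)`. -/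
noncomputable def Stilde (N : ℕ) (α : ℝ) : ℂ :=
  ∑' n : ℕ, (vM n : ℂ) * Real.exp (-(n : ℝ) / N) *
    Complex.exp (2 * (Real.pi : ℂ) * Complex.I * (n : ℂ) * (α : ℂ))

open Complex Metric in
/-- Dividing an entire function by the Blaschke factor of one of its zeros. -/
theorem exists_divide_blaschke {f : ℂ → ℂ} (hf : Differentiable ℂ f) {R M : ℝ} (hR : 0 < R)
    (hM : ∀ s ∈ closedBall (0 : ℂ) R, ‖f s‖ ≤ M) {ρ : ℂ} (hρ : f ρ = 0) (hρR : ‖ρ‖ < R) :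
    ∃ g : ℂ → ℂ, Differentiable ℂ g ∧
      (∀ s, f s * (R ^ 2 - (starRingEnd ℂ) ρ * s) = g s * (R * (s - ρ))) ∧
      ∀ s ∈ closedBall (0 : ℂ) R, ‖g s‖ ≤ M := by
  have hR' : (R : ℂ) ≠ 0 := by exact_mod_cast hR.ne'
  have hd : Differentiable ℂ (dslope f ρ) := by
    rw [← differentiableOn_univ] at hf ⊢
    exact (differentiableOn_dslope Filter.univ_mem).2 hf
  have hfac : ∀ s, f s = (s - ρ) * dslope f ρ s := by
    intro s
    have := sub_smul_dslope f ρ s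
    rw [hρ, sub_zero, smul_eq_mul] at this
    exact this.symm
  have hg : Differentiable ℂ
      (fun s => dslope f ρ s * (R ^ 2 - (starRingEnd ℂ) ρ * s) / R) := by fun_prop
  refine ⟨_, hg, fun s => ?_, ?_⟩
  · rw [hfac s]; field_simp
  · have hsph : ∀ s ∈ frontier (ball (0 : ℂ) R),
        ‖dslope f ρ s * (R ^ 2 - (starRingEnd ℂ) ρ * s) / R‖ ≤ M := by
      intro s hs
      rw [frontier_ball _ hR.ne'] at hs
      have h1 := norm_canonicalFactor_eval_circle_eq_one (R := R) (w := ρ) (z := s)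
        (by simpa using hρR) hs
      have hsρ : s - ρ ≠ 0 := by
        intro h
        rw [sub_eq_zero] at h
        subst h
        simp at hs
        linarith
      have : dslope f ρ s * (R ^ 2 - (starRingEnd ℂ) ρ * s) / R
          = f s * canonicalFactor R ρ s := by
        rw [canonicalFactor_apply, hfac s]
        field_simp
      rw [this, norm_mul, h1, mul_one]
      exact hM s (sphere_subset_closedBall hs)
    intro s hs
    rw [← closure_ball _ hR.ne'] at hs
    exact norm_le_of_forall_mem_frontier_norm_le isBounded_ball hg.diffContOnCl hsph hs

open Complex Metric in
theorem exists_blaschke_factorization {R r M : ℝ} (hr : 0 < r) (hrR : r < R) (n : ℕ) :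
    ∀ f : ℂ → ℂ, Differentiable ℂ f → (∀ s ∈ closedBall (0 : ℂ) R, ‖f s‖ ≤ M) →
    M < ‖f 0‖ * (R / r) ^ n → f 0 ≠ 0 →
    ∃ (l : Multiset ℂ) (g : ℂ → ℂ), Differentiable ℂ g ∧ (∀ ρ ∈ l, f ρ = 0 ∧ ‖ρ‖ ≤ r) ∧
      (∀ s ∈ closedBall (0 : ℂ) R, ‖g s‖ ≤ M) ∧ ‖f 0‖ * (R / r) ^ l.card ≤ ‖g 0‖ ∧
      (∀ s ∈ closedBall (0 : ℂ) r, g s ≠ 0) ∧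
      ∀ s ∈ ball (0 : ℂ) R, f s ≠ 0 → logDeriv f s = logDeriv g s +
        (l.map fun ρ => 1 / (s - ρ) + (starRingEnd ℂ) ρ / (R ^ 2 - (starRingEnd ℂ) ρ * s)).sum := by
  have hR : 0 < R := hr.trans hrR
  have hR' : (R : ℂ) ≠ 0 := by exact_mod_cast hR.ne'
  induction n with
  | zero =>
    intro f _ hM h0
    have := hM 0 (by simp [hR.le])
    simp at h0
    linarith
  | succ n ih =>
    intro f hf hM hn h0
    by_cases hz : ∃ ρ ∈ closedBall (0 : ℂ) r, f ρ = 0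
    · obtain ⟨ρ, hρr, hρ⟩ := hz
      rw [mem_closedBall_zero_iff] at hρr
      have hρR : ‖ρ‖ < R := hρr.trans_lt hrR
      obtain ⟨g, hg, hfg, hgM⟩ := exists_divide_blaschke hf hR hM hρ hρR
      have hρ0 : ρ ≠ 0 := by rintro rfl; exact h0 hρ
      have hρn : 0 < ‖ρ‖ := norm_pos_iff.2 hρ0
      have hg0 : ‖f 0‖ * (R / r) ≤ ‖g 0‖ := by
        have := congrArg norm (hfg 0)
        simp [abs_of_pos hR] at this
        have h2 : ‖f 0‖ * R = ‖g 0‖ * ‖ρ‖ := by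
          have : R * (‖f 0‖ * R) = R * (‖g 0‖ * ‖ρ‖) := by linarith
          exact mul_left_cancel₀ hR.ne' this
        rw [← mul_div_assoc, div_le_iff₀ hr, h2]
        gcongr
      have hpos : 0 < ‖f 0‖ * (R / r) := by positivity
      obtain ⟨l, G, hG, hl, hGM, hG0, hGne, hlog⟩ := ih g hg hgM (by
        calc M < ‖f 0‖ * (R / r) ^ (n + 1) := hn
          _ = ‖f 0‖ * (R / r) * (R / r) ^ n := by ring
          _ ≤ _ := by gcongr) (norm_pos_iff.1 (hpos.trans_le hg0))
      have hnum : ∀ s ∈ ball (0 : ℂ) R, (R : ℂ) ^ 2 - (starRingEnd ℂ) ρ * s ≠ 0 := by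
        intro s hs h
        rw [mem_ball_zero_iff] at hs
        have h1 : ‖(R : ℂ) ^ 2‖ = ‖(starRingEnd ℂ) ρ * s‖ := by rw [sub_eq_zero.1 h]
        simp [abs_of_pos hR] at h1
        nlinarith [norm_nonneg s]
      have hball : ∀ s, ‖s‖ ≤ r → s ∈ ball (0 : ℂ) R := fun s hs => by
        rw [mem_ball_zero_iff]; linarith
      refine ⟨ρ ::ₘ l, G, hG, ?_, hGM, ?_, hGne, ?_⟩
      · intro ρ' h'
        rcases Multiset.mem_cons.1 h' with rfl | h'
        · exact ⟨hρ, hρr⟩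
        · obtain ⟨h1, h2⟩ := hl ρ' h'
          refine ⟨?_, h2⟩
          have := hfg ρ'
          rw [h1, zero_mul] at this
          exact (mul_eq_zero.1 this).resolve_right (hnum _ (hball _ h2))
      · rw [Multiset.card_cons, pow_succ]
        calc ‖f 0‖ * ((R / r) ^ l.card * (R / r)) = ‖f 0‖ * (R / r) * (R / r) ^ l.card := by ring
          _ ≤ ‖g 0‖ * (R / r) ^ l.card := by gcongr
          _ ≤ _ := hG0
      · intro s hs hfs
        have hns := hnum s hs
        have hgs : g s ≠ 0 := by
          intro h
          have := hfg s
          rw [h, zero_mul] at this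
          exact (mul_ne_zero hfs hns) this
        have hsρ : s - ρ ≠ 0 := by
          intro h
          rw [sub_eq_zero] at h
          exact hfs (h ▸ hρ)
        rw [Multiset.map_cons, Multiset.sum_cons]
        have key : logDeriv (fun s => f s * (R ^ 2 - (starRingEnd ℂ) ρ * s)) s
            = logDeriv (fun s => g s * (R * (s - ρ))) s := by
          rw [funext hfg]
        rw [logDeriv_mul _ hfs hns hf.differentiableAt (by fun_prop),
          logDeriv_mul (f := g) (g := fun s => (R : ℂ) * (s - ρ)) s hgs (mul_ne_zero hR' hsρ) hg.differentiableAt (by fun_prop)] at key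
        have e1 : logDeriv (fun s : ℂ => (R : ℂ) ^ 2 - (starRingEnd ℂ) ρ * s) s
            = - ((starRingEnd ℂ) ρ / (R ^ 2 - (starRingEnd ℂ) ρ * s)) := by
          have : HasDerivAt (fun s : ℂ => (R : ℂ) ^ 2 - (starRingEnd ℂ) ρ * s)
              (- ((starRingEnd ℂ) ρ * 1)) s :=
            ((hasDerivAt_id s).const_mul _).const_sub _
          rw [logDeriv_apply, this.deriv]
          ring
        have e2 : logDeriv (fun s : ℂ => (R : ℂ) * (s - ρ)) s = 1 / (s - ρ) := by
          have : HasDerivAt (fun s : ℂ => (R : ℂ) * (s - ρ)) (R * 1) s :=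
            ((hasDerivAt_id s).sub_const _).const_mul _
          rw [logDeriv_apply, this.deriv]
          field_simp
        rw [e1, e2, hlog s hs hgs] at key
        linear_combination key
    · push Not at hz
      refine ⟨0, f, hf, by simp, hM, by simp, hz, by simp⟩

open Complex Metric in
/-- Borel–Carathéodory for the logarithmic derivative of a zero-free function. -/
theorem norm_logDeriv_le_of_ne_zero {G : ℂ → ℂ} (hG : Differentiable ℂ G) {r r' K : ℝ}
    (hr' : 0 < r') (hr : r' < r) (hK : 0 < K) (hne : ∀ s ∈ closedBall (0 : ℂ) r, G s ≠ 0)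
    (hGK : ∀ s ∈ closedBall (0 : ℂ) r, ‖G s‖ ≤ ‖G 0‖ * Real.exp K) {s : ℂ} (hs : ‖s‖ ≤ r') :
    ‖logDeriv G s‖ ≤ 8 * r / (r - r') ^ 2 * K := by
  have hr0 : 0 < r := hr'.trans hr
  have hsub : ball (0 : ℂ) r ⊆ closedBall 0 r := ball_subset_closedBall
  have hdl : DifferentiableOn ℂ (logDeriv G) (ball 0 r) := by
    intro s hs
    have : DifferentiableAt ℂ (fun s => deriv G s / G s) s :=
      ((hG.contDiff (n := 2)).differentiable_deriv_two s).div (hG s) (hne s (hsub hs))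
    exact this.differentiableWithinAt
  obtain ⟨h, hh0, hh⟩ := hdl.isExactOn_ball.with_val_at 0 0
  have hdh : DifferentiableOn ℂ h (ball 0 r) := fun s hs =>
    (hh s hs).differentiableAt.differentiableWithinAt
  have hexp : ∀ s ∈ ball (0 : ℂ) r, G s * cexp (-h s) = G 0 := by
    intro s hs
    have hd : ∀ x ∈ ball (0 : ℂ) r, HasDerivAt (fun s => G s * cexp (-h s)) 0 x := by
      intro x hx
      have h1 : HasDerivAt (fun s => G s * cexp (-h s))
          (deriv G x * cexp (-h x) + G x * (cexp (-h x) * -logDeriv G x)) x :=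
        (hG x).hasDerivAt.mul ((hh x hx).neg.cexp)
      have h2 : deriv G x * cexp (-h x) + G x * (cexp (-h x) * -logDeriv G x) = 0 := by
        have := hne x (hsub hx)
        rw [logDeriv_apply]
        field_simp
        ring
      rwa [h2] at h1
    have := (convex_ball (0 : ℂ) r).is_const_of_fderivWithin_eq_zero (𝕜 := ℂ)
      (f := fun s => G s * cexp (-h s)) (fun x hx => (hd x hx).differentiableAt.differentiableWithinAt)
      (fun x hx => by
        rw [fderivWithin_of_isOpen isOpen_ball hx]
        ext
        simp [(hd x hx).deriv]) hs (mem_ball_self hr0)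
    simpa [hh0] using this
  have hG0 : 0 < ‖G 0‖ := norm_pos_iff.2 (hne 0 (by simp [hr0.le]))
  have hre : Set.MapsTo h (ball 0 r) {z | z.re ≤ K} := by
    intro s hs
    have h1 := congrArg norm (hexp s hs)
    rw [norm_mul, norm_exp, neg_re] at h1
    have h2 := hGK s (hsub hs)
    have h3 : ‖G s‖ = ‖G 0‖ * Real.exp (h s).re := by
      rw [← h1, mul_assoc, ← Real.exp_add]; simp
    rw [h3] at h2
    exact Real.exp_le_exp.1 (le_of_mul_le_mul_left h2 hG0)
  set r₃ := (r + r') / 2 with hr₃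
  have hb : ∀ w ∈ sphere s (r₃ - r'), ‖h w‖ ≤ 4 * r / (r - r') * K := by
    intro w hw
    have hw' : ‖w‖ ≤ r₃ := by
      rw [mem_sphere_iff_norm] at hw
      calc ‖w‖ = ‖(w - s) + s‖ := by simp
        _ ≤ ‖w - s‖ + ‖s‖ := norm_add_le _ _
        _ ≤ r₃ := by linarith
    have h1 := borelCaratheodory_zero hK hdh hre hr0
      (z := w) (by rw [mem_ball_zero_iff]; linarith) hh0
    refine h1.trans ?_
    have h2 : (r - r') / 2 ≤ r - ‖w‖ := by linarith
    have h3 : 0 < (r - r') / 2 := by linarith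
    calc 2 * K * ‖w‖ / (r - ‖w‖) ≤ 2 * K * r / ((r - r') / 2) := by
          gcongr
          linarith
      _ = 4 * r / (r - r') * K := by
          have : r - r' ≠ 0 := by linarith
          field_simp
          ring
  have hsr : s ∈ ball (0 : ℂ) r := by rw [mem_ball_zero_iff]; linarith
  have hder := norm_deriv_le_of_forall_mem_sphere_norm_le (c := s) (R := r₃ - r') (by linarith)
    (f := h) (DifferentiableOn.diffContOnCl_ball (U := ball 0 r) hdh (by
      intro w hw
      rw [mem_closedBall_iff_norm] at hw
      rw [mem_ball_zero_iff]
      calc ‖w‖ = ‖(w - s) + s‖ := by simp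
        _ ≤ ‖w - s‖ + ‖s‖ := norm_add_le _ _
        _ < r := by linarith)) hb
  rw [(hh s hsr).deriv] at hder
  refine hder.trans (le_of_eq ?_)
  have : r - r' ≠ 0 := by linarith
  have h4 : r₃ - r' = (r - r') / 2 := by rw [hr₃]; ring
  rw [h4]
  field_simp
  ring

open Complex Metric in
/-- Landau's lemma: the logarithmic derivative of an entire function is approximated on a disc by
the partial fraction of its zeros in a slightly larger disc. -/
theorem exists_zeros_logDeriv_approx {R r r' : ℝ} (hr' : 0 < r') (hr : r' < r) (hR : r < R) :
    ∃ C : ℝ, 0 < C ∧ ∀ (f : ℂ → ℂ) (K : ℝ), Differentiable ℂ f → 0 < K → f 0 ≠ 0 →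
      (∀ s ∈ closedBall (0 : ℂ) R, ‖f s‖ ≤ ‖f 0‖ * Real.exp K) →
      ∃ l : Multiset ℂ, (∀ ρ ∈ l, f ρ = 0 ∧ ‖ρ‖ ≤ r) ∧ l.card ≤ C * K ∧
        ∀ s, ‖s‖ ≤ r' → f s ≠ 0 →
          ‖logDeriv f s - (l.map fun ρ => 1 / (s - ρ)).sum‖ ≤ C * K := by
  have hr0 : 0 < r := hr'.trans hr
  have hR0 : 0 < R := hr0.trans hR
  have hq : 1 < R / r := (one_lt_div hr0).2 hR
  have hlq : 0 < Real.log (R / r) := Real.log_pos hq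
  have hD : 0 < R ^ 2 - r * r' := by nlinarith
  set C₁ := 1 / Real.log (R / r)
  set C₂ := 8 * r / (r - r') ^ 2
  set C₃ := r / (R ^ 2 - r * r')
  have hC₁ : 0 < C₁ := by positivity
  have hC₂ : 0 < C₂ := by
    have : 0 < r - r' := by linarith
    positivity
  have hC₃ : 0 < C₃ := by positivity
  refine ⟨C₁ + C₂ + C₁ * C₃, by positivity, fun f K hf hK h0 hM => ?_⟩
  have hf0 : 0 < ‖f 0‖ := norm_pos_iff.2 h0
  obtain ⟨n, hn⟩ := pow_unbounded_of_one_lt (Real.exp K) hq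
  obtain ⟨l, g, hg, hl, hgM, hg0, hgne, hlog⟩ := exists_blaschke_factorization hr0 hR n f hf hM
    (by gcongr) h0
  have hcard : (l.card : ℝ) ≤ C₁ * K := by
    have h1 := hg0.trans (hgM 0 (by simp [hR0.le]))
    have h2 : (R / r) ^ l.card ≤ Real.exp K := le_of_mul_le_mul_left h1 hf0
    have h3 := Real.log_le_log (by positivity) h2
    rw [Real.log_pow, Real.log_exp] at h3
    rw [show C₁ * K = K / Real.log (R / r) from one_div_mul_eq_div _ _, le_div_iff₀ hlq]
    exact h3
  have hle : ‖f 0‖ ≤ ‖g 0‖ := by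
    refine le_trans ?_ hg0
    exact le_mul_of_one_le_right hf0.le (one_le_pow₀ hq.le)
  refine ⟨l, hl, hcard.trans ?_, fun s hs hfs => ?_⟩
  · gcongr
    have := mul_pos hC₁ hC₃
    linarith
  · have hbc := norm_logDeriv_le_of_ne_zero hg hr' hr hK hgne (fun w hw =>
      (hgM w (closedBall_subset_closedBall hR.le hw)).trans (by gcongr)) hs
    have hsum : ∀ m : Multiset ℂ, (∀ ρ ∈ m, ‖ρ‖ ≤ r) →
        ‖(m.map fun ρ => (starRingEnd ℂ) ρ / (R ^ 2 - (starRingEnd ℂ) ρ * s)).sum‖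
          ≤ m.card * C₃ := by
      intro m
      induction m using Multiset.induction_on with
      | empty => simp
      | cons ρ m ih =>
        intro hm
        rw [Multiset.map_cons, Multiset.sum_cons, Multiset.card_cons]
        refine (norm_add_le _ _).trans ?_
        have h1 := ih (fun ρ' h => hm ρ' (Multiset.mem_cons_of_mem h))
        have h2 : ‖ρ‖ ≤ r := hm ρ (Multiset.mem_cons_self _ _)
        have h3 : ‖(starRingEnd ℂ) ρ / (R ^ 2 - (starRingEnd ℂ) ρ * s)‖ ≤ C₃ := by
          rw [norm_div, RCLike.norm_conj]
          have h4 : R ^ 2 - r * r' ≤ ‖(R : ℂ) ^ 2 - (starRingEnd ℂ) ρ * s‖ := by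
            have := norm_sub_norm_le ((R : ℂ) ^ 2) ((starRingEnd ℂ) ρ * s)
            rw [norm_mul, norm_pow, RCLike.norm_conj, norm_real, Real.norm_eq_abs,
              sq_abs] at this
            have : ‖ρ‖ * ‖s‖ ≤ r * r' := by gcongr
            linarith
          change _ ≤ r / (R ^ 2 - r * r')
          gcongr
        push_cast
        linarith
    rw [hlog s (by rw [mem_ball_zero_iff]; linarith) hfs, Multiset.sum_map_add]
    have h5 := hsum l (fun ρ h => (hl ρ h).2)
    have h6 : (l.card : ℝ) * C₃ ≤ C₁ * K * C₃ := by gcongr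
    calc _ = ‖logDeriv g s + (l.map fun ρ =>
          (starRingEnd ℂ) ρ / (R ^ 2 - (starRingEnd ℂ) ρ * s)).sum‖ := by congr 1; ring
      _ ≤ _ := norm_add_le _ _
      _ ≤ C₂ * K + C₁ * K * C₃ := add_le_add hbc (h5.trans h6)
      _ ≤ _ := by nlinarith [mul_pos hC₁ hK]

/-- The entire function `(s - 1) ζ(s)`. -/
noncomputable def zetaReg : ℂ → ℂ := Function.update (fun s => (s - 1) * riemannZeta s) 1 1

theorem zetaReg_of_ne {s : ℂ} (hs : s ≠ 1) : zetaReg s = (s - 1) * riemannZeta s :=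
  Function.update_of_ne hs _ _

@[simp] theorem zetaReg_one : zetaReg 1 = 1 := Function.update_self _ _ _

theorem differentiable_zetaReg : Differentiable ℂ zetaReg := by
  rw [← differentiableOn_univ,
    ← Complex.differentiableOn_compl_singleton_and_continuousAt_iff (c := 1) Filter.univ_mem]
  constructor
  · have h : DifferentiableOn ℂ (fun s => (s - 1) * riemannZeta s) (Set.univ \ {1}) := by
      intro s hs
      exact (((differentiableAt_id.sub_const 1).mul
        (differentiableAt_riemannZeta hs.2))).differentiableWithinAt
    exact h.congr fun s hs => zetaReg_of_ne hs.2
  · rw [zetaReg, continuousAt_update_same]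
    exact riemannZeta_residue_one

/-- The terms of a series for `(s - 1) ζ(s) - 1` that converges for `0 < re s`. -/
noncomputable def zetaTerm (n : ℕ) (s : ℂ) : ℂ :=
  (s - 1) * ((n : ℂ) + 1) ^ (-s) + ((n : ℂ) + 2) ^ (1 - s) - ((n : ℂ) + 1) ^ (1 - s)

theorem hasDerivAt_add_ofReal_cpow {a : ℝ} (ha : 0 < a) {u : ℝ} (hu : 0 ≤ u) (w : ℂ) :
    HasDerivAt (fun v : ℝ => ((a : ℂ) + v) ^ w) (w * ((a : ℂ) + u) ^ (w - 1)) u := by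
  have h0 : ((a : ℂ) + u) ∈ Complex.slitPlane := by
    left; simp; linarith
  have h1 : HasDerivAt (fun v : ℂ => ((a : ℂ) + v)) 1 (u : ℂ) := (hasDerivAt_id _).const_add _
  have h := (h1.cpow_const (c := w) h0).comp_ofReal
  simpa using h

theorem norm_zetaTerm_le (n : ℕ) {s : ℂ} (hs : 0 < s.re) :
    ‖zetaTerm n s‖ ≤ ‖s - 1‖ * ‖s‖ * ((n : ℝ) + 1) ^ (-s.re - 1) := by
  have hn : (0 : ℝ) < n + 1 := by positivity
  have key : ∀ u ∈ Set.Icc (0 : ℝ) 1,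
      ‖((n : ℂ) + 1 + u) ^ (-s) - ((n : ℂ) + 1) ^ (-s)‖ ≤ ‖s‖ * ((n : ℝ) + 1) ^ (-s.re - 1) := by
    intro u hu
    have h := norm_image_sub_le_of_norm_deriv_le_segment' (a := 0) (b := u)
      (f := fun v : ℝ => (((n + 1 : ℝ) : ℂ) + v) ^ (-s))
      (f' := fun v => -s * (((n + 1 : ℝ) : ℂ) + v) ^ (-s - 1))
      (C := ‖s‖ * ((n : ℝ) + 1) ^ (-s.re - 1))
      (fun x hx => (hasDerivAt_add_ofReal_cpow hn hx.1 _).hasDerivWithinAt)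
      (fun x hx => by
        rw [norm_mul, norm_neg, ← Complex.ofReal_add,
          Complex.norm_cpow_eq_rpow_re_of_pos (by linarith [hx.1])]
        gcongr
        simp only [Complex.sub_re, Complex.neg_re, Complex.one_re]
        exact Real.rpow_le_rpow_of_nonpos hn (by linarith [hx.1]) (by linarith))
      u ⟨hu.1, le_rfl⟩
    simp only [Complex.ofReal_add, Complex.ofReal_natCast, Complex.ofReal_one,
      Complex.ofReal_zero, add_zero, sub_zero] at h
    refine h.trans ?_
    exact mul_le_of_le_one_right (by positivity) hu.2
  have h := norm_image_sub_le_of_norm_deriv_le_segment_01'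
      (f := fun v : ℝ => (((n + 1 : ℝ) : ℂ) + v) ^ (1 - s) +
        (v : ℂ) * ((s - 1) * ((n : ℂ) + 1) ^ (-s)))
      (f' := fun v => (1 - s) * (((n + 1 : ℝ) : ℂ) + v) ^ (1 - s - 1) +
        1 * ((s - 1) * ((n : ℂ) + 1) ^ (-s)))
      (C := ‖s - 1‖ * ‖s‖ * ((n : ℝ) + 1) ^ (-s.re - 1))
      (fun x hx => ((hasDerivAt_add_ofReal_cpow hn hx.1 _).add
        ((hasDerivAt_id (x : ℂ)).comp_ofReal.mul_const _)).hasDerivWithinAt)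
      (fun x hx => by
        have := key x ⟨hx.1, hx.2.le⟩
        calc _ = ‖(1 - s) * (((n : ℂ) + 1 + x) ^ (-s) - ((n : ℂ) + 1) ^ (-s))‖ := by
              congr 1; push_cast; rw [show 1 - s - 1 = -s by ring]; ring
          _ ≤ _ := by
              rw [norm_mul, norm_sub_rev, mul_assoc]
              gcongr)
  refine le_trans (le_of_eq ?_) h
  congr 1
  simp only [zetaTerm]
  push_cast
  rw [show (n : ℂ) + 1 + 1 = n + 2 by ring]
  ring_nf

theorem differentiable_zetaTerm (n : ℕ) : Differentiable ℂ (zetaTerm n) := by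
  have h1 : (n : ℂ) + 1 ≠ 0 := by exact_mod_cast n.succ_ne_zero
  have h2 : (n : ℂ) + 2 ≠ 0 := by exact_mod_cast (n + 1).succ_ne_zero
  unfold zetaTerm
  refine ((((differentiable_id.sub_const 1)).mul ?_).add ?_).sub ?_
  · exact (differentiable_id.neg).const_cpow (.inl h1)
  · exact (differentiable_id.const_sub 1).const_cpow (.inl h2)
  · exact (differentiable_id.const_sub 1).const_cpow (.inl h1)

theorem sum_range_zetaTerm (s : ℂ) (M : ℕ) :
    ∑ n ∈ range M, zetaTerm n s =
      (s - 1) * ∑ n ∈ range M, 1 / ((n : ℂ) + 1) ^ s + ((M : ℂ) + 1) ^ (1 - s) - 1 := by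
  induction M with
  | zero => simp
  | succ M ih =>
    rw [sum_range_succ, ih, sum_range_succ, zetaTerm, Complex.cpow_neg]
    push_cast
    rw [show (M : ℂ) + 1 + 1 = M + 2 by ring]
    ring

theorem hasSum_zetaTerm_of_one_lt_re {s : ℂ} (hs : 1 < s.re) :
    ∑' n, zetaTerm n s = zetaReg s - 1 := by
  have hs1 : s ≠ 1 := by rintro rfl; simp at hs
  have hsum : Summable fun n => zetaTerm n s := by
    refine Summable.of_norm_bounded ?_ (fun n => norm_zetaTerm_le n (by linarith))
    refine Summable.mul_left _ ?_
    have := (summable_nat_add_iff 1).2 (Real.summable_nat_rpow_inv (p := s.re + 1)|>.2 (by linarith))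
    refine this.congr fun n => ?_
    rw [show -s.re - 1 = -(s.re + 1) by ring, Real.rpow_neg (by positivity)]
    push_cast; rfl
  have hz : Summable fun n : ℕ => 1 / ((n : ℂ) + 1) ^ s := by
    have := (summable_nat_add_iff 1).2 (Complex.summable_one_div_nat_cpow.2 hs)
    exact this.congr fun n => by push_cast; rfl
  have h1 := hsum.hasSum.tendsto_sum_nat
  have h2 := hz.hasSum.tendsto_sum_nat
  have h3 : Filter.Tendsto (fun M : ℕ => ((M : ℂ) + 1) ^ (1 - s)) Filter.atTop (nhds 0) := by
    rw [tendsto_zero_iff_norm_tendsto_zero]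
    have h4 : Filter.Tendsto (fun M : ℕ => ((M : ℝ) + 1) ^ (-(s.re - 1))) Filter.atTop (nhds 0) :=
      (tendsto_rpow_neg_atTop (by linarith)).comp
        (Filter.tendsto_atTop_add_const_right _ _ tendsto_natCast_atTop_atTop)
    refine h4.congr fun M => ?_
    have := Complex.norm_cpow_eq_rpow_re_of_pos (x := (M : ℝ) + 1) (by positivity) (1 - s)
    push_cast at this
    rw [this]; simp
  refine tendsto_nhds_unique h1 ?_
  rw [zetaReg_of_ne hs1, zeta_eq_tsum_one_div_nat_add_one_cpow hs]
  have := ((h2.const_mul (s - 1)).add h3).sub_const 1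
  rw [add_zero] at this
  exact this.congr fun M => (sum_range_zetaTerm s M).symm

theorem exists_norm_zetaReg_le : ∃ C : ℝ, 0 < C ∧ ∀ s : ℂ, 1 / 4 ≤ s.re →
    ‖zetaReg s‖ ≤ C * (1 + ‖s‖) ^ 2 := by
  have hS : ∀ p : ℝ, 0 < p → Summable fun n : ℕ => ((n : ℝ) + 1) ^ (-p - 1) := by
    intro p hp
    have := (summable_nat_add_iff 1).2 (Real.summable_nat_rpow_inv (p := p + 1)|>.2 (by linarith))
    refine this.congr fun n => ?_
    rw [show -p - 1 = -(p + 1) by ring, Real.rpow_neg (by positivity)]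
    push_cast; rfl
  have hterm : ∀ {p : ℝ} {s : ℂ} (n : ℕ), 0 < p → p ≤ s.re →
      ‖zetaTerm n s‖ ≤ ‖s - 1‖ * ‖s‖ * ((n : ℝ) + 1) ^ (-p - 1) := by
    intro p s n hp h
    refine (norm_zetaTerm_le n (hp.trans_le h)).trans ?_
    gcongr
    linarith [(Nat.cast_nonneg n : (0:ℝ) ≤ n)]
  have heq : ∀ s : ℂ, 0 < s.re → zetaReg s = 1 + ∑' n, zetaTerm n s := by
    have hU : IsOpen {s : ℂ | 0 < s.re} := isOpen_lt continuous_const Complex.continuous_re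
    have hd : DifferentiableOn ℂ (fun s => 1 + ∑' n, zetaTerm n s) {s : ℂ | 0 < s.re} := by
      intro s₀ hs₀
      have hs₀' : 0 < s₀.re := hs₀
      have hV : IsOpen ({s : ℂ | s₀.re / 2 < s.re} ∩ Metric.ball 0 (‖s₀‖ + 1)) :=
        (isOpen_lt continuous_const Complex.continuous_re).inter Metric.isOpen_ball
      have := Complex.differentiableOn_tsum_of_summable_norm
        ((hS (s₀.re / 2) (by linarith)).mul_left ((‖s₀‖ + 2) * (‖s₀‖ + 1)))
        (fun n => (differentiable_zetaTerm n).differentiableOn) hV (fun n s hs => by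
          have h1 : ‖s‖ ≤ ‖s₀‖ + 1 := (mem_ball_zero_iff.1 hs.2).le
          have h2 : ‖s - 1‖ ≤ ‖s₀‖ + 2 := (norm_sub_le _ _).trans (by rw [norm_one]; linarith)
          refine (hterm n (by linarith : 0 < s₀.re / 2) hs.1.le).trans ?_
          gcongr)
      refine ((this.differentiableAt (hV.mem_nhds ⟨?_, ?_⟩)).const_add 1).differentiableWithinAt
      · show s₀.re / 2 < s₀.re
        linarith
      · rw [mem_ball_zero_iff]; linarith
    have h := (differentiable_zetaReg.differentiableOn.analyticOnNhd hU).eqOn_of_preconnected_of_eventuallyEq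
      (hd.analyticOnNhd hU) (convex_halfSpace_re_gt 0).isPreconnected (z₀ := 2) (by simp) (by
        have : {s : ℂ | 1 < s.re} ∈ nhds (2 : ℂ) :=
          (isOpen_lt continuous_const Complex.continuous_re).mem_nhds (by simp)
        filter_upwards [this] with s hs
        rw [hasSum_zetaTerm_of_one_lt_re hs]; ring)
    exact fun s hs => h hs
  set S := ∑' n : ℕ, ((n : ℝ) + 1) ^ (-(1 / 4 : ℝ) - 1)
  have hS0 : 0 ≤ S := tsum_nonneg fun n => by positivity
  refine ⟨1 + S, by positivity, fun s hs => ?_⟩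
  rw [heq s (by linarith)]
  have h1 : ‖∑' n, zetaTerm n s‖ ≤ ‖s - 1‖ * ‖s‖ * S :=
    tsum_of_norm_bounded ((hS (1 / 4) (by norm_num)).hasSum.mul_left _)
      (fun n => hterm n (by norm_num) hs)
  have h2 : ‖s - 1‖ ≤ 1 + ‖s‖ := (norm_sub_le _ _).trans (by rw [norm_one]; linarith)
  have h3 : ‖s - 1‖ * ‖s‖ ≤ (1 + ‖s‖) ^ 2 := by
    rw [sq]; gcongr; linarith
  calc _ ≤ ‖(1 : ℂ)‖ + ‖∑' n, zetaTerm n s‖ := norm_add_le _ _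
    _ ≤ 1 + (1 + ‖s‖) ^ 2 * S := by rw [norm_one]; gcongr; exact h1.trans (by gcongr)
    _ ≤ _ := by nlinarith [norm_nonneg s]

theorem exists_le_norm_zetaReg : ∃ c : ℝ, 0 < c ∧ ∀ t : ℝ, c ≤ ‖zetaReg (2 + t * Complex.I)‖ := by
  refine ⟨2 - Real.pi ^ 2 / 6, by nlinarith [Real.pi_lt_d2, Real.pi_pos], fun t => ?_⟩
  set s : ℂ := 2 + t * Complex.I
  have hre : s.re = 2 := by simp [s]
  have hs1 : s ≠ 1 := by intro h; rw [h] at hre; norm_num at hre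
  have hs : 1 < s.re := by rw [hre]; norm_num
  have hnorm : ∀ n : ℕ, ‖1 / ((n : ℂ) + 1) ^ s‖ = 1 / ((n : ℝ) + 1) ^ 2 := by
    intro n
    have := Complex.norm_cpow_eq_rpow_re_of_pos (x := (n : ℝ) + 1) (by positivity) s
    push_cast at this
    rw [norm_div, norm_one, this, hre]
    norm_num
  have hz : Summable fun n : ℕ => 1 / ((n : ℂ) + 1) ^ s := by
    have := (summable_nat_add_iff 1).2 (Complex.summable_one_div_nat_cpow.2 hs)
    exact this.congr fun n => by push_cast; rfl
  have h2 : HasSum (fun n : ℕ => 1 / ((n : ℝ) + 2) ^ 2) (Real.pi ^ 2 / 6 - 1) := by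
    have := (hasSum_nat_add_iff' 2).2 hasSum_zeta_two
    simpa [sum_range_succ] using this
  have h3 : riemannZeta s = 1 + ∑' n : ℕ, 1 / (((n + 1 : ℕ) : ℂ) + 1) ^ s := by
    rw [zeta_eq_tsum_one_div_nat_add_one_cpow hs, hz.tsum_eq_zero_add]
    simp
  have h4 : ‖∑' n : ℕ, 1 / (((n + 1 : ℕ) : ℂ) + 1) ^ s‖ ≤ Real.pi ^ 2 / 6 - 1 := by
    refine tsum_of_norm_bounded h2 fun n => ?_
    rw [hnorm]
    push_cast
    rw [show (n : ℝ) + 1 + 1 = n + 2 by ring]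
  have h5 : 2 - Real.pi ^ 2 / 6 ≤ ‖riemannZeta s‖ := by
    rw [h3]
    have := norm_sub_norm_le (1 : ℂ) (-∑' n : ℕ, 1 / (((n + 1 : ℕ) : ℂ) + 1) ^ s)
    rw [norm_neg, norm_one, sub_neg_eq_add] at this
    linarith
  rw [zetaReg_of_ne hs1, norm_mul]
  have h6 : 1 ≤ ‖s - 1‖ := by
    have := Complex.abs_re_le_norm (s - 1)
    rw [Complex.sub_re, hre] at this
    norm_num at this
    exact this
  nlinarith [norm_nonneg (riemannZeta s)]

theorem RiemannHypothesis.re_eq_of_zetaReg_eq_zero (hRH : RiemannHypothesis) {s : ℂ}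
    (hs : 0 < s.re) (h : zetaReg s = 0) : s.re = 1 / 2 := by
  have h1 : s ≠ 1 := by rintro rfl; simp at h
  rw [zetaReg_of_ne h1] at h
  refine hRH s ((mul_eq_zero.1 h).resolve_left (sub_ne_zero.2 h1)) ?_ h1
  rintro ⟨n, rfl⟩
  have h2 : (-2 * ((n : ℂ) + 1)).re = -2 * (n + 1) := by simp
  rw [h2] at hs
  linarith [(Nat.cast_nonneg n : (0 : ℝ) ≤ n)]

/-- Under the Riemann hypothesis, the logarithmic derivative of `(s - 1) ζ(s)` near `2 + i t`
is a sum over `O(log t)` zeros on the critical line, up to `O(log t)`. -/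
theorem RiemannHypothesis.exists_logDeriv_zetaReg_approx (hRH : RiemannHypothesis) :
    ∃ A : ℝ, 0 < A ∧ ∀ t : ℝ, ∃ l : Multiset ℂ, (∀ ρ ∈ l, ρ.re = 1 / 2) ∧
      l.card ≤ A * Real.log (|t| + 2) ∧
      ∀ s, ‖s - (2 + t * Complex.I)‖ ≤ 31 / 20 → zetaReg s ≠ 0 →
        ‖logDeriv zetaReg s - (l.map fun ρ => 1 / (s - ρ)).sum‖ ≤ A * Real.log (|t| + 2) := by
  obtain ⟨C, hC, hZ⟩ := exists_norm_zetaReg_le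
  obtain ⟨c, hc, hcZ⟩ := exists_le_norm_zetaReg
  obtain ⟨D, hD, happ⟩ := exists_zeros_logDeriv_approx (R := 7 / 4) (r := 13 / 8) (r' := 31 / 20)
    (by norm_num) (by norm_num) (by norm_num)
  have hl2 : 0 < Real.log 2 := Real.log_pos (by norm_num)
  set B : ℝ := 6 + |Real.log (C / c)| / Real.log 2
  have hB : 0 < B := by positivity
  refine ⟨D * B, by positivity, fun t => ?_⟩
  have hlog : Real.log 2 ≤ Real.log (|t| + 2) :=
    Real.log_le_log (by norm_num) (by linarith [abs_nonneg t])
  have hlog0 := hl2.trans_le hlog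
  set w : ℂ := 2 + t * Complex.I with hw
  have hwre : w.re = 2 := by simp [w]
  have hwn : ‖w‖ ≤ 2 + |t| := by
    refine (norm_add_le _ _).trans ?_
    simp
  have hexp : C * (|t| + 5 : ℝ) ^ 2 ≤ c * Real.exp (B * Real.log (|t| + 2)) := by
    have h1 : Real.log (C / c) ≤ |Real.log (C / c)| / Real.log 2 * Real.log (|t| + 2) := by
      rw [div_mul_eq_mul_div, le_div_iff₀ hl2]
      exact mul_le_mul (le_abs_self _) hlog hl2.le (abs_nonneg _)
    have h2 : (|t| + 5 : ℝ) ^ 2 ≤ Real.exp (6 * Real.log (|t| + 2)) := by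
      rw [mul_comm, Real.exp_mul, Real.exp_log (by positivity)]
      norm_cast
      have h3 : |t| + 5 ≤ (|t| + 2) ^ 3 := by
        nlinarith [abs_nonneg t, pow_nonneg (abs_nonneg t) 2, pow_nonneg (abs_nonneg t) 3]
      calc (|t| + 5) ^ 2 ≤ ((|t| + 2) ^ 3) ^ 2 := by gcongr
        _ = _ := by ring
    calc C * (|t| + 5 : ℝ) ^ 2 = c * ((C / c) * (|t| + 5 : ℝ) ^ 2) := by field_simp
      _ ≤ c * (Real.exp (|Real.log (C / c)| / Real.log 2 * Real.log (|t| + 2)) *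
            Real.exp (6 * Real.log (|t| + 2))) := by
          gcongr
          rw [← Real.exp_log (show 0 < C / c by positivity)]
          simpa using h1
      _ = _ := by rw [← Real.exp_add]; congr 2; ring
  obtain ⟨l, hl, hcard, happ⟩ := happ (fun z => zetaReg (w + z)) (B * Real.log (|t| + 2))
    (differentiable_zetaReg.comp (differentiable_id.const_add w)) (by positivity)
    (by
      rw [add_zero]
      exact norm_pos_iff.1 (hc.trans_le (hcZ t)))
    (fun z hz => by
      have hz' : ‖z‖ ≤ 7 / 4 := mem_closedBall_zero_iff.1 hz
      have h1 := (abs_le.1 (Complex.abs_re_le_norm z)).1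
      refine (hZ (w + z) (by rw [Complex.add_re, hwre]; linarith)).trans ?_
      have h2 : ‖w + z‖ ≤ |t| + 15 / 4 := (norm_add_le _ _).trans (by linarith)
      calc C * (1 + ‖w + z‖) ^ 2 ≤ C * (|t| + 5) ^ 2 := by
            have : 1 + ‖w + z‖ ≤ |t| + 5 := by linarith
            gcongr
        _ ≤ _ := hexp
        _ ≤ _ := by rw [add_zero]; gcongr; exact hcZ t)
  refine ⟨l.map (w + ·), ?_, ?_, fun s hs hsne => ?_⟩
  · intro ρ hρ
    obtain ⟨z, hz, rfl⟩ := Multiset.mem_map.1 hρ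
    have h1 := (abs_le.1 (Complex.abs_re_le_norm z)).1
    have h2 := (hl z hz).2
    exact hRH.re_eq_of_zetaReg_eq_zero (by rw [Complex.add_re, hwre]; linarith) (hl z hz).1
  · rw [Multiset.card_map, mul_assoc]; exact hcard
  · have h := happ (s - w) hs (by simpa using hsne)
    have h1 : logDeriv (fun z => zetaReg (w + z)) (s - w) = logDeriv zetaReg s := by
      simp only [logDeriv_apply]
      rw [deriv_comp_const_add]
      simp
    rw [h1] at h
    rw [Multiset.map_map, mul_assoc]
    convert h using 6 with ρ
    simp only [Function.comp]
    ring

theorem RiemannHypothesis.zetaReg_ne_zero (hRH : RiemannHypothesis) {s : ℂ}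
    (hs : 1 / 2 < s.re) : zetaReg s ≠ 0 := fun h => by
  linarith [hRH.re_eq_of_zetaReg_eq_zero (by linarith) h]

theorem RiemannHypothesis.exists_norm_logDeriv_zetaReg_le (hRH : RiemannHypothesis) :
    ∃ A : ℝ, 0 < A ∧ ∀ s : ℂ, 1 / 2 < s.re → s.re ≤ 3 / 2 →
      ‖logDeriv zetaReg s‖ ≤ A / (s.re - 1 / 2) * Real.log (|s.im| + 2) := by
  obtain ⟨A, hA, h⟩ := hRH.exists_logDeriv_zetaReg_approx
  refine ⟨2 * A, by positivity, fun s h1 h2 => ?_⟩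
  obtain ⟨l, hl, hcard, happ⟩ := h s.im
  have hlog : 0 < Real.log (|s.im| + 2) := Real.log_pos (by linarith [abs_nonneg s.im])
  have h3 := happ s (by
    have : s - (2 + s.im * Complex.I) = ((s.re - 2 : ℝ) : ℂ) := by
      apply Complex.ext <;> simp
    rw [this, Complex.norm_real, Real.norm_eq_abs, abs_le]
    constructor <;> linarith) (hRH.zetaReg_ne_zero h1)
  have hd : 0 < s.re - 1 / 2 := by linarith
  have hsum : ∀ m : Multiset ℂ, (∀ ρ ∈ m, ρ.re = 1 / 2) →
      ‖(m.map fun ρ => 1 / (s - ρ)).sum‖ ≤ m.card * (1 / (s.re - 1 / 2)) := by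
    intro m
    induction m using Multiset.induction_on with
    | empty => simp
    | cons ρ m ih =>
      intro hm
      rw [Multiset.map_cons, Multiset.sum_cons, Multiset.card_cons]
      refine (norm_add_le _ _).trans ?_
      have h4 := ih (fun ρ' h => hm ρ' (Multiset.mem_cons_of_mem h))
      have h5 : ‖1 / (s - ρ)‖ ≤ 1 / (s.re - 1 / 2) := by
        rw [norm_div, norm_one]
        have := Complex.re_le_norm (s - ρ)
        rw [Complex.sub_re, hm ρ (Multiset.mem_cons_self _ _)] at this
        gcongr
      push_cast
      linarith
  have h4 := norm_le_norm_add_norm_sub' (logDeriv zetaReg s) (l.map fun ρ => 1 / (s - ρ)).sum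
  have h5 := hsum l hl
  have h6 : (l.card : ℝ) * (1 / (s.re - 1 / 2)) ≤
      A * Real.log (|s.im| + 2) * (1 / (s.re - 1 / 2)) := by gcongr
  have h7 : A * Real.log (|s.im| + 2) ≤ A * Real.log (|s.im| + 2) * (1 / (s.re - 1 / 2)) := by
    refine le_mul_of_one_le_right (by positivity) ?_
    rw [one_div, one_le_inv₀ hd]
    linarith
  calc _ ≤ 2 * (A * Real.log (|s.im| + 2) * (1 / (s.re - 1 / 2))) := by linarith
    _ = _ := by ring

theorem integral_poisson_kernel_le_pi {δ : ℝ} (hδ : 0 < δ) (γ a b : ℝ) :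
    ∫ t in a..b, δ / (δ ^ 2 + (t - γ) ^ 2) ≤ Real.pi := by
  have hderiv : ∀ t : ℝ, HasDerivAt (fun t => Real.arctan ((t - γ) / δ))
      (δ / (δ ^ 2 + (t - γ) ^ 2)) t := fun t => by
    have h := (((hasDerivAt_id' t).sub_const γ).div_const δ).arctan
    convert h using 1
    have : δ ^ 2 + (t - γ) ^ 2 ≠ 0 := by positivity
    have : 1 + ((t - γ) / δ) ^ 2 ≠ 0 := by positivity
    field_simp
  have hcont : Continuous fun t : ℝ => δ / (δ ^ 2 + (t - γ) ^ 2) := by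
    refine continuous_const.div (by fun_prop) fun t => ?_
    positivity
  rw [intervalIntegral.integral_eq_sub_of_hasDerivAt (fun t _ => hderiv t)
    (hcont.intervalIntegrable _ _)]
  linarith [Real.arctan_lt_pi_div_two ((b - γ) / δ), Real.neg_pi_div_two_lt_arctan ((a - γ) / δ)]

theorem continuous_logDeriv_zetaReg_vertical (hRH : RiemannHypothesis) {σ : ℝ} (hσ : 1 / 2 < σ) :
    Continuous fun t : ℝ => logDeriv zetaReg (σ + t * Complex.I) := by
  have h1 : Continuous fun t : ℝ => (σ + t * Complex.I : ℂ) := by fun_prop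
  have h2 : Continuous (deriv zetaReg) :=
    (differentiable_zetaReg.contDiff (n := 1)).continuous_deriv le_rfl
  simp only [logDeriv_apply]
  refine (h2.comp h1).div (differentiable_zetaReg.continuous.comp h1) fun t => ?_
  exact hRH.zetaReg_ne_zero (by simpa using hσ)

/-- The real part of the logarithmic derivative is on average `O(log t)`, uniformly up to the
critical line. -/
theorem RiemannHypothesis.exists_integral_re_logDeriv_zetaReg_le (hRH : RiemannHypothesis) :
    ∃ A : ℝ, 0 < A ∧ ∀ δ : ℝ, 0 < δ → δ ≤ 1 / 4 → ∀ u : ℝ,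
      ∫ t in (u - 1 / 4)..(u + 1 / 4),
        |(logDeriv zetaReg ((1 / 2 + δ : ℝ) + t * Complex.I)).re| ≤ A * Real.log (|u| + 2) := by
  obtain ⟨A, hA, h⟩ := hRH.exists_logDeriv_zetaReg_approx
  refine ⟨A + A * Real.pi, by positivity, fun δ hδ hδ' u => ?_⟩
  obtain ⟨l, hl, hcard, happ⟩ := h u
  have hlog : 0 < Real.log (|u| + 2) := Real.log_pos (by linarith [abs_nonneg u])
  have hP : ∀ m : Multiset ℂ, (∀ ρ ∈ m, ρ.re = 1 / 2) → ∃ P : ℝ → ℝ, Continuous P ∧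
      (∀ t : ℝ, |(m.map fun ρ => 1 / (((1 / 2 + δ : ℝ) + t * Complex.I : ℂ) - ρ)).sum.re| ≤ P t) ∧
      ∫ t in (u - 1 / 4)..(u + 1 / 4), P t ≤ m.card * Real.pi := by
    intro m
    induction m using Multiset.induction_on with
    | empty => exact fun _ => ⟨0, continuous_const, by simp, by simp⟩
    | cons ρ m ih =>
      intro hm
      obtain ⟨P, hPc, hP1, hP2⟩ := ih (fun ρ' h => hm ρ' (Multiset.mem_cons_of_mem h))
      have hc : Continuous fun t : ℝ => δ / (δ ^ 2 + (t - ρ.im) ^ 2) := by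
        refine continuous_const.div (by fun_prop) fun t => ?_
        positivity
      refine ⟨fun t => δ / (δ ^ 2 + (t - ρ.im) ^ 2) + P t, hc.add hPc, fun t => ?_, ?_⟩
      · rw [Multiset.map_cons, Multiset.sum_cons, Complex.add_re]
        refine (abs_add_le _ _).trans (add_le_add (le_of_eq ?_) (hP1 t))
        have h1 : (1 / (((1 / 2 + δ : ℝ) + t * Complex.I : ℂ) - ρ)).re =
            δ / (δ ^ 2 + (t - ρ.im) ^ 2) := by
          rw [one_div, Complex.inv_re, Complex.normSq_apply]
          simp only [Complex.sub_re, Complex.add_re, Complex.ofReal_re, Complex.mul_re,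
            Complex.I_re, Complex.I_im, Complex.ofReal_im, Complex.sub_im, Complex.add_im,
            Complex.mul_im, hm ρ (Multiset.mem_cons_self _ _)]
          ring_nf
        rw [h1, abs_of_pos (by positivity)]
      · rw [intervalIntegral.integral_add (hc.intervalIntegrable _ _)
          (hPc.intervalIntegrable _ _), Multiset.card_cons]
        have := integral_poisson_kernel_le_pi hδ ρ.im (u - 1 / 4) (u + 1 / 4)
        push_cast
        linarith
  obtain ⟨P, hPc, hP1, hP2⟩ := hP l hl
  have hcont : Continuous fun t : ℝ =>
      |(logDeriv zetaReg ((1 / 2 + δ : ℝ) + t * Complex.I)).re| :=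
    (Complex.continuous_re.comp
      (continuous_logDeriv_zetaReg_vertical hRH (by linarith : 1 / 2 < 1 / 2 + δ))).abs
  calc _ ≤ ∫ t in (u - 1 / 4)..(u + 1 / 4), (A * Real.log (|u| + 2) + P t) := by
        refine intervalIntegral.integral_mono_on (by linarith) (hcont.intervalIntegrable _ _)
          ((continuous_const.add hPc).intervalIntegrable _ _) fun t ht => ?_
        have h1 := happ ((1 / 2 + δ : ℝ) + t * Complex.I) (by
          have h2 : (((1 / 2 + δ : ℝ) + t * Complex.I : ℂ) - (2 + u * Complex.I)) =
              ((δ - 3 / 2 : ℝ) : ℂ) + ((t - u : ℝ) : ℂ) * Complex.I := by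
            push_cast; ring
          rw [h2, Complex.norm_add_mul_I, Real.sqrt_le_iff]
          refine ⟨by norm_num, ?_⟩
          nlinarith [ht.1, ht.2]) (hRH.zetaReg_ne_zero (by simpa using hδ))
        have h3 := (Complex.abs_re_le_norm _).trans h1
        rw [Complex.sub_re] at h3
        have h4 := abs_sub_abs_le_abs_sub
          (logDeriv zetaReg ((1 / 2 + δ : ℝ) + t * Complex.I)).re
          (l.map fun ρ => 1 / (((1 / 2 + δ : ℝ) + t * Complex.I : ℂ) - ρ)).sum.re
        linarith [hP1 t]
    _ = 1 / 2 * (A * Real.log (|u| + 2)) + ∫ t in (u - 1 / 4)..(u + 1 / 4), P t := by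
        rw [intervalIntegral.integral_add (continuous_const.intervalIntegrable _ _)
          (hPc.intervalIntegrable _ _), intervalIntegral.integral_const, smul_eq_mul]
        ring
    _ ≤ 1 / 2 * (A * Real.log (|u| + 2)) + A * Real.log (|u| + 2) * Real.pi := by
        gcongr
        exact hP2.trans (by gcongr)
    _ ≤ _ := by nlinarith [mul_pos hA hlog]

theorem Complex.norm_Gamma_one_half_add_mul_I_le (t : ℝ) :
    ‖Complex.Gamma (1 / 2 + t * Complex.I)‖ ≤
      √(2 * Real.pi) * Real.exp (-(Real.pi / 2 * |t|)) := by
  have h1 := Complex.Gamma_mul_Gamma_one_sub (1 / 2 + t * Complex.I)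
  have h2 : (1 : ℂ) - (1 / 2 + t * Complex.I) = (starRingEnd ℂ) (1 / 2 + t * Complex.I) := by
    apply Complex.ext <;> simp; norm_num
  have h3 : Complex.sin (Real.pi * (1 / 2 + t * Complex.I)) = (Real.cosh (Real.pi * t) : ℂ) := by
    rw [show (Real.pi : ℂ) * (1 / 2 + t * Complex.I) =
      (Real.pi * t : ℂ) * Complex.I + Real.pi / 2 by ring, Complex.sin_add_pi_div_two,
      Complex.cos_mul_I]
    push_cast; rfl
  rw [h2, Complex.Gamma_conj, h3, Complex.mul_conj, Complex.normSq_eq_norm_sq] at h1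
  have h4 : ‖Complex.Gamma (1 / 2 + t * Complex.I)‖ ^ 2 = Real.pi / Real.cosh (Real.pi * t) := by
    exact_mod_cast h1
  have h5 : Real.exp (Real.pi * |t|) / 2 ≤ Real.cosh (Real.pi * t) := by
    rw [← Real.cosh_abs, abs_mul, abs_of_pos Real.pi_pos, Real.cosh_eq]
    have := Real.exp_pos (-(Real.pi * |t|))
    linarith
  refine le_of_sq_le_sq ?_ (by positivity)
  rw [h4, mul_pow, Real.sq_sqrt (by positivity), ← Real.exp_nat_mul]
  calc Real.pi / Real.cosh (Real.pi * t) ≤ Real.pi / (Real.exp (Real.pi * |t|) / 2) := by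
        have := Real.pi_pos
        gcongr
    _ = 2 * Real.pi * Real.exp (-(Real.pi * |t|)) := by
        rw [Real.exp_neg]; field_simp
    _ = _ := by congr 2; push_cast; ring

theorem Complex.norm_Gamma_le_Gamma_re {s : ℂ} (hs : 0 < s.re) :
    ‖Complex.Gamma s‖ ≤ Real.Gamma s.re := by
  rw [Complex.Gamma_eq_integral hs, Real.Gamma_eq_integral hs, Complex.GammaIntegral]
  refine (MeasureTheory.norm_integral_le_integral_norm _).trans (le_of_eq ?_)
  refine MeasureTheory.setIntegral_congr_fun measurableSet_Ioi fun x hx => ?_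
  have hx' : (0 : ℝ) < x := hx
  simp only [norm_mul, Complex.norm_real, Real.norm_eq_abs, Real.abs_exp,
    Complex.norm_cpow_eq_rpow_re_of_pos hx', Complex.sub_re, Complex.one_re]

theorem Real.exists_Gamma_le : ∃ B : ℝ, 0 < B ∧ ∀ x ∈ Set.Icc (1 / 2 : ℝ) (3 / 2),
    Real.Gamma x ≤ B := by
  have h : ContinuousOn Real.Gamma (Set.Icc (1 / 2 : ℝ) (3 / 2)) := fun x hx =>
    (Real.differentiableAt_Gamma fun m => by
      have := hx.1
      have := (Nat.cast_nonneg m : (0 : ℝ) ≤ m)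
      linarith).continuousAt.continuousWithinAt
  obtain ⟨B, hB⟩ := (isCompact_Icc.image_of_continuousOn h).bddAbove
  refine ⟨max B 1, by positivity, fun x hx => le_max_of_le_left (hB ⟨x, hx, rfl⟩)⟩

open Complex Filter Asymptotics in
theorem Complex.norm_Gamma_le_of_nonneg_im {s : ℂ} (h1 : 1 / 2 ≤ s.re) (h2 : s.re ≤ 3 / 2)
    (h3 : 0 ≤ s.im) :
    ‖Complex.Gamma s‖ ≤
      7 * (1 + |s.im|) ^ (s.re - 1 / 2) * Real.exp (-(Real.pi / 2 * |s.im|)) := by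
  set T : ℝ := 1 + |s.im| with hT
  have hT1 : 1 ≤ T := by rw [hT]; linarith [abs_nonneg s.im]
  have hT0 : 0 < T := by linarith
  have hTC : (T : ℂ) ≠ 0 := by exact_mod_cast hT0.ne'
  set G : ℂ → ℂ := fun w => Complex.Gamma w * Complex.exp (-(I * Real.pi / 2) * w) *
    (T : ℂ) ^ (-(w - 1 / 2)) * (T / (w + T)) with hG
  have hnorm : ∀ w : ℂ, ‖G w‖ = ‖Complex.Gamma w‖ * Real.exp (Real.pi / 2 * w.im) *
      T ^ (-(w.re - 1 / 2)) * (T / ‖w + T‖) := by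
    intro w
    simp only [hG, norm_mul, Complex.norm_exp, norm_div, Complex.norm_real, Real.norm_eq_abs,
      Complex.norm_cpow_eq_rpow_re_of_pos hT0, abs_of_pos hT0]
    congr 4
    · simp
    · simp
  have hwT : ∀ w : ℂ, 0 ≤ w.re → T ≤ ‖w + T‖ := by
    intro w hw
    have := Complex.re_le_norm (w + T)
    rw [Complex.add_re, Complex.ofReal_re] at this
    linarith
  obtain ⟨B, hB, hΓB⟩ := Real.exists_Gamma_le
  have key : ‖G s‖ ≤ √(2 * Real.pi) := by
    refine PhragmenLindelof.vertical_strip (a := 1 / 2) (b := 3 / 2) ?_ ?_ ?_ ?_ h1 h2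
    · apply DifferentiableOn.diffContOnCl
      intro w hw
      have hw' : w.re ∈ Set.Icc (1 / 2 : ℝ) (3 / 2) := by
        have h := closure_minimal (t := re ⁻¹' Set.Icc (1 / 2 : ℝ) (3 / 2))
          (fun z hz => ⟨hz.1.le, hz.2.le⟩) (isClosed_Icc.preimage continuous_re) hw
        exact h
      have h4 : DifferentiableAt ℂ Complex.Gamma w := Complex.differentiableAt_Gamma _ fun m h => by
        have := hw'.1
        rw [h] at this
        simp at this
        have := (Nat.cast_nonneg m : (0 : ℝ) ≤ m)
        linarith
      have h5 : w + T ≠ 0 := by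
        rw [← norm_pos_iff]
        exact hT0.trans_le (hwT w (by linarith [hw'.1]))
      have h6 : DifferentiableAt ℂ (fun w : ℂ => (T : ℂ) ^ (-(w - 1 / 2))) w :=
        ((differentiableAt_id.sub_const _).neg).const_cpow (.inl hTC)
      have h7 : DifferentiableAt ℂ (fun w : ℂ => Complex.exp (-(I * Real.pi / 2) * w)) w := by
        fun_prop
      exact (((h4.mul h7).mul h6).mul ((differentiableAt_const _).div
        (differentiableAt_id.add_const _) h5)).differentiableWithinAt
    · refine ⟨1, by norm_num; linarith [Real.pi_gt_three], Real.pi / 2, ?_⟩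
      refine IsBigO.of_bound B ?_
      refine Filter.eventually_inf_principal.2 (Filter.Eventually.of_forall fun w hw => ?_)
      have hw1 : 1 / 2 < w.re := hw.1
      have hw2 : w.re < 3 / 2 := hw.2
      rw [hnorm, Real.norm_eq_abs, Real.abs_exp]
      have h4 : ‖Complex.Gamma w‖ ≤ B :=
        (Complex.norm_Gamma_le_Gamma_re (by linarith)).trans (hΓB _ ⟨hw1.le, hw2.le⟩)
      have h5 : T ^ (-(w.re - 1 / 2)) ≤ 1 := Real.rpow_le_one_of_one_le_of_nonpos hT1 (by linarith)
      have h6 : T / ‖w + T‖ ≤ 1 := by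
        have := hwT w (by linarith)
        rw [div_le_one (hT0.trans_le this)]; exact this
      calc _ ≤ B * Real.exp (Real.pi / 2 * w.im) * 1 * 1 := by gcongr
        _ ≤ B * Real.exp (Real.pi / 2 * Real.exp (1 * |w.im|)) := by
          rw [mul_one, mul_one]
          gcongr
          have := Real.add_one_le_exp (1 * |w.im|)
          linarith [le_abs_self w.im]
    · intro w hw
      have h4 : w = 1 / 2 + w.im * I := by
        apply Complex.ext <;> simp [hw]
      rw [hnorm, hw, sub_self, neg_zero, Real.rpow_zero, mul_one]
      have h5 := Complex.norm_Gamma_one_half_add_mul_I_le w.im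
      rw [← h4] at h5
      have h6 : T / ‖w + T‖ ≤ 1 := by
        have := hwT w (by linarith)
        rw [div_le_one (hT0.trans_le this)]; exact this
      calc _ ≤ √(2 * Real.pi) * Real.exp (-(Real.pi / 2 * |w.im|)) *
            Real.exp (Real.pi / 2 * |w.im|) * 1 := by
            gcongr
            exact le_abs_self _
        _ = _ := by rw [mul_assoc (√_), ← Real.exp_add]; simp
    · intro w hw
      set v : ℂ := 1 / 2 + w.im * I with hv
      have h4 : w = v + 1 := by
        apply Complex.ext <;> simp [hv, hw]; norm_num
      have hv0 : v ≠ 0 := by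
        intro h
        have := congrArg Complex.re h
        simp [hv] at this
      have h5 := Complex.norm_Gamma_one_half_add_mul_I_le w.im
      rw [← hv] at h5
      have h8 : ‖v‖ ≤ ‖w + T‖ := by
        rw [← sq_le_sq₀ (norm_nonneg _) (norm_nonneg _), Complex.sq_norm, Complex.sq_norm,
          Complex.normSq_apply, Complex.normSq_apply]
        simp [hv, hw]
        nlinarith
      have h9 : 0 < ‖w + T‖ := hT0.trans_le (hwT w (by linarith))
      rw [hnorm, hw, show Complex.Gamma w = v * Complex.Gamma v by
        rw [h4]; exact Complex.Gamma_add_one v hv0, norm_mul,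
        show (-(3 / 2 - 1 / 2) : ℝ) = -1 by norm_num, Real.rpow_neg_one]
      calc _ ≤ ‖v‖ * (√(2 * Real.pi) * Real.exp (-(Real.pi / 2 * |w.im|))) *
            Real.exp (Real.pi / 2 * |w.im|) * T⁻¹ * (T / ‖w + T‖) := by
            gcongr
            exact le_abs_self _
        _ = √(2 * Real.pi) * (‖v‖ / ‖w + T‖) := by
            rw [Real.exp_neg]
            field_simp
        _ ≤ √(2 * Real.pi) * 1 := by
            gcongr
            rwa [div_le_one h9]
        _ = _ := mul_one _
  rw [hnorm] at key
  have hsT : ‖s + T‖ ≤ 5 / 2 * T := by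
    have h4 : ‖s‖ ≤ |s.re| + |s.im| := Complex.norm_le_abs_re_add_abs_im s
    rw [abs_of_nonneg (by linarith : 0 ≤ s.re)] at h4
    have h5 := norm_add_le s (T : ℂ)
    rw [Complex.norm_real, Real.norm_eq_abs, abs_of_pos hT0] at h5
    linarith
  have hsT0 : 0 < ‖s + T‖ := hT0.trans_le (hwT s (by linarith))
  have h2π : √(2 * Real.pi) * (5 / 2) ≤ 7 := by
    have : √(2 * Real.pi) ≤ 14 / 5 := by
      rw [Real.sqrt_le_iff]
      constructor
      · norm_num
      · nlinarith [Real.pi_lt_d2]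
    linarith
  have h10 : (2 / 5 : ℝ) ≤ T / ‖s + T‖ := by
    rw [le_div_iff₀ hsT0]; linarith
  have h11 : ‖Complex.Gamma s‖ * Real.exp (Real.pi / 2 * s.im) * T ^ (-(s.re - 1 / 2)) ≤ 7 := by
    have h12 : ‖Complex.Gamma s‖ * Real.exp (Real.pi / 2 * s.im) * T ^ (-(s.re - 1 / 2)) * (2 / 5)
        ≤ √(2 * Real.pi) := le_trans (by gcongr) key
    linarith
  rw [abs_of_nonneg h3] at *
  calc ‖Complex.Gamma s‖ = ‖Complex.Gamma s‖ * Real.exp (Real.pi / 2 * s.im) *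
        T ^ (-(s.re - 1 / 2)) * T ^ (s.re - 1 / 2) * Real.exp (-(Real.pi / 2 * s.im)) := by
        rw [Real.rpow_neg hT0.le, Real.exp_neg]
        have : T ^ (s.re - 1 / 2) ≠ 0 := by positivity
        field_simp
    _ ≤ _ := by gcongr

/-- Stirling-type bound for the Gamma function in the strip `1 / 2 ≤ re s ≤ 3 / 2`. -/
theorem Complex.norm_Gamma_le {s : ℂ} (h1 : 1 / 2 ≤ s.re) (h2 : s.re ≤ 3 / 2) :
    ‖Complex.Gamma s‖ ≤
      7 * (1 + |s.im|) ^ (s.re - 1 / 2) * Real.exp (-(Real.pi / 2 * |s.im|)) := by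
  rcases le_total 0 s.im with h | h
  · exact Complex.norm_Gamma_le_of_nonneg_im h1 h2 h
  · have := Complex.norm_Gamma_le_of_nonneg_im (s := (starRingEnd ℂ) s) (by simpa using h1)
      (by simpa using h2) (by simpa using h)
    rw [Complex.Gamma_conj, RCLike.norm_conj] at this
    simpa using this

theorem one_add_abs_pow_mul_exp_le {ϑ : ℝ} (hϑ : 0 < ϑ) (m : ℕ) (t : ℝ) :
    (1 + |t|) ^ m * Real.exp (-(ϑ * |t|)) ≤ m.factorial * Real.exp ϑ / ϑ ^ m := by
  have h := Real.pow_div_factorial_le_exp (ϑ * (1 + |t|)) (by positivity) m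
  have h0 : (0 : ℝ) < m.factorial := by exact_mod_cast m.factorial_pos
  rw [div_le_iff₀ h0, mul_pow, mul_add, Real.exp_add, mul_one] at h
  rw [le_div_iff₀ (by positivity), Real.exp_neg]
  have he := Real.exp_pos (ϑ * |t|)
  rw [mul_right_comm, ← div_eq_mul_inv, div_le_iff₀ he]
  linarith

theorem arg_gap_pos {z : ℂ} (hz : 0 < z.re) : 0 < Real.pi / 2 - |z.arg| :=
  sub_pos.2 (Complex.abs_arg_lt_pi_div_two_iff.2 (.inl hz))

theorem norm_cpow_neg_le {z : ℂ} (hz : z ≠ 0) (s : ℂ) :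
    ‖z ^ (-s)‖ ≤ ‖z‖ ^ (-s.re) * Real.exp (|z.arg| * |s.im|) := by
  rw [Complex.norm_cpow_of_ne_zero hz, Complex.neg_re, Complex.neg_im, div_eq_mul_inv,
    ← Real.exp_neg]
  gcongr
  rw [← abs_mul]
  have := le_abs_self (z.arg * s.im)
  linarith

theorem norm_Gamma_mul_cpow_le {z : ℂ} (hz : 0 < z.re) {s : ℂ} (h1 : 1 / 2 ≤ s.re)
    (h2 : s.re ≤ 3 / 2) :
    ‖Complex.Gamma s * z ^ (-s)‖ ≤ 7 * ‖z‖ ^ (-s.re) *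
      ((1 + |s.im|) ^ (s.re - 1 / 2) * Real.exp (-((Real.pi / 2 - |z.arg|) * |s.im|))) := by
  have hz0 : z ≠ 0 := by rintro rfl; simp at hz
  rw [norm_mul]
  calc _ ≤ (7 * (1 + |s.im|) ^ (s.re - 1 / 2) * Real.exp (-(Real.pi / 2 * |s.im|))) *
        (‖z‖ ^ (-s.re) * Real.exp (|z.arg| * |s.im|)) := by
        gcongr
        · exact Complex.norm_Gamma_le h1 h2
        · exact norm_cpow_neg_le hz0 s
    _ = _ := by
        rw [show -((Real.pi / 2 - |z.arg|) * |s.im|) =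
          -(Real.pi / 2 * |s.im|) + |z.arg| * |s.im| by ring, Real.exp_add]
        ring

/-- Polynomial growth against exponential decay, in integrable form. -/
theorem exists_one_add_abs_pow_mul_exp_le {ϑ : ℝ} (hϑ : 0 < ϑ) (m : ℕ) :
    ∃ C : ℝ, 0 < C ∧ ∀ t : ℝ,
      (1 + |t|) ^ m * Real.exp (-(ϑ * |t|)) ≤ C * (1 + t ^ 2)⁻¹ := by
  refine ⟨(m + 2).factorial * Real.exp ϑ / ϑ ^ (m + 2), by positivity, fun t => ?_⟩
  have h := one_add_abs_pow_mul_exp_le hϑ (m + 2) t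
  rw [← div_eq_mul_inv, le_div_iff₀ (by positivity)]
  refine le_trans ?_ h
  rw [pow_add, mul_right_comm]
  gcongr
  nlinarith [abs_nonneg t, sq_abs t]

theorem integrable_Gamma_mul_cpow {z : ℂ} (hz : 0 < z.re) {σ : ℝ} (h1 : 1 / 2 ≤ σ)
    (h2 : σ ≤ 3 / 2) :
    MeasureTheory.Integrable fun t : ℝ =>
      Complex.Gamma (σ + t * Complex.I) * z ^ (-(σ + t * Complex.I) : ℂ) := by
  have hz0 : z ≠ 0 := by rintro rfl; simp at hz
  obtain ⟨C, hC, h⟩ := exists_one_add_abs_pow_mul_exp_le (arg_gap_pos hz) 1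
  have hcont : Continuous fun t : ℝ =>
      Complex.Gamma (σ + t * Complex.I) * z ^ (-(σ + t * Complex.I) : ℂ) := by
    refine Continuous.mul ?_ ?_
    · refine continuous_iff_continuousAt.2 fun t => ?_
      refine ContinuousAt.comp (f := fun t : ℝ => (σ + t * Complex.I : ℂ))
        (Complex.differentiableAt_Gamma _ fun m h => ?_).continuousAt (by fun_prop)
      have := congrArg Complex.re h
      simp at this
      have := (Nat.cast_nonneg m : (0 : ℝ) ≤ m)
      linarith
    · exact Continuous.const_cpow (by fun_prop) (.inl hz0)
  refine (integrable_inv_one_add_sq.const_mul (7 * ‖z‖ ^ (-σ) * C)).mono'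
    hcont.aestronglyMeasurable (Filter.Eventually.of_forall fun t => ?_)
  have h3 := norm_Gamma_mul_cpow_le hz (s := σ + t * Complex.I) (by simpa using h1)
    (by simpa using h2)
  simp only [Complex.add_re, Complex.ofReal_re, Complex.mul_re, Complex.I_re, mul_zero,
    Complex.ofReal_im, Complex.I_im, mul_one, sub_self, add_zero, Complex.add_im, Complex.mul_im,
    zero_add] at h3
  refine h3.trans ?_
  rw [mul_assoc (7 * ‖z‖ ^ (-σ))]
  refine mul_le_mul_of_nonneg_left (le_trans ?_ (h t)) (by positivity)
  have h4 : (1 + |t|) ^ (σ - 1 / 2) ≤ (1 + |t|) ^ (1 : ℝ) :=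
    Real.rpow_le_rpow_of_exponent_le (by linarith [abs_nonneg t]) (by linarith)
  rw [Real.rpow_one] at h4
  rw [pow_one]
  gcongr

open MeasureTheory in
theorem mellin_cexp_neg_mul {z s : ℂ} (hz : 0 < z.re) (hs : 0 < s.re) :
    MellinConvergent (fun x : ℝ => Complex.exp (-z * x)) s ∧
      mellin (fun x : ℝ => Complex.exp (-z * x)) s = z ^ (-s) * Complex.Gamma s := by
  have hcont : ∀ (w a : ℂ), ContinuousOn (fun x : ℝ => (x : ℂ) ^ a * Complex.exp (-w * x))
      (Set.Ioi 0) := fun w a => by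
    refine ContinuousOn.mul (fun x hx => ?_) (by fun_prop)
    exact (Complex.continuousAt_ofReal_cpow_const x a
      (.inr (ne_of_gt hx))).continuousWithinAt
  have hint : ∀ (ε b : ℝ), 0 < ε → -1 < b →
      IntegrableOn (fun x : ℝ => x ^ b * Real.exp (-ε * x)) (Set.Ioi 0) := fun ε b hε hb =>
    (integrableOn_rpow_mul_exp_neg_mul_rpow hb one_pos hε).congr_fun (by
      intro x hx; simp) measurableSet_Ioi
  have hnorm : ∀ (w a : ℂ) (x : ℝ), 0 < x →
      ‖(x : ℂ) ^ a * Complex.exp (-w * x)‖ = x ^ a.re * Real.exp (-w.re * x) := by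
    intro w a x hx
    rw [norm_mul, Complex.norm_cpow_eq_rpow_re_of_pos hx, Complex.norm_exp]
    simp
  have hconv : ∀ (w a : ℂ), 0 < w.re → -1 < a.re →
      IntegrableOn (fun x : ℝ => (x : ℂ) ^ a * Complex.exp (-w * x)) (Set.Ioi 0) := by
    intro w a hw ha
    refine (hint w.re a.re hw ha).mono'
      ((hcont w a).aestronglyMeasurable measurableSet_Ioi) ?_
    refine (ae_restrict_iff' measurableSet_Ioi).2 (Filter.Eventually.of_forall fun x hx => ?_)
    exact (hnorm w a x hx).le
  refine ⟨hconv z (s - 1) hz (by simpa using hs), ?_⟩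
  set F : ℂ → ℂ := fun w => ∫ x in Set.Ioi (0 : ℝ), (x : ℂ) ^ (s - 1) * Complex.exp (-w * x)
  have hU : IsOpen {w : ℂ | 0 < w.re} := isOpen_lt continuous_const Complex.continuous_re
  have hF : DifferentiableOn ℂ F {w : ℂ | 0 < w.re} := by
    intro w₀ hw₀
    have hw₀' : 0 < w₀.re := hw₀
    have hnhds : {w : ℂ | w₀.re / 2 < w.re} ∈ nhds w₀ :=
      (isOpen_lt continuous_const Complex.continuous_re).mem_nhds
        (show w₀.re / 2 < w₀.re by linarith)
    have := hasDerivAt_integral_of_dominated_loc_of_deriv_le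
      (μ := volume.restrict (Set.Ioi (0 : ℝ))) (x₀ := w₀)
      (F := fun w (x : ℝ) => (x : ℂ) ^ (s - 1) * Complex.exp (-w * x))
      (F' := fun w (x : ℝ) => -((x : ℂ) ^ s * Complex.exp (-w * x)))
      (bound := fun x : ℝ => x ^ s.re * Real.exp (-(w₀.re / 2) * x)) hnhds
      (Filter.Eventually.of_forall fun w =>
        (hcont w (s - 1)).aestronglyMeasurable measurableSet_Ioi)
      (hconv w₀ (s - 1) hw₀ (by simpa using hs))
      ((hcont w₀ s).neg.aestronglyMeasurable measurableSet_Ioi)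
      ((ae_restrict_iff' measurableSet_Ioi).2 (Filter.Eventually.of_forall fun x hx w hw => by
        rw [norm_neg, hnorm w s x hx]
        have hx' : (0 : ℝ) < x := hx
        have hw' : w₀.re / 2 < w.re := hw
        gcongr))
      (hint _ _ (by linarith) (by linarith))
      ((ae_restrict_iff' measurableSet_Ioi).2 (Filter.Eventually.of_forall fun x hx w hw => by
        have hx' : (x : ℂ) ≠ 0 := by exact_mod_cast (ne_of_gt hx)
        have h1 : HasDerivAt (fun w : ℂ => Complex.exp (-w * x))
            (Complex.exp (-w * x) * (-1 * x)) w :=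
          (((hasDerivAt_id' w).neg).mul_const (x : ℂ)).cexp
        have h2 := h1.const_mul ((x : ℂ) ^ (s - 1))
        refine h2.congr_deriv ?_
        rw [Complex.cpow_sub _ _ hx', Complex.cpow_one]
        field_simp))
    exact this.2.differentiableAt.differentiableWithinAt
  have hG : DifferentiableOn ℂ (fun w : ℂ => w ^ (-s) * Complex.Gamma s) {w : ℂ | 0 < w.re} := by
    intro w hw
    exact ((differentiableAt_id.cpow_const (.inl hw)).mul_const _).differentiableWithinAt
  have hfreq : ∃ᶠ w in nhdsWithin (1 : ℂ) {1}ᶜ, F w = w ^ (-s) * Complex.Gamma s := by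
    have h1 : ∀ r : ℝ, 0 < r → F r = (r : ℂ) ^ (-s) * Complex.Gamma s := by
      intro r hr
      have := Complex.integral_cpow_mul_exp_neg_mul_Ioi hs hr
      simp only [F, neg_mul]
      rw [this, one_div, Complex.inv_cpow _ _ (by
        rw [Complex.arg_ofReal_of_nonneg hr.le]; exact Real.pi_ne_zero.symm), Complex.cpow_neg]
    have h2 : Filter.Tendsto (fun x : ℝ => (x : ℂ)) (nhdsWithin 1 {1}ᶜ)
        (nhdsWithin (1 : ℂ) {1}ᶜ) := by
      refine tendsto_nhdsWithin_iff.2 ⟨?_, ?_⟩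
      · have : Filter.Tendsto (fun x : ℝ => (x : ℂ)) (nhds 1) (nhds ((1 : ℝ) : ℂ)) :=
          Complex.continuous_ofReal.tendsto 1
        rw [Complex.ofReal_one] at this
        exact this.mono_left nhdsWithin_le_nhds
      · filter_upwards [self_mem_nhdsWithin] with x hx
        simpa using hx
    refine h2.frequently ?_
    refine Filter.Eventually.frequently ?_
    filter_upwards [mem_nhdsWithin_of_mem_nhds (Ioi_mem_nhds (zero_lt_one' ℝ))] with r hr
    exact h1 r hr
  have := (hF.analyticOnNhd hU).eqOn_of_preconnected_of_frequently_eq (hG.analyticOnNhd hU)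
    (convex_halfSpace_re_gt 0).isPreconnected (z₀ := 1) (by simp) hfreq hz
  simpa only [mellin, smul_eq_mul, F] using this

theorem cexp_neg_eq_integral_Gamma {z : ℂ} (hz : 0 < z.re) {σ : ℝ} (h1 : 1 / 2 ≤ σ)
    (h2 : σ ≤ 3 / 2) :
    Complex.exp (-z) = 1 / (2 * Real.pi) * ∫ t : ℝ,
      Complex.Gamma (σ + t * Complex.I) * z ^ (-(σ + t * Complex.I) : ℂ) := by
  have hm : ∀ t : ℝ, mellin (fun x : ℝ => Complex.exp (-z * x)) (σ + t * Complex.I) =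
      Complex.Gamma (σ + t * Complex.I) * z ^ (-(σ + t * Complex.I) : ℂ) := fun t => by
    rw [(mellin_cexp_neg_mul hz (by simp; linarith)).2, mul_comm]
  have h := mellinInv_mellin_eq σ (fun x : ℝ => Complex.exp (-z * x)) one_pos
    (mellin_cexp_neg_mul hz (by simp; linarith)).1
    (by
      have := integrable_Gamma_mul_cpow hz h1 h2
      exact this.congr (Filter.Eventually.of_forall fun t => (hm t).symm))
    (by fun_prop)
  simp only [mellinInv, Complex.ofReal_one, Complex.one_cpow, mul_one, hm, one_smul] at h
  rw [← h, Complex.real_smul]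
  push_cast
  rfl

open Complex MeasureTheory Filter in
/-- Shifting a vertical line of integration. -/
theorem integrable_and_integral_vertical_eq {G : ℂ → ℂ} {a b C : ℝ} (hab : a ≤ b)
    (hG : ∀ s : ℂ, a ≤ s.re → s.re ≤ b → DifferentiableAt ℂ G s)
    (hC : ∀ s : ℂ, a ≤ s.re → s.re ≤ b → ‖G s‖ ≤ C * (1 + s.im ^ 2)⁻¹) :
    (∀ x, a ≤ x → x ≤ b → Integrable fun t : ℝ => G (x + t * I)) ∧
      ∫ t : ℝ, G (a + t * I) = ∫ t : ℝ, G (b + t * I) := by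
  have hint : ∀ x, a ≤ x → x ≤ b → Integrable fun t : ℝ => G (x + t * I) := by
    intro x h1 h2
    refine (integrable_inv_one_add_sq.const_mul C).mono' ?_ (Eventually.of_forall fun t => ?_)
    · refine Continuous.aestronglyMeasurable (continuous_iff_continuousAt.2 fun t => ?_)
      exact ContinuousAt.comp (f := fun t : ℝ => (x + t * I : ℂ))
        (hG _ (by simpa using h1) (by simpa using h2)).continuousAt (by fun_prop)
    · simpa using hC (x + t * I) (by simpa using h1) (by simpa using h2)
  refine ⟨hint, ?_⟩
  have hlim : ∀ x, a ≤ x → x ≤ b → Tendsto (fun T : ℝ => ∫ t in (-T)..T, G (x + t * I)) atTop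
      (nhds (∫ t : ℝ, G (x + t * I))) := fun x h1 h2 =>
    intervalIntegral_tendsto_integral (hint x h1 h2) tendsto_neg_atTop_atBot tendsto_id
  have hinv : Tendsto (fun T : ℝ => C * (1 + T ^ 2)⁻¹ * |b - a|) atTop (nhds 0) := by
    have h1 : Tendsto (fun T : ℝ => (1 + T ^ 2)⁻¹) atTop (nhds 0) :=
      tendsto_inv_atTop_zero.comp (tendsto_atTop_add_const_left _ _ (tendsto_pow_atTop two_ne_zero))
    simpa using (h1.const_mul C).mul_const |b - a|
  have hhor : ∀ T : ℝ, ‖∫ x in a..b, G (x + T * I)‖ ≤ C * (1 + T ^ 2)⁻¹ * |b - a| := fun T =>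
    intervalIntegral.norm_integral_le_of_norm_le_const fun x hx => by
      rw [Set.uIoc_of_le hab] at hx
      simpa using hC (x + T * I) (by simpa using hx.1.le) (by simpa using hx.2)
  have hrect : ∀ T : ℝ, (∫ t in (-T)..T, G (b + t * I)) - (∫ t in (-T)..T, G (a + t * I)) =
      -I * ((∫ x in a..b, G (x + T * I)) - ∫ x in a..b, G (x + (-T : ℝ) * I)) := by
    intro T
    have h := Complex.integral_boundary_rect_eq_zero_of_differentiableOn G (a + (-T : ℝ) * I)
      (b + T * I) (fun s hs => by
        rw [mem_reProdIm] at hs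
        have h1 := hs.1
        simp [Set.uIcc_of_le hab] at h1
        exact (hG s h1.1 h1.2).differentiableWithinAt)
    simp only [add_re, ofReal_re, mul_re, I_re, mul_zero, ofReal_im, I_im, mul_one, sub_self,
      add_zero, add_im, mul_im, zero_add, smul_eq_mul] at h
    linear_combination -I * h + ((∫ t in (-T)..T, G (b + t * I)) -
      (∫ t in (-T)..T, G (a + t * I))) * I_sq
  have h0 : Tendsto (fun T : ℝ => -I * ((∫ x in a..b, G (x + T * I)) -
      ∫ x in a..b, G (x + (-T : ℝ) * I))) atTop (nhds 0) := by
    have h1 : Tendsto (fun T : ℝ => ∫ x in a..b, G (x + T * I)) atTop (nhds 0) :=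
      squeeze_zero_norm hhor hinv
    have h2 : Tendsto (fun T : ℝ => ∫ x in a..b, G (x + (-T : ℝ) * I)) atTop (nhds 0) :=
      squeeze_zero_norm (fun T => by simpa using hhor (-T)) hinv
    simpa using (h1.sub h2).const_mul (-I)
  have h1 := (hlim b hab le_rfl).sub (hlim a le_rfl hab)
  have h2 := tendsto_nhds_unique (h1.congr hrect) h0
  exact (sub_eq_zero.1 h2).symm

theorem norm_Gamma_le_of_re_pos {a : ℝ} (ha : 0 < a) (ha1 : a ≤ 1) {s : ℂ} (h1 : a ≤ s.re)
    (h2 : s.re ≤ 3 / 2) :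
    ‖Complex.Gamma s‖ ≤ 7 / a * (1 + |s.im|) * Real.exp (-(Real.pi / 2 * |s.im|)) := by
  have hT : 1 ≤ 1 + |s.im| := by linarith [abs_nonneg s.im]
  have h7 : 7 ≤ 7 / a := by rw [le_div_iff₀ ha]; linarith
  rcases le_total (1 / 2) s.re with h | h
  · refine (Complex.norm_Gamma_le h h2).trans ?_
    gcongr
    calc (1 + |s.im|) ^ (s.re - 1 / 2) ≤ (1 + |s.im|) ^ (1 : ℝ) :=
          Real.rpow_le_rpow_of_exponent_le hT (by linarith)
      _ = _ := Real.rpow_one _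
  · have hs0 : s ≠ 0 := by rintro rfl; simp at h1; linarith
    have h3 := Complex.norm_Gamma_le (s := s + 1) (by simp; linarith) (by simp; linarith)
    rw [Complex.Gamma_add_one s hs0, norm_mul] at h3
    simp only [Complex.add_im, Complex.one_im, add_zero, Complex.add_re, Complex.one_re] at h3
    have h4 : a ≤ ‖s‖ := h1.trans (Complex.re_le_norm s)
    have h5 : (1 + |s.im|) ^ (s.re + 1 - 1 / 2) ≤ 1 + |s.im| := by
      calc (1 + |s.im|) ^ (s.re + 1 - 1 / 2) ≤ (1 + |s.im|) ^ (1 : ℝ) :=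
          Real.rpow_le_rpow_of_exponent_le hT (by linarith)
        _ = _ := Real.rpow_one _
    have h6 : a * ‖Complex.Gamma s‖ ≤
        7 * (1 + |s.im|) * Real.exp (-(Real.pi / 2 * |s.im|)) :=
      calc _ ≤ ‖s‖ * ‖Complex.Gamma s‖ := by gcongr
        _ ≤ _ := h3
        _ ≤ _ := by gcongr
    rw [div_mul_eq_mul_div, div_mul_eq_mul_div, le_div_iff₀ ha]
    linarith

theorem rpow_neg_le_add {x a b σ : ℝ} (hx : 0 < x) (h1 : a ≤ σ) (h2 : σ ≤ b) :
    x ^ (-σ) ≤ x ^ (-a) + x ^ (-b) := by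
  rcases le_total 1 x with h | h
  · have := Real.rpow_le_rpow_of_exponent_le h (neg_le_neg h1)
    have := Real.rpow_pos_of_pos hx (-b)
    linarith
  · have := Real.rpow_le_rpow_of_exponent_ge hx h (neg_le_neg h2)
    have := Real.rpow_pos_of_pos hx (-a)
    linarith

/-- A function of polynomial growth times the Mellin kernel decays on vertical strips. -/
theorem exists_norm_mul_Gamma_mul_cpow_le {z : ℂ} (hz : 0 < z.re) {a b B : ℝ} (ha : 0 < a)
    (hb : b ≤ 3 / 2) (ha1 : a ≤ 1) (hB : 0 < B) {h : ℂ → ℂ}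
    (hh : ∀ s : ℂ, a ≤ s.re → s.re ≤ b → ‖h s‖ ≤ B * (1 + |s.im|)) :
    ∃ C : ℝ, ∀ s : ℂ, a ≤ s.re → s.re ≤ b →
      ‖h s * (Complex.Gamma s * z ^ (-s))‖ ≤ C * (1 + s.im ^ 2)⁻¹ := by
  have hz0 : z ≠ 0 := by rintro rfl; simp at hz
  have hzn : 0 < ‖z‖ := norm_pos_iff.2 hz0
  obtain ⟨C, hC, hexp⟩ := exists_one_add_abs_pow_mul_exp_le (arg_gap_pos hz) 2
  refine ⟨B * (7 / a) * (‖z‖ ^ (-a) + ‖z‖ ^ (-b)) * C, fun s h1 h2 => ?_⟩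
  rw [norm_mul, norm_mul]
  calc _ ≤ (B * (1 + |s.im|)) * ((7 / a * (1 + |s.im|) * Real.exp (-(Real.pi / 2 * |s.im|))) *
        ((‖z‖ ^ (-a) + ‖z‖ ^ (-b)) * Real.exp (|z.arg| * |s.im|))) := by
        gcongr
        · exact hh s h1 h2
        · exact norm_Gamma_le_of_re_pos ha ha1 h1 (h2.trans hb)
        · refine (norm_cpow_neg_le hz0 s).trans ?_
          gcongr
          exact rpow_neg_le_add hzn h1 h2
    _ = B * (7 / a) * (‖z‖ ^ (-a) + ‖z‖ ^ (-b)) * ((1 + |s.im|) ^ 2 *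
          Real.exp (-((Real.pi / 2 - |z.arg|) * |s.im|))) := by
        rw [show -((Real.pi / 2 - |z.arg|) * |s.im|) =
          -(Real.pi / 2 * |s.im|) + |z.arg| * |s.im| by ring, Real.exp_add]
        ring
    _ ≤ _ := by
        rw [mul_assoc _ C]
        exact mul_le_mul_of_nonneg_left (hexp s.im) (by positivity)

theorem differentiableAt_Gamma_mul_cpow {z : ℂ} (hz : 0 < z.re) {s : ℂ} (hs : 0 < s.re) :
    DifferentiableAt ℂ (fun s => Complex.Gamma s * z ^ (-s)) s := by
  have hz0 : z ≠ 0 := by rintro rfl; simp at hz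
  refine (Complex.differentiableAt_Gamma _ fun m h => ?_).mul
    (differentiableAt_id.neg.const_cpow (.inl hz0))
  rw [h] at hs
  simp at hs
  have := (Nat.cast_nonneg m : (0 : ℝ) ≤ m)
  linarith

theorem logDeriv_zetaReg_of_one_lt_re {s : ℂ} (hs : 1 < s.re) :
    logDeriv zetaReg s =
      1 / (s - 1) - LSeries (fun n => (ArithmeticFunction.vonMangoldt n : ℂ)) s := by
  have hs1 : s ≠ 1 := by rintro rfl; simp at hs
  have hζ := riemannZeta_ne_zero_of_one_lt_re hs
  have h1 : logDeriv zetaReg s = logDeriv (fun s => (s - 1) * riemannZeta s) s := by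
    have : zetaReg =ᶠ[nhds s] fun s => (s - 1) * riemannZeta s := by
      filter_upwards [isOpen_ne.mem_nhds hs1] with w hw
      exact zetaReg_of_ne hw
    rw [logDeriv_apply, logDeriv_apply, this.deriv_eq, this.eq_of_nhds]
  rw [h1, logDeriv_mul (f := fun s => s - 1) (g := riemannZeta) s (sub_ne_zero.2 hs1) hζ (by fun_prop) (differentiableAt_riemannZeta hs1),
    ArithmeticFunction.LSeries_vonMangoldt_eq_deriv_riemannZeta_div hs]
  simp only [logDeriv_apply]
  rw [deriv_sub_const, deriv_id'']
  ring

theorem RiemannHypothesis.differentiableAt_logDeriv_zetaReg (hRH : RiemannHypothesis) {s : ℂ}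
    (hs : 1 / 2 < s.re) : DifferentiableAt ℂ (logDeriv zetaReg) s := by
  have h : Differentiable ℂ (deriv zetaReg) :=
    (differentiable_zetaReg.contDiff (n := 2)).differentiable_deriv_two
  exact (h s).div (differentiable_zetaReg s) (hRH.zetaReg_ne_zero hs)

theorem log_abs_add_two_le (t : ℝ) : Real.log (|t| + 2) ≤ 1 + |t| := by
  have := Real.log_le_sub_one_of_pos (show 0 < |t| + 2 by positivity)
  linarith

/-- The power series generating function of the von Mangoldt function at `e^{-z}`. -/
noncomputable def vonMangoldtSum (z : ℂ) : ℂ :=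
  ∑' n : ℕ, (ArithmeticFunction.vonMangoldt n : ℂ) * Complex.exp (-(n * z))

open Complex MeasureTheory in
theorem vonMangoldtSum_eq_integral {z : ℂ} (hz : 0 < z.re) :
    vonMangoldtSum z = 1 / (2 * Real.pi) * ∫ t : ℝ,
      LSeries (fun n => (ArithmeticFunction.vonMangoldt n : ℂ)) ((3 / 2 : ℝ) + t * I) *
        (Gamma ((3 / 2 : ℝ) + t * I) * z ^ (-((3 / 2 : ℝ) + t * I) : ℂ)) := by
  set Λ : ℕ → ℂ := fun n => (ArithmeticFunction.vonMangoldt n : ℂ) with hΛ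
  have hint := integrable_Gamma_mul_cpow hz (σ := 3 / 2) (by norm_num) le_rfl
  set K : ℝ → ℂ := fun t => Gamma ((3 / 2 : ℝ) + t * I) * z ^ (-((3 / 2 : ℝ) + t * I) : ℂ)
  have hterm : ∀ n : ℕ, Λ n * exp (-(n * z)) = 1 / (2 * Real.pi) * ∫ t : ℝ,
      LSeries.term Λ ((3 / 2 : ℝ) + t * I) n * K t := by
    intro n
    rcases Nat.eq_zero_or_pos n with rfl | hn
    · simp [hΛ]
    have hn' : (0 : ℝ) < n := by exact_mod_cast hn
    have hz0 : z ≠ 0 := by rintro rfl; simp at hz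
    rw [cexp_neg_eq_integral_Gamma (z := n * z) (by simpa using mul_pos hn' hz) (σ := 3 / 2)
      (by norm_num) le_rfl, mul_left_comm, ← integral_const_mul]
    congr 2
    ext t
    rw [LSeries.term_of_ne_zero hn.ne']
    have h1 : ((n : ℂ) * z) ^ (-((3 / 2 : ℝ) + t * I) : ℂ) =
        (n : ℂ) ^ (-((3 / 2 : ℝ) + t * I) : ℂ) * z ^ (-((3 / 2 : ℝ) + t * I) : ℂ) := by
      have hn0 : (n : ℂ) ≠ 0 := by exact_mod_cast hn.ne'
      have hlog := Complex.log_ofReal_mul hn' hz0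
      rw [cpow_def_of_ne_zero (mul_ne_zero hn0 hz0), cpow_def_of_ne_zero hn0,
        cpow_def_of_ne_zero hz0, ← Complex.exp_add, ← add_mul, ← Complex.natCast_log,
        ← hlog]
      simp
    rw [h1, cpow_neg]
    simp only [K]
    ring
  have hnorm : ∀ (n : ℕ) (t : ℝ), ‖LSeries.term Λ ((3 / 2 : ℝ) + t * I) n‖ =
      ‖LSeries.term Λ (3 / 2 : ℝ) n‖ := by
    intro n t
    rw [LSeries.norm_term_eq, LSeries.norm_term_eq]
    simp
  have hsumm : Summable fun n => ‖LSeries.term Λ (3 / 2 : ℝ) n‖ :=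
    (ArithmeticFunction.LSeriesSummable_vonMangoldt (s := (3 / 2 : ℝ)) (by norm_num)).norm
  have hcont : ∀ n, Continuous fun t : ℝ => LSeries.term Λ ((3 / 2 : ℝ) + t * I) n := by
    intro n
    rcases Nat.eq_zero_or_pos n with rfl | hn
    · simp only [LSeries.term_zero]; exact continuous_const
    · simp only [LSeries.term_of_ne_zero hn.ne']
      have hn0 : (n : ℂ) ≠ 0 := by exact_mod_cast hn.ne'
      refine continuous_const.div (Continuous.const_cpow (by fun_prop) (.inl hn0)) fun t => ?_
      exact (cpow_ne_zero_iff_of_exponent_ne_zero (by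
        intro h
        have := congrArg re h
        simp at this)).2 hn0
  have hI : ∀ n, Integrable fun t : ℝ => LSeries.term Λ ((3 / 2 : ℝ) + t * I) n * K t := fun n =>
    hint.bdd_mul (hcont n).aestronglyMeasurable
      (Filter.Eventually.of_forall fun t => (hnorm n t).le)
  have hS : Summable fun n => ∫ t : ℝ, ‖LSeries.term Λ ((3 / 2 : ℝ) + t * I) n * K t‖ := by
    simp only [norm_mul, hnorm, integral_const_mul]
    exact hsumm.mul_right _
  have h := (hasSum_integral_of_summable_integral_norm hI hS).mul_left (1 / (2 * Real.pi : ℂ))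
  simp only [vonMangoldtSum]
  rw [tsum_congr hterm, h.tsum_eq]
  simp only [tsum_mul_right]
  rfl

open Complex MeasureTheory in
theorem vonMangoldtSum_eq_sub_integral_logDeriv {z : ℂ} (hz : 0 < z.re)
    (hint : Integrable fun t : ℝ => logDeriv zetaReg ((3 / 2 : ℝ) + t * I) *
      (Gamma ((3 / 2 : ℝ) + t * I) * z ^ (-((3 / 2 : ℝ) + t * I) : ℂ))) :
    vonMangoldtSum z = exp (-z) / z - 1 / (2 * Real.pi) * ∫ t : ℝ,
      logDeriv zetaReg ((3 / 2 : ℝ) + t * I) *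
        (Gamma ((3 / 2 : ℝ) + t * I) * z ^ (-((3 / 2 : ℝ) + t * I) : ℂ)) := by
  have hz0 : z ≠ 0 := by rintro rfl; simp at hz
  have hint2 := (integrable_Gamma_mul_cpow hz (σ := 1 / 2) le_rfl (by norm_num)).div_const z
  have hE := cexp_neg_eq_integral_Gamma hz (σ := 1 / 2) le_rfl (by norm_num)
  rw [vonMangoldtSum_eq_integral hz, hE, mul_div_assoc, ← integral_div, ← mul_sub,
    ← integral_sub hint2 hint]
  congr 2
  ext t
  have hs : 1 < (((3 / 2 : ℝ) + t * I : ℂ)).re := by simp; norm_num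
  have hw0 : ((1 / 2 : ℝ) + t * I : ℂ) ≠ 0 := by
    intro h
    have := congrArg re h
    simp at this
  have hsw : ((3 / 2 : ℝ) + t * I : ℂ) = ((1 / 2 : ℝ) + t * I) + 1 := by push_cast; ring
  rw [logDeriv_zetaReg_of_one_lt_re hs, hsw, Complex.Gamma_add_one _ hw0, neg_add,
    cpow_add _ _ hz0, cpow_neg_one, add_sub_cancel_right]
  field_simp
  ring

theorem RiemannHypothesis.exists_norm_logDeriv_zetaReg_le_linear (hRH : RiemannHypothesis)
    {c : ℝ} (hc : 1 / 2 < c) :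
    ∃ B > 0, ∀ s : ℂ, c ≤ s.re → s.re ≤ 3 / 2 → ‖logDeriv zetaReg s‖ ≤ B * (1 + |s.im|) := by
  obtain ⟨A, hA, h⟩ := hRH.exists_norm_logDeriv_zetaReg_le
  refine ⟨A / (c - 1 / 2), div_pos hA (by linarith), fun s h1 h2 => ?_⟩
  refine (h s (by linarith) h2).trans ?_
  have h3 : 0 < c - 1 / 2 := by linarith
  exact mul_le_mul (div_le_div_of_nonneg_left hA.le h3 (by linarith)) (log_abs_add_two_le _)
    (Real.log_nonneg (by linarith [abs_nonneg s.im])) (by positivity)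

open Complex MeasureTheory in
/-- The explicit-formula representation with the logarithmic derivative replaced by twice its
real part near the critical line. -/
theorem RiemannHypothesis.vonMangoldtSum_eq (hRH : RiemannHypothesis) {z : ℂ} (hz : 0 < z.re)
    {δ : ℝ} (hδ : 0 < δ) (hδ' : δ ≤ 1 / 4) :
    vonMangoldtSum z = exp (-z) / z - 1 / (2 * Real.pi) * ((∫ t : ℝ,
      ((2 * (logDeriv zetaReg ((1 / 2 + δ : ℝ) + t * I)).re : ℝ) : ℂ) *
        (Gamma ((1 / 2 + δ : ℝ) + t * I) * z ^ (-((1 / 2 + δ : ℝ) + t * I) : ℂ))) -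
      ∫ t : ℝ, (starRingEnd ℂ) (logDeriv zetaReg ((1 + δ : ℝ) + t * I)) *
        (Gamma ((δ : ℝ) + t * I) * z ^ (-((δ : ℝ) + t * I) : ℂ))) := by
  obtain ⟨B, hB, hV⟩ := hRH.exists_norm_logDeriv_zetaReg_le_linear (c := 1 / 2 + δ) (by linarith)
  obtain ⟨C₁, hC₁⟩ := exists_norm_mul_Gamma_mul_cpow_le hz (a := 1 / 2 + δ) (b := 3 / 2)
    (by linarith) le_rfl (by linarith) hB hV
  obtain ⟨hi₁, he₁⟩ := integrable_and_integral_vertical_eq (a := 1 / 2 + δ) (b := 3 / 2)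
    (G := fun s => logDeriv zetaReg s * (Gamma s * z ^ (-s)))
    (by linarith) (fun s h1 h2 => (hRH.differentiableAt_logDeriv_zetaReg (by linarith)).mul
      (differentiableAt_Gamma_mul_cpow hz (by linarith))) hC₁
  set V₂ : ℂ → ℂ := fun s => (starRingEnd ℂ) (logDeriv zetaReg ((starRingEnd ℂ)
    ((1 + 2 * δ : ℝ) - s))) with hV₂
  have hre : ∀ s : ℂ, ((starRingEnd ℂ) ((1 + 2 * δ : ℝ) - s)).re = 1 + 2 * δ - s.re := by
    intro s; simp [-map_sub]
  have him : ∀ s : ℂ, |((starRingEnd ℂ) ((1 + 2 * δ : ℝ) - s)).im| = |s.im| := by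
    intro s; simp [-map_sub]
  obtain ⟨C₂, hC₂⟩ := exists_norm_mul_Gamma_mul_cpow_le hz (a := δ) (b := 1 / 2 + δ) (h := V₂)
    hδ (by linarith) (by linarith) hB fun s h1 h2 => by
      have := hV ((starRingEnd ℂ) ((1 + 2 * δ : ℝ) - s)) (by rw [hre]; linarith)
        (by rw [hre]; linarith)
      rw [him] at this
      simpa only [hV₂, RCLike.norm_conj] using this
  obtain ⟨hi₂, he₂⟩ := integrable_and_integral_vertical_eq (a := δ) (b := 1 / 2 + δ)
    (G := fun s => V₂ s * (Gamma s * z ^ (-s)))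
    (by linarith) (fun s h1 h2 => by
      refine DifferentiableAt.mul ?_ (differentiableAt_Gamma_mul_cpow hz (by linarith))
      have h3 := hRH.differentiableAt_logDeriv_zetaReg (s := (starRingEnd ℂ)
        ((1 + 2 * δ : ℝ) - s)) (by rw [hre]; linarith)
      have h4 := h3.conj_conj
      rw [Complex.conj_conj] at h4
      exact h4.comp (f := fun s => ((1 + 2 * δ : ℝ) : ℂ) - s) s (by fun_prop)) hC₂
  have e1 : ∀ t : ℝ, V₂ ((1 / 2 + δ : ℝ) + t * I) =
      (starRingEnd ℂ) (logDeriv zetaReg ((1 / 2 + δ : ℝ) + t * I)) := by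
    intro t
    simp only [hV₂]
    congr 2
    apply Complex.ext
    · simp [-map_sub]; ring
    · simp [-map_sub]
  have e2 : ∀ t : ℝ, V₂ ((δ : ℝ) + t * I) =
      (starRingEnd ℂ) (logDeriv zetaReg ((1 + δ : ℝ) + t * I)) := by
    intro t
    simp only [hV₂]
    congr 2
    apply Complex.ext
    · simp [-map_sub]; ring
    · simp [-map_sub]
  have i1 := hi₁ (1 / 2 + δ) le_rfl (by linarith)
  have i2 := hi₂ (1 / 2 + δ) (by linarith) le_rfl
  rw [vonMangoldtSum_eq_sub_integral_logDeriv hz (hi₁ (3 / 2) (by linarith) le_rfl), ← he₁]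
  simp only [← e2]
  rw [he₂, ← integral_sub]
  · congr 3
    ext t
    simp only [e1]
    rw [← sub_mul]
    congr 1
    apply Complex.ext <;> simp
    ring
  · refine (i1.add i2).congr (Filter.Eventually.of_forall fun t => ?_)
    simp only [Pi.add_apply, e1]
    rw [← add_mul, Complex.add_conj]
  · exact i2

theorem norm_LSeries_vonMangoldt_le {σ : ℝ} (hσ : 1 < σ) {s : ℂ} (hs : s.re = σ) :
    ‖LSeries (fun n => (ArithmeticFunction.vonMangoldt n : ℂ)) s‖ ≤
      ‖LSeries (fun n => (ArithmeticFunction.vonMangoldt n : ℂ)) σ‖ := by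
  set Λ : ℕ → ℂ := fun n => (ArithmeticFunction.vonMangoldt n : ℂ) with hΛ
  have hnorm : ∀ n : ℕ, ‖LSeries.term Λ s n‖ = ‖LSeries.term Λ σ n‖ := by
    intro n
    rw [LSeries.norm_term_eq, LSeries.norm_term_eq]
    simp [hs]
  have hreal : ∀ n : ℕ, LSeries.term Λ σ n = (‖LSeries.term Λ σ n‖ : ℂ) := by
    intro n
    rcases Nat.eq_zero_or_pos n with rfl | hn
    · simp
    · rw [LSeries.norm_term_eq, LSeries.term_of_ne_zero hn.ne']
      simp only [hn.ne', if_false, hΛ, Complex.ofReal_re, Complex.norm_real, Real.norm_eq_abs,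
        abs_of_nonneg ArithmeticFunction.vonMangoldt_nonneg]
      push_cast
      rw [Complex.ofReal_cpow (by positivity)]
      simp
  have hsumm : Summable fun n => ‖LSeries.term Λ s n‖ :=
    (ArithmeticFunction.LSeriesSummable_vonMangoldt (by rw [hs]; exact hσ)).norm
  have h2 : LSeries Λ σ = ((∑' n, ‖LSeries.term Λ s n‖ : ℝ) : ℂ) := by
    rw [LSeries, tsum_congr hreal, Complex.ofReal_tsum]
    simp only [hnorm]
  calc _ ≤ ∑' n, ‖LSeries.term Λ s n‖ := norm_tsum_le_tsum_norm hsumm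
    _ ≤ _ := by rw [h2, Complex.norm_real]; exact le_abs_self _

theorem RiemannHypothesis.exists_norm_logDeriv_zetaReg_right_le (hRH : RiemannHypothesis) :
    ∃ C > 0, ∀ δ : ℝ, 0 < δ → δ ≤ 1 / 2 → ∀ t : ℝ,
      ‖logDeriv zetaReg ((1 + δ : ℝ) + t * Complex.I)‖ ≤ C / δ := by
  obtain ⟨A, hA, h⟩ := hRH.exists_norm_logDeriv_zetaReg_le
  refine ⟨2 + A, by positivity, fun δ hδ hδ' t => ?_⟩
  set s : ℂ := (1 + δ : ℝ) + t * Complex.I with hs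
  have hre : s.re = 1 + δ := by simp [hs]
  have e1 := logDeriv_zetaReg_of_one_lt_re (s := s) (by rw [hre]; linarith)
  have e2 := logDeriv_zetaReg_of_one_lt_re (s := (1 + δ : ℝ)) (by simpa using hδ)
  have h1 := norm_LSeries_vonMangoldt_le (σ := 1 + δ) (by linarith) hre
  have h2 : ‖logDeriv zetaReg (1 + δ : ℝ)‖ ≤ A / δ := by
    refine (h (1 + δ : ℝ) (by simp; linarith) (by simp; linarith)).trans ?_
    have hl : Real.log 2 ≤ 1 := by linarith [Real.log_two_lt_d9]
    have h3 : A / (1 + δ - 1 / 2) ≤ A / δ := div_le_div_of_nonneg_left hA.le hδ (by linarith)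
    simp only [Complex.ofReal_re, Complex.ofReal_im, abs_zero, zero_add]
    calc _ ≤ A / δ * 1 := by
          refine mul_le_mul h3 hl (Real.log_nonneg (by norm_num)) (by positivity)
      _ = _ := mul_one _
  have h3 : ‖1 / (((1 + δ : ℝ) : ℂ) - 1)‖ = 1 / δ := by
    push_cast
    rw [add_sub_cancel_left, norm_div, Complex.norm_real, norm_one, Real.norm_eq_abs,
      abs_of_pos hδ]
  have h4 : ‖1 / (s - 1)‖ ≤ 1 / δ := by
    rw [norm_div, norm_one]
    refine one_div_le_one_div_of_le hδ ?_
    calc δ = (s - 1).re := by simp [hre]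
      _ ≤ _ := Complex.re_le_norm _
  have h5 : LSeries (fun n => (ArithmeticFunction.vonMangoldt n : ℂ)) (1 + δ : ℝ) =
      1 / (((1 + δ : ℝ) : ℂ) - 1) - logDeriv zetaReg (1 + δ : ℝ) := by rw [e2]; ring
  rw [h5] at h1
  calc _ ≤ 1 / δ + (1 / δ + A / δ) := by
        rw [e1]
        refine (norm_sub_le _ _).trans (add_le_add h4 (h1.trans ((norm_sub_le _ _).trans ?_)))
        rw [h3]
        linarith
    _ = _ := by ring

theorem norm_Gamma_near_zero_le {δ : ℝ} (hδ : 0 < δ) (hδ' : δ ≤ 1 / 4) (t : ℝ) :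
    ‖Complex.Gamma ((δ : ℝ) + t * Complex.I)‖ ≤
      14 * (4 / δ * (1 + t ^ 2)⁻¹ + |t| ^ (δ - 1 / 2)) * Real.exp (-(Real.pi / 2 * |t|)) := by
  set s : ℂ := (δ : ℝ) + t * Complex.I with hs
  have hre : s.re = δ := by simp [hs]
  have him : s.im = t := by simp [hs]
  have hs0 : s ≠ 0 := by intro h; rw [h] at hre; simp at hre; linarith
  have h3 := Complex.norm_Gamma_le (s := s + 1) (by simp [hre]; linarith) (by simp [hre]; linarith)
  rw [Complex.Gamma_add_one s hs0, norm_mul] at h3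
  simp only [Complex.add_im, Complex.one_im, add_zero, Complex.add_re, Complex.one_re, hre, him]
    at h3
  have ht := abs_nonneg t
  have hδs : δ ≤ ‖s‖ := hre ▸ Complex.re_le_norm s
  have hts : |t| ≤ ‖s‖ := him ▸ Complex.abs_im_le_norm s
  have hs1 : 0 < ‖s‖ := hδ.trans_le hδs
  have key : 7 * (1 + |t|) ^ (δ + 1 - 1 / 2) ≤
      ‖s‖ * (14 * (4 / δ * (1 + t ^ 2)⁻¹ + |t| ^ (δ - 1 / 2))) := by
    have h0 := Real.rpow_nonneg ht (δ - 1 / 2)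
    rcases le_total |t| 1 with h | h
    · have h6 : (1 + |t|) ^ (δ + 1 - 1 / 2) ≤ 2 := by
        calc (1 + |t|) ^ (δ + 1 - 1 / 2) ≤ 2 ^ (δ + 1 - 1 / 2) := by
              gcongr
              · linarith
              · linarith
          _ ≤ 2 ^ (1 : ℝ) := Real.rpow_le_rpow_of_exponent_le (by norm_num) (by linarith)
          _ = 2 := Real.rpow_one _
      have h7 : 1 / 2 ≤ (1 + t ^ 2)⁻¹ := by
        rw [one_div]
        refine inv_anti₀ (by positivity) ?_
        have := (sq_le_one_iff_abs_le_one t).2 h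
        linarith
      have h8 : 1 / δ * 2 ≤ 4 / δ * (1 + t ^ 2)⁻¹ + |t| ^ (δ - 1 / 2) := by
        have : 4 / δ * (1 / 2) ≤ 4 / δ * (1 + t ^ 2)⁻¹ := by gcongr
        have e : 4 / δ * (1 / 2) = 1 / δ * 2 := by ring
        linarith
      calc _ ≤ δ * (14 * (1 / δ * 2)) := by
            rw [show δ * (14 * (1 / δ * 2)) = 28 * (δ / δ) by ring, div_self hδ.ne']; linarith
        _ ≤ _ := by gcongr
    · have ht0 : 0 < |t| := by linarith
      have h6 : (1 + |t|) ^ (δ + 1 - 1 / 2) ≤ 2 * |t| ^ (δ + 1 - 1 / 2) := by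
        calc (1 + |t|) ^ (δ + 1 - 1 / 2) ≤ (2 * |t|) ^ (δ + 1 - 1 / 2) := by
              gcongr
              · linarith
              · linarith
          _ = 2 ^ (δ + 1 - 1 / 2) * |t| ^ (δ + 1 - 1 / 2) := Real.mul_rpow (by norm_num) ht
          _ ≤ 2 ^ (1 : ℝ) * |t| ^ (δ + 1 - 1 / 2) := by
              gcongr
              · norm_num
              · linarith
          _ = _ := by rw [Real.rpow_one]
      have h7 : |t| ^ (δ + 1 - 1 / 2) = |t| * |t| ^ (δ - 1 / 2) := by
        rw [show δ + 1 - 1 / 2 = 1 + (δ - 1 / 2) by ring, Real.rpow_add ht0, Real.rpow_one]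
      have h8 : 0 ≤ 4 / δ * (1 + t ^ 2)⁻¹ := by positivity
      calc _ ≤ |t| * (14 * |t| ^ (δ - 1 / 2)) := by rw [h7] at h6; linarith
        _ ≤ _ := by gcongr; linarith
  refine le_of_mul_le_mul_left ?_ hs1
  calc _ ≤ 7 * (1 + |t|) ^ (δ + 1 - 1 / 2) * Real.exp (-(Real.pi / 2 * |t|)) := h3
    _ ≤ _ := by rw [← mul_assoc]; gcongr

open MeasureTheory in
theorem integral_abs_rpow_mul_exp_neg_mul_abs {a r : ℝ} (ha : 0 < a) (hr : 0 < r) :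
    ∫ t : ℝ, |t| ^ (a - 1) * Real.exp (-(r * |t|)) = 2 * ((1 / r) ^ a * Real.Gamma a) := by
  rw [integral_comp_abs (f := fun t : ℝ => t ^ (a - 1) * Real.exp (-(r * t))),
    Real.integral_rpow_mul_exp_neg_mul_Ioi ha hr]

open MeasureTheory in
theorem integrable_abs_rpow_mul_exp_neg_mul_abs {a r : ℝ} (ha : 0 < a) (hr : 0 < r) :
    Integrable fun t : ℝ => |t| ^ (a - 1) * Real.exp (-(r * |t|)) := by
  refine Integrable.of_integral_ne_zero ?_
  rw [integral_abs_rpow_mul_exp_neg_mul_abs ha hr]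
  have := Real.Gamma_pos_of_pos ha
  positivity

open Complex MeasureTheory in
theorem RiemannHypothesis.exists_norm_integral_conj_logDeriv_le (hRH : RiemannHypothesis) :
    ∃ C > 0, ∀ z : ℂ, 0 < z.re → ∀ δ : ℝ, 0 < δ → δ ≤ 1 / 4 →
      ‖∫ t : ℝ, (starRingEnd ℂ) (logDeriv zetaReg ((1 + δ : ℝ) + t * I)) *
        (Gamma ((δ : ℝ) + t * I) * z ^ (-((δ : ℝ) + t * I) : ℂ))‖ ≤
      C / δ * ‖z‖ ^ (-δ) * (1 / δ + (1 / (Real.pi / 2 - |z.arg|)) ^ (1 / 2 + δ)) := by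
  obtain ⟨C, hC, hV⟩ := hRH.exists_norm_logDeriv_zetaReg_right_le
  refine ⟨C * 14 * 14, by positivity, fun z hz δ hδ hδ' => ?_⟩
  have hz0 : z ≠ 0 := by rintro rfl; simp at hz
  have hϑ := arg_gap_pos hz
  set ϑ := Real.pi / 2 - |z.arg| with hϑd
  have ha : 0 < 1 / 2 + δ := by linarith
  have hi1 := integrable_inv_one_add_sq.const_mul (4 / δ)
  have hi2 := integrable_abs_rpow_mul_exp_neg_mul_abs ha hϑ
  have hint := (hi1.add hi2).const_mul (C / δ * (14 * ‖z‖ ^ (-δ)))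
  refine (norm_integral_le_of_norm_le hint (Filter.Eventually.of_forall fun t => ?_)).trans ?_
  · simp only [Pi.add_apply]
    rw [norm_mul, norm_mul, RCLike.norm_conj]
    have h1 := norm_cpow_neg_le hz0 ((δ : ℝ) + t * I)
    simp only [add_re, ofReal_re, mul_re, I_re, mul_zero, ofReal_im, I_im, mul_one, sub_self,
      add_zero, add_im, mul_im, zero_add] at h1
    have h2 := norm_Gamma_near_zero_le hδ hδ' t
    have h3 := hV δ hδ (by linarith) t
    have h4 : Real.exp (-(Real.pi / 2 * |t|)) * Real.exp (|z.arg| * |t|) =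
        Real.exp (-(ϑ * |t|)) := by
      rw [← Real.exp_add, hϑd]; congr 1; ring
    have h5 : Real.exp (-(ϑ * |t|)) ≤ 1 := by
      rw [Real.exp_le_one_iff]
      have : 0 ≤ ϑ * |t| := by positivity
      linarith
    have h6 : 0 ≤ 4 / δ * (1 + t ^ 2)⁻¹ := by positivity
    rw [show δ - 1 / 2 = 1 / 2 + δ - 1 by ring] at h2
    calc _ ≤ C / δ * ((14 * (4 / δ * (1 + t ^ 2)⁻¹ + |t| ^ (1 / 2 + δ - 1)) *
          Real.exp (-(Real.pi / 2 * |t|))) * (‖z‖ ^ (-δ) * Real.exp (|z.arg| * |t|))) := by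
          gcongr
      _ = C / δ * (14 * ‖z‖ ^ (-δ)) * ((4 / δ * (1 + t ^ 2)⁻¹ + |t| ^ (1 / 2 + δ - 1)) *
          (Real.exp (-(Real.pi / 2 * |t|)) * Real.exp (|z.arg| * |t|))) := by ring
      _ ≤ _ := by
          rw [h4, add_mul]
          exact mul_le_mul_of_nonneg_left (add_le_add_left (mul_le_of_le_one_right h6 h5) _)
            (by positivity)
  · rw [integral_const_mul]
    simp only [Pi.add_apply]
    rw [integral_add hi1 hi2, integral_const_mul, integral_univ_inv_one_add_sq,
      integral_abs_rpow_mul_exp_neg_mul_abs ha hϑ]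
    have hG : Real.Gamma (1 / 2 + δ) ≤ 7 := by
      have h := Complex.norm_Gamma_le (s := (1 / 2 + δ : ℝ)) (by simp; linarith)
        (by simp; linarith)
      rw [Complex.Gamma_ofReal, Complex.norm_real] at h
      simpa using (le_abs_self _).trans h
    have hπ := Real.pi_lt_d2
    have hx : 0 ≤ (1 / ϑ) ^ (1 / 2 + δ) := by positivity
    calc _ ≤ C / δ * (14 * ‖z‖ ^ (-δ)) * (14 / δ + 14 * (1 / ϑ) ^ (1 / 2 + δ)) := by
          refine mul_le_mul_of_nonneg_left (add_le_add ?_ ?_) (by positivity)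
          · rw [div_mul_eq_mul_div]
            gcongr
            linarith
          · nlinarith
      _ = _ := by ring

/-- The contribution of the line `Re s = 1/2 + δ` to the explicit formula for the von Mangoldt
generating function. -/
noncomputable def criticalIntegral (δ : ℝ) (z : ℂ) : ℂ :=
  ∫ t : ℝ, ((2 * (logDeriv zetaReg ((1 / 2 + δ : ℝ) + t * Complex.I)).re : ℝ) : ℂ) *
    (Complex.Gamma ((1 / 2 + δ : ℝ) + t * Complex.I) *
      z ^ (-((1 / 2 + δ : ℝ) + t * Complex.I) : ℂ))

theorem re_div_norm_le_arg_gap {z : ℂ} (hz : 0 < z.re) :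
    z.re / ‖z‖ ≤ Real.pi / 2 - |z.arg| := by
  have hz0 : z ≠ 0 := by rintro rfl; simp at hz
  rw [← Complex.cos_arg hz0, ← Real.cos_abs, ← Real.sin_pi_div_two_sub]
  exact Real.sin_le (arg_gap_pos hz).le

theorem norm_cexp_neg_sub_one_div_le {z : ℂ} (hz : 0 < z.re) :
    ‖(Complex.exp (-z) - 1) / z‖ ≤ 2 := by
  have hz0 : z ≠ 0 := by rintro rfl; simp at hz
  rw [norm_div, div_le_iff₀ (norm_pos_iff.2 hz0)]
  rcases le_total ‖z‖ 1 with h | h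
  · simpa using Complex.norm_exp_sub_one_le (x := -z) (by simpa using h)
  · refine (norm_sub_le _ _).trans ?_
    have : ‖Complex.exp (-z)‖ ≤ 1 := by
      rw [Complex.norm_exp]
      simpa using hz.le
    rw [norm_one]
    linarith

theorem rpow_one_div_log {x : ℝ} (hx : 1 < x) : x ^ (1 / Real.log x) = Real.exp 1 := by
  rw [Real.rpow_def_of_pos (by linarith), mul_one_div_cancel (Real.log_pos hx).ne']

theorem RiemannHypothesis.exists_norm_sq_vonMangoldtSum_sub_le (hRH : RiemannHypothesis) :
    ∃ C > 0, ∀ x : ℝ, 1 < x → 4 ≤ Real.log x → ∀ z : ℂ, z.re = 1 / x → ‖z‖ ≤ 5 →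
      ‖vonMangoldtSum z - 1 / z‖ ^ 2 ≤
        ‖criticalIntegral (1 / Real.log x) z‖ ^ 2 + C * x * Real.log x ^ 2 := by
  obtain ⟨C, hC, hJ⟩ := hRH.exists_norm_integral_conj_logDeriv_le
  refine ⟨2 * (1 + 51 * C) ^ 2, by positivity, fun x hx hL z hzre hz5 => ?_⟩
  set L := Real.log x with hLd
  set δ := 1 / L with hδd
  have hx0 : 0 < x := by linarith
  have hL0 : 0 < L := by linarith
  have hδ : 0 < δ := by positivity
  have hδ' : δ ≤ 1 / 4 := one_div_le_one_div_of_le (by norm_num) hL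
  have hz : 0 < z.re := by rw [hzre]; positivity
  have hz0 : z ≠ 0 := by rintro rfl; simp at hz
  have hzn : 0 < ‖z‖ := norm_pos_iff.2 hz0
  have hzx : 1 / x ≤ ‖z‖ := hzre ▸ Complex.re_le_norm z
  have hxδ : x ^ δ ≤ 3 := by
    rw [hδd, rpow_one_div_log hx]; linarith [Real.exp_one_lt_d9]
  have h1 : ‖z‖ ^ (-δ) ≤ 3 := by
    refine le_trans ?_ hxδ
    rw [Real.rpow_neg hzn.le, ← Real.inv_rpow hzn.le]
    gcongr
    exact inv_le_of_inv_le₀ hx0 (by rwa [← one_div])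
  have hϑ0 := arg_gap_pos hz
  have hϑ : 1 / (Real.pi / 2 - |z.arg|) ≤ 5 * x := by
    rw [div_le_iff₀ hϑ0]
    have h2 := re_div_norm_le_arg_gap hz
    rw [hzre, div_div, div_le_iff₀ (by positivity)] at h2
    nlinarith [mul_nonneg hx0.le hϑ0.le, mul_nonneg (mul_nonneg hx0.le hϑ0.le)
      (sub_nonneg.2 hz5)]
  have hsq : 0 < √x := Real.sqrt_pos.2 hx0
  have h2 : (1 / (Real.pi / 2 - |z.arg|)) ^ (1 / 2 + δ) ≤ 15 * √x := by
    calc _ ≤ (5 * x) ^ (1 / 2 + δ) := by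
          gcongr
      _ = 5 ^ (1 / 2 + δ) * (√x * x ^ δ) := by
          rw [Real.mul_rpow (by norm_num) hx0.le, Real.rpow_add hx0, Real.sqrt_eq_rpow]
      _ ≤ 5 ^ (1 : ℝ) * (√x * 3) := by
          gcongr
          · norm_num
          · linarith
      _ = _ := by rw [Real.rpow_one]; ring
  have h3 : L ≤ 2 * √x := by
    have := Real.log_le_rpow_div hx0.le (ε := 1 / 2) (by norm_num)
    rw [← Real.sqrt_eq_rpow] at this
    linarith
  have h4 := hJ z hz δ hδ hδ'
  have h5 : C / δ * ‖z‖ ^ (-δ) * (1 / δ + (1 / (Real.pi / 2 - |z.arg|)) ^ (1 / 2 + δ)) ≤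
      51 * C * (L * √x) := by
    have e : 1 / δ = L := by rw [hδd, one_div_one_div]
    have e' : C / δ = C * L := by rw [div_eq_mul_one_div, e]
    rw [e, e']
    calc _ ≤ C * L * 3 * (2 * √x + 15 * √x) := by gcongr
      _ = _ := by ring
  have h6 := norm_cexp_neg_sub_one_div_le hz
  have hrep := hRH.vonMangoldtSum_eq hz hδ hδ'
  set J := ∫ t : ℝ, (starRingEnd ℂ) (logDeriv zetaReg ((1 + δ : ℝ) + t * Complex.I)) *
        (Complex.Gamma ((δ : ℝ) + t * Complex.I) * z ^ (-((δ : ℝ) + t * Complex.I) : ℂ))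
  have hrep' : vonMangoldtSum z - 1 / z = (Complex.exp (-z) - 1) / z -
      1 / (2 * Real.pi) * criticalIntegral δ z + 1 / (2 * Real.pi) * J := by
    rw [hrep, criticalIntegral]
    ring
  have hπ : ‖(1 / (2 * Real.pi) : ℂ)‖ ≤ 1 / 2 := by
    rw [norm_div, norm_mul, norm_one, Complex.norm_real, Complex.norm_ofNat, Real.norm_eq_abs,
      abs_of_pos Real.pi_pos]
    exact one_div_le_one_div_of_le (by norm_num) (by linarith [Real.pi_gt_three])
  have hs1 : 1 ≤ √x := Real.one_le_sqrt.2 hx.le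
  have h7 : ‖vonMangoldtSum z - 1 / z‖ ≤
      1 / 2 * ‖criticalIntegral δ z‖ + (1 + 51 * C) * (L * √x) := by
    have h8 : ‖1 / (2 * Real.pi : ℂ) * criticalIntegral δ z‖ ≤ 1 / 2 * ‖criticalIntegral δ z‖ := by
      rw [norm_mul]; gcongr
    have h9 : ‖1 / (2 * Real.pi : ℂ) * J‖ ≤ 1 * (51 * C * (L * √x)) := by
      rw [norm_mul]
      exact mul_le_mul (by linarith) (h4.trans h5) (norm_nonneg _) zero_le_one
    have h10 : 2 ≤ L * √x := by nlinarith
    rw [hrep']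
    refine (norm_add_le _ _).trans ((add_le_add_left (norm_sub_le _ _) _).trans ?_)
    linarith
  have h11 : 0 ≤ (1 + 51 * C) * (L * √x) := by positivity
  calc _ ≤ (1 / 2 * ‖criticalIntegral δ z‖ + (1 + 51 * C) * (L * √x)) ^ 2 := by gcongr
    _ ≤ ‖criticalIntegral δ z‖ ^ 2 + 2 * ((1 + 51 * C) * (L * √x)) ^ 2 := by
        nlinarith [sq_nonneg (1 / 2 * ‖criticalIntegral δ z‖ - (1 + 51 * C) * (L * √x)),
          sq_nonneg ‖criticalIntegral δ z‖]
    _ = _ := by rw [mul_pow, mul_pow, Real.sq_sqrt hx0.le]; ring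

open MeasureTheory in
theorem lintegral_mul_le_of_local_average_le {b φ : ℝ → ℝ} {B K : ℝ} (hb : Continuous b)
    (hb0 : ∀ t, 0 ≤ b t) (hφ : Continuous φ) (hφ0 : ∀ t, 0 ≤ φ t) (hK : 0 ≤ K)
    (hB : ∀ u, ∫ t in (u - 1 / 4)..(u + 1 / 4), b t ≤ B)
    (hφK : ∀ t u, |t - u| ≤ 1 / 4 → φ t ≤ K * φ u) :
    ∫⁻ t, ENNReal.ofReal (b t * φ t) ≤ ENNReal.ofReal (2 * K * B) * ∫⁻ t, ENNReal.ofReal (φ t) := by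
  set S : Set (ℝ × ℝ) := {q | |q.1 - q.2| ≤ 1 / 4} with hS
  have hSm : MeasurableSet S := measurableSet_le (by fun_prop) (by fun_prop)
  set F : ℝ → ℝ → ENNReal := fun t u =>
    S.indicator (fun q => ENNReal.ofReal (2 * K * φ q.2) * ENNReal.ofReal (b q.1)) (t, u) with hF
  have hFm : Measurable (Function.uncurry F) := by
    refine Measurable.indicator ?_ hSm
    fun_prop
  have h1 : ∀ t, ENNReal.ofReal (b t * φ t) ≤ ∫⁻ u, F t u := by
    intro t
    have e1 : ∀ u, F t u = (Set.Icc (t - 1 / 4) (t + 1 / 4)).indicator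
        (fun u => ENNReal.ofReal (2 * K * φ u) * ENNReal.ofReal (b t)) u := by
      intro u
      simp only [hF, Set.indicator, hS, Set.mem_ofPred_eq, abs_le, Set.mem_Icc]
      congr 1
      simp only [eq_iff_iff]
      constructor <;> rintro ⟨h1, h2⟩ <;> constructor <;> linarith
    simp only [e1]
    rw [lintegral_indicator measurableSet_Icc]
    calc ENNReal.ofReal (b t * φ t) =
        ∫⁻ _u in Set.Icc (t - 1 / 4) (t + 1 / 4), ENNReal.ofReal (2 * (b t * φ t)) := by
          rw [setLIntegral_const, Real.volume_Icc, ← ENNReal.ofReal_mul (by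
            have := hb0 t; have := hφ0 t; positivity)]
          congr 1; ring
      _ ≤ _ := by
          refine setLIntegral_mono (by fun_prop) fun u hu => ?_
          have h2 := hφK t u (abs_le.2 ⟨by linarith [hu.2], by linarith [hu.1]⟩)
          rw [← ENNReal.ofReal_mul (by have := hφ0 u; positivity)]
          refine ENNReal.ofReal_le_ofReal ?_
          nlinarith [mul_le_mul_of_nonneg_left h2 (hb0 t)]
  have h2 : ∀ u, ∫⁻ t, F t u ≤ ENNReal.ofReal (2 * K * φ u) * ENNReal.ofReal B := by
    intro u
    have e1 : ∀ t, F t u = (Set.Icc (u - 1 / 4) (u + 1 / 4)).indicator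
        (fun t => ENNReal.ofReal (2 * K * φ u) * ENNReal.ofReal (b t)) t := by
      intro t
      simp only [hF, Set.indicator, hS, Set.mem_ofPred_eq, abs_le, Set.mem_Icc]
      congr 1
      simp only [eq_iff_iff]
      constructor <;> rintro ⟨h1, h2⟩ <;> constructor <;> linarith
    simp only [e1]
    rw [lintegral_indicator measurableSet_Icc, lintegral_const_mul _ (by fun_prop)]
    gcongr
    rw [← ofReal_integral_eq_lintegral_ofReal
      (hb.continuousOn.integrableOn_Icc) (Filter.Eventually.of_forall hb0)]
    refine ENNReal.ofReal_le_ofReal ?_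
    rw [integral_Icc_eq_integral_Ioc, ← intervalIntegral.integral_of_le (by linarith)]
    exact hB u
  have hB0 : 0 ≤ B :=
    (intervalIntegral.integral_nonneg (by norm_num) fun t _ => hb0 t).trans (hB 0)
  calc _ ≤ ∫⁻ t, ∫⁻ u, F t u := lintegral_mono h1
    _ = ∫⁻ u, ∫⁻ t, F t u := lintegral_lintegral_swap hFm.aemeasurable
    _ ≤ ∫⁻ u, ENNReal.ofReal (2 * K * φ u) * ENNReal.ofReal B := lintegral_mono h2
    _ = ∫⁻ u, ENNReal.ofReal (2 * K * B) * ENNReal.ofReal (φ u) := by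
        congr 1; ext u
        have := hφ0 u
        rw [← ENNReal.ofReal_mul (by positivity), ← ENNReal.ofReal_mul (by positivity)]
        congr 1; ring
    _ = _ := lintegral_const_mul _ (by fun_prop)

open MeasureTheory in
theorem integral_mul_le_of_local_average_le {b φ : ℝ → ℝ} {B K : ℝ} (hb : Continuous b)
    (hb0 : ∀ t, 0 ≤ b t) (hφ : Continuous φ) (hφ0 : ∀ t, 0 ≤ φ t) (hφi : Integrable φ)
    (hK : 0 ≤ K) (hB : ∀ u, ∫ t in (u - 1 / 4)..(u + 1 / 4), b t ≤ B)
    (hφK : ∀ t u, |t - u| ≤ 1 / 4 → φ t ≤ K * φ u) :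
    Integrable (fun t => b t * φ t) ∧ ∫ t, b t * φ t ≤ 2 * K * B * ∫ t, φ t := by
  have h := lintegral_mul_le_of_local_average_le hb hb0 hφ hφ0 hK hB hφK
  have hB0 : 0 ≤ B :=
    (intervalIntegral.integral_nonneg (by norm_num) fun t _ => hb0 t).trans (hB 0)
  have hφI : 0 ≤ ∫ t, φ t := integral_nonneg hφ0
  have hnn : ∀ t, 0 ≤ b t * φ t := fun t => mul_nonneg (hb0 t) (hφ0 t)
  rw [← ofReal_integral_eq_lintegral_ofReal hφi (Filter.Eventually.of_forall hφ0),
    ← ENNReal.ofReal_mul (by positivity)] at h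
  have hi : Integrable (fun t => b t * φ t) := by
    refine ⟨(hb.mul hφ).aestronglyMeasurable, ?_⟩
    rw [hasFiniteIntegral_iff_ofReal (Filter.Eventually.of_forall hnn)]
    exact h.trans_lt ENNReal.ofReal_lt_top
  refine ⟨hi, ?_⟩
  rw [← ofReal_integral_eq_lintegral_ofReal hi (Filter.Eventually.of_forall hnn)] at h
  exact (ENNReal.ofReal_le_ofReal_iff (by positivity)).1 h

open MeasureTheory in
theorem integral_exp_neg_mul_abs {r : ℝ} (hr : 0 < r) :
    Integrable (fun t : ℝ => Real.exp (-(r * |t|))) ∧ ∫ t : ℝ, Real.exp (-(r * |t|)) = 2 / r := by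
  have h1 := integral_abs_rpow_mul_exp_neg_mul_abs one_pos hr
  have h2 := integrable_abs_rpow_mul_exp_neg_mul_abs one_pos hr
  simp only [sub_self, Real.rpow_zero, one_mul, Real.rpow_one, Real.Gamma_one, mul_one] at h1 h2
  exact ⟨h2, by rw [h1]; ring⟩

open MeasureTheory in
theorem integral_mul_exp_neg_le_of_local_average_le {b : ℝ → ℝ} {B r : ℝ} (hb : Continuous b)
    (hb0 : ∀ t, 0 ≤ b t) (hB : ∀ u, ∫ t in (u - 1 / 4)..(u + 1 / 4), b t ≤ B)
    (hr : 0 < r) (hr2 : r ≤ 2) :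
    Integrable (fun t => b t * Real.exp (-(r * |t|))) ∧
      ∫ t, b t * Real.exp (-(r * |t|)) ≤ 8 * B / r := by
  obtain ⟨hi, he⟩ := integral_exp_neg_mul_abs hr
  obtain ⟨h1, h2⟩ := integral_mul_le_of_local_average_le (K := 2) hb hb0
    (φ := fun t => Real.exp (-(r * |t|))) (by fun_prop) (fun t => (Real.exp_pos _).le) hi
    (by norm_num) hB (fun t u htu => by
      have h3 : |u| ≤ |t| + 1 / 4 := by
        have := abs_sub_abs_le_abs_sub u t
        rw [abs_sub_comm] at this
        linarith
      have h4 : Real.exp (1 / 2) ≤ 2 := by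
        have h5 : Real.exp (1 / 2) ^ 2 = Real.exp 1 := by rw [← Real.exp_nat_mul]; norm_num
        have := Real.exp_one_lt_d9
        nlinarith [Real.exp_pos (1 / 2)]
      calc Real.exp (-(r * |t|)) ≤ Real.exp (1 / 2 + -(r * |u|)) := by
            gcongr
            nlinarith [mul_le_mul_of_nonneg_left h3 hr.le]
        _ ≤ _ := by rw [Real.exp_add]; gcongr)
  refine ⟨h1, h2.trans (le_of_eq ?_)⟩
  rw [he]; ring

open MeasureTheory in
theorem integral_mul_inv_one_add_sq_le_of_local_average_le {b : ℝ → ℝ} {B : ℝ}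
    (hb : Continuous b) (hb0 : ∀ t, 0 ≤ b t)
    (hB : ∀ u, ∫ t in (u - 1 / 4)..(u + 1 / 4), b t ≤ B) (v : ℝ) :
    Integrable (fun t => b t * (1 + (t - v) ^ 2)⁻¹) ∧
      ∫ t, b t * (1 + (t - v) ^ 2)⁻¹ ≤ 4 * Real.pi * B := by
  have hi : Integrable fun t : ℝ => (1 + (t - v) ^ 2)⁻¹ :=
    integrable_inv_one_add_sq.comp_sub_right v
  have he : ∫ t : ℝ, (1 + (t - v) ^ 2)⁻¹ = Real.pi := by
    rw [integral_sub_right_eq_self (fun t : ℝ => (1 + t ^ 2)⁻¹) v, integral_univ_inv_one_add_sq]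
  obtain ⟨h1, h2⟩ := integral_mul_le_of_local_average_le (K := 2) hb hb0
    (φ := fun t => (1 + (t - v) ^ 2)⁻¹)
    (Continuous.inv₀ (by fun_prop) fun t => by positivity) (fun t => by positivity) hi
    (by norm_num) hB (fun t u htu => by
      rw [← div_eq_mul_inv, le_div_iff₀ (by positivity), inv_mul_le_iff₀ (by positivity)]
      have h3 : (t - u) ^ 2 ≤ (1 / 4) ^ 2 := sq_le_sq' (by linarith [(abs_le.1 htu).1])
        (abs_le.1 htu).2
      nlinarith [sq_nonneg ((t - v) + (t - u))])
  refine ⟨h1, h2.trans (le_of_eq ?_)⟩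
  rw [he]; ring

theorem exists_one_add_abs_rpow_mul_exp_mul_log_le {κ : ℝ} (hκ : 0 < κ) :
    ∃ C > 0, ∀ x : ℝ, 1 < x → 4 ≤ Real.log x → ∀ r : ℝ, κ / x ≤ r → ∀ t u : ℝ, |t - u| ≤ 1 / 4 →
      (1 + |t|) ^ (1 / Real.log x) * Real.exp (-(r * |t|)) * Real.log (|u| + 2) ≤
        C * Real.log x := by
  refine ⟨3 * (2 + 2 / κ) ^ 2, by positivity, fun x hx hL r hr t u htu => ?_⟩
  set L := Real.log x with hLd
  have hx0 : 0 < x := by linarith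
  have hL0 : 0 < L := by linarith
  set y := |t| / x with hy
  have hy0 : 0 ≤ y := by positivity
  have hty : |t| = y * x := by rw [hy]; field_simp
  have h1 : (1 + |t|) ^ (1 / L) ≤ 3 * (2 + y) := by
    have h2 : 1 + |t| ≤ x * (2 + y) := by rw [hty]; nlinarith
    calc (1 + |t|) ^ (1 / L) ≤ (x * (2 + y)) ^ (1 / L) := by gcongr
      _ = x ^ (1 / L) * (2 + y) ^ (1 / L) := Real.mul_rpow hx0.le (by positivity)
      _ ≤ 3 * (2 + y) ^ (1 : ℝ) := by
          gcongr
          · rw [rpow_one_div_log hx]; linarith [Real.exp_one_lt_d9]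
          · linarith
          · rw [div_le_one hL0]; linarith
      _ = _ := by rw [Real.rpow_one]
  have h2 : Real.exp (-(r * |t|)) ≤ Real.exp (-(κ * y)) := by
    refine Real.exp_le_exp.2 (neg_le_neg ?_)
    rw [hty]
    have : κ ≤ r * x := (div_le_iff₀ hx0).1 hr
    nlinarith
  have h3 : Real.log (|u| + 2) ≤ L * (2 + y) := by
    have hu : |u| ≤ |t| + 1 / 4 := by
      have := abs_sub_abs_le_abs_sub u t
      rw [abs_sub_comm] at this
      linarith
    have h4 : |u| + 2 ≤ x * (3 + y) := by rw [hty] at hu; nlinarith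
    calc Real.log (|u| + 2) ≤ Real.log (x * (3 + y)) := Real.log_le_log (by positivity) h4
      _ = L + Real.log (3 + y) := Real.log_mul hx0.ne' (by positivity)
      _ ≤ L + (3 + y - 1) := by gcongr; exact Real.log_le_sub_one_of_pos (by positivity)
      _ ≤ _ := by nlinarith
  have h4 : (2 + y) ^ 2 * Real.exp (-(κ * y)) ≤ (2 + 2 / κ) ^ 2 := by
    rw [Real.exp_neg, ← div_eq_mul_inv, div_le_iff₀ (Real.exp_pos _)]
    have h5 : 1 + κ * y / 2 ≤ Real.exp (κ * y / 2) := by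
      linarith [Real.add_one_le_exp (κ * y / 2)]
    have h6 : 2 + y ≤ (2 + 2 / κ) * Real.exp (κ * y / 2) := by
      calc 2 + y ≤ (2 + 2 / κ) * (1 + κ * y / 2) := by
            have : (2 + 2 / κ) * (1 + κ * y / 2) = 2 + y + 2 / κ + κ * y := by field_simp; ring
            rw [this]
            have : 0 ≤ 2 / κ + κ * y := by positivity
            linarith
        _ ≤ _ := by gcongr
    calc (2 + y) ^ 2 ≤ ((2 + 2 / κ) * Real.exp (κ * y / 2)) ^ 2 := by gcongr
      _ = _ := by rw [mul_pow, ← Real.exp_nat_mul]; congr 2; push_cast; ring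
  have hlog0 : 0 ≤ Real.log (|u| + 2) := Real.log_nonneg (by linarith [abs_nonneg u])
  calc _ ≤ 3 * (2 + y) * Real.exp (-(κ * y)) * (L * (2 + y)) := by gcongr
    _ = 3 * L * ((2 + y) ^ 2 * Real.exp (-(κ * y))) := by ring
    _ ≤ 3 * L * (2 + 2 / κ) ^ 2 := by gcongr
    _ = _ := by ring

open Complex in
/-- Two integrations by parts against an additive character. -/
theorem norm_integral_mul_cexp_le {f f' f'' : ℝ → ℝ} {a b B : ℝ} (hab : a ≤ b)
    (hf : ∀ v ∈ Set.Icc a b, HasDerivAt f (f' v) v)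
    (hf' : ∀ v ∈ Set.Icc a b, HasDerivAt f' (f'' v) v)
    (hc : ContinuousOn f'' (Set.Icc a b))
    (ha : f a = 0) (hb : f b = 0) (ha' : f' a = 0) (hb' : f' b = 0)
    (hB : ∀ v ∈ Set.Icc a b, |f v| + |f'' v| ≤ B) (τ : ℝ) :
    ‖∫ v in a..b, (f v : ℂ) * exp (-(τ * v * I))‖ ≤ B * (b - a) * (1 + τ ^ 2)⁻¹ := by
  set e : ℝ → ℂ := fun v => exp (-(τ * v * I)) with he
  have hec : Continuous e := by fun_prop
  have hed : ∀ v : ℝ, HasDerivAt e (-(τ * I) * e v) v := by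
    intro v
    have h1 : HasDerivAt (fun v : ℝ => -(τ * v * I : ℂ)) (-(τ * I)) v := by
      have := (((hasDerivAt_id v).ofReal_comp.const_mul (τ : ℂ)).mul_const I).fun_neg
      simpa using this
    have := h1.cexp
    rwa [mul_comm] at this
  have hen : ∀ v, ‖e v‖ = 1 := by
    intro v
    simp only [he]
    rw [show -(τ * v * I : ℂ) = ((-(τ * v) : ℝ) : ℂ) * I by push_cast; ring]
    exact norm_exp_ofReal_mul_I _
  have hU : Set.uIcc a b = Set.Icc a b := Set.uIcc_of_le hab
  have ibp : ∀ g g' : ℝ → ℝ, (∀ v ∈ Set.Icc a b, HasDerivAt g (g' v) v) →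
      ContinuousOn g' (Set.Icc a b) → g a = 0 → g b = 0 →
      ∫ v in a..b, (g' v : ℂ) * e v = τ * I * ∫ v in a..b, (g v : ℂ) * e v := by
    intro g g' hg hgc hga hgb
    have h1 := intervalIntegral.integral_mul_deriv_eq_deriv_mul (a := a) (b := b)
      (u := fun v => (g v : ℂ)) (u' := fun v => (g' v : ℂ)) (v := e)
      (v' := fun v => -(τ * I) * e v) (fun v hv => (hg v (hU ▸ hv)).ofReal_comp)
      (fun v _ => hed v)
      (ContinuousOn.intervalIntegrable (by
        rw [hU]; exact continuous_ofReal.comp_continuousOn hgc))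
      (Continuous.intervalIntegrable (by fun_prop) _ _)
    simp only [hga, hgb, ofReal_zero, zero_mul, sub_zero, zero_sub] at h1
    rw [eq_neg_iff_add_eq_zero, add_comm, ← eq_neg_iff_add_eq_zero] at h1
    rw [h1, ← intervalIntegral.integral_neg, ← intervalIntegral.integral_const_mul]
    congr 1
    ext v
    ring
  have hc' : ContinuousOn f' (Set.Icc a b) := fun v hv => (hf' v hv).continuousAt.continuousWithinAt
  have hc0 : ContinuousOn f (Set.Icc a b) := fun v hv => (hf v hv).continuousAt.continuousWithinAt
  have h1 := ibp f f' hf hc' ha hb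
  have h2 := ibp f' f'' hf' hc ha' hb'
  rw [h1] at h2
  have h3 : ((1 + τ ^ 2 : ℝ) : ℂ) * ∫ v in a..b, (f v : ℂ) * e v =
      ∫ v in a..b, ((f v - f'' v : ℝ) : ℂ) * e v := by
    have i1 : IntervalIntegrable (fun v => (f v : ℂ) * e v) MeasureTheory.volume a b :=
      ContinuousOn.intervalIntegrable (by
        rw [hU]; exact (continuous_ofReal.comp_continuousOn hc0).mul hec.continuousOn)
    have i2 : IntervalIntegrable (fun v => (f'' v : ℂ) * e v) MeasureTheory.volume a b :=
      ContinuousOn.intervalIntegrable (by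
        rw [hU]; exact (continuous_ofReal.comp_continuousOn hc).mul hec.continuousOn)
    simp only [ofReal_sub, sub_mul]
    rw [intervalIntegral.integral_sub i1 i2, h2]
    push_cast
    linear_combination (τ : ℂ) ^ 2 * (∫ v in a..b, (f v : ℂ) * e v) * I_sq
  have h4 : ‖∫ v in a..b, ((f v - f'' v : ℝ) : ℂ) * e v‖ ≤ B * |b - a| :=
    intervalIntegral.norm_integral_le_of_norm_le_const fun v hv => by
      rw [Set.uIoc_of_le hab] at hv
      rw [norm_mul, hen, mul_one, norm_real, Real.norm_eq_abs]
      exact (abs_sub _ _).trans (hB v ⟨hv.1.le, hv.2⟩)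
  rw [← h3, norm_mul, norm_real, Real.norm_eq_abs, abs_of_pos (by positivity),
    abs_of_nonneg (sub_nonneg.2 hab)] at h4
  rw [← div_eq_mul_inv, le_div_iff₀ (by positivity), mul_comm]
  exact h4

/-- The complementary argument `π/2 - arcsin (x / e^v)` of the point of modulus `e^v` on the
vertical line `Re z = x`. -/
noncomputable def lineArg (x v : ℝ) : ℝ := Real.pi / 2 - Real.arcsin (x * Real.exp (-v))

theorem continuous_lineArg (x : ℝ) : Continuous (lineArg x) := by
  unfold lineArg
  exact continuous_const.sub (Real.continuous_arcsin.comp (by fun_prop))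

theorem lineArg_nonneg (x v : ℝ) : 0 ≤ lineArg x v :=
  sub_nonneg.2 (Real.arcsin_le_pi_div_two _)

theorem lineArg_le {x v : ℝ} (hx : 0 ≤ x) (h : x * Real.exp (-v) ≤ 1) :
    lineArg x v ≤ Real.pi / 2 - x * Real.exp (-v) := by
  have h0 : 0 ≤ x * Real.exp (-v) := by positivity
  refine sub_le_sub_left ?_ _
  conv_lhs => rw [← Real.sin_arcsin (by linarith) h]
  exact Real.sin_le (Real.arcsin_nonneg.2 h0)

theorem hasDerivAt_lineArg {x v : ℝ} (hx : 0 ≤ x) (h : x * Real.exp (-v) < 1) :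
    HasDerivAt (lineArg x) (Real.tan (Real.arcsin (x * Real.exp (-v)))) v := by
  have h0 : 0 ≤ x * Real.exp (-v) := by positivity
  have h1 : HasDerivAt (fun v => x * Real.exp (-v)) (-(x * Real.exp (-v))) v := by
    have := ((hasDerivAt_neg v).exp).const_mul x
    simpa using this
  have h2 := ((Real.hasDerivAt_arcsin (x := x * Real.exp (-v)) (by linarith) h.ne).comp v
    h1).const_sub (Real.pi / 2)
  refine h2.congr_deriv ?_
  rw [Real.tan_arcsin]
  ring

theorem hasDerivAt_tan_arcsin {x v : ℝ} (hx : 0 ≤ x) (h : x * Real.exp (-v) < 1) :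
    HasDerivAt (fun v => Real.tan (Real.arcsin (x * Real.exp (-v))))
      (-(Real.tan (Real.arcsin (x * Real.exp (-v))) *
        (1 + Real.tan (Real.arcsin (x * Real.exp (-v))) ^ 2))) v := by
  have h0 : 0 ≤ x * Real.exp (-v) := by positivity
  have h1 := (hasDerivAt_lineArg hx h).const_sub (Real.pi / 2)
  have h2 : (fun v => Real.pi / 2 - lineArg x v) = fun v => Real.arcsin (x * Real.exp (-v)) := by
    ext v; simp [lineArg]
  rw [h2] at h1
  have hcos : Real.cos (Real.arcsin (x * Real.exp (-v))) ≠ 0 := by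
    rw [Real.cos_arcsin]
    exact (Real.sqrt_pos.2 (by nlinarith)).ne'
  have h3 := (Real.hasDerivAt_tan hcos).comp v h1
  refine h3.congr_deriv ?_
  rw [one_div, ← Real.inv_one_add_tan_sq hcos, inv_inv]
  ring

/-- A bump function on `[a, a + 3]` vanishing to second order at the endpoints. -/
def bump (a v : ℝ) : ℝ := ((v - a) * (a + 3 - v)) ^ 2

theorem bump_nonneg (a v : ℝ) : 0 ≤ bump a v := sq_nonneg _

theorem continuous_bump (a : ℝ) : Continuous (bump a) := by unfold bump; fun_prop

theorem bump_le {a v : ℝ} (h : v ∈ Set.Icc a (a + 3)) : bump a v ≤ 6 := by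
  have h1 : 0 ≤ (v - a) * (a + 3 - v) := mul_nonneg (by linarith [h.1]) (by linarith [h.2])
  have h2 : (v - a) * (a + 3 - v) ≤ 9 / 4 := by nlinarith [sq_nonneg (v - a - 3 / 2)]
  unfold bump
  nlinarith

theorem one_le_bump {a v : ℝ} (h1 : a + 1 ≤ v) (h2 : v ≤ a + 2) : 1 ≤ bump a v := by
  have : 1 ≤ (v - a) * (a + 3 - v) := by nlinarith
  unfold bump
  nlinarith

theorem one_add_sq_mul_exp_le {y : ℝ} (hy : 0 ≤ y) :
    (1 + y) ^ 2 * Real.exp (-y) ≤ 16 * Real.exp (-(y / 2)) := by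
  have h1 : 1 + y ≤ 4 * Real.exp (y / 4) := by linarith [Real.add_one_le_exp (y / 4)]
  have h2 : (1 + y) ^ 2 ≤ 16 * Real.exp (y / 2) := by
    calc _ ≤ (4 * Real.exp (y / 4)) ^ 2 := by gcongr
      _ = _ := by rw [mul_pow, ← Real.exp_nat_mul]; norm_num; ring
  calc _ ≤ 16 * Real.exp (y / 2) * Real.exp (-y) := by gcongr
    _ = _ := by rw [mul_assoc, ← Real.exp_add]; congr 2; ring

set_option maxHeartbeats 1000000 in
/-- Decay of the kernel obtained by squaring the Mellin kernel and integrating over a dyadic piece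
of a vertical line. -/
theorem exists_norm_integral_bump_mul_exp_le :
    ∃ C > 0, ∀ x a : ℝ, 0 < x → x * Real.exp (-a) ≤ 1 / 2 → ∀ τ T S : ℝ, |T| ≤ S →
      ‖∫ v in a..(a + 3), ((bump a v * Real.exp (lineArg x v * T) : ℝ) : ℂ) *
        Complex.exp (-(τ * v * Complex.I))‖ ≤
      C * Real.exp ((Real.pi / 2 - x * Real.exp (-(a + 3)) / 2) * S) * (1 + τ ^ 2)⁻¹ := by
  refine ⟨106 * Real.exp 3 ^ 2 * 16 * 3, by positivity, fun x a hx hxa τ T S hTS => ?_⟩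
  have hS : 0 ≤ S := (abs_nonneg T).trans hTS
  set ρ := x * Real.exp (-(a + 3)) with hρ
  have hρ0 : 0 < ρ := by positivity
  have hρa : x * Real.exp (-a) = Real.exp 3 * ρ := by
    rw [hρ, mul_left_comm, ← Real.exp_add]; congr 2; ring
  set k : ℝ → ℝ := fun v => Real.tan (Real.arcsin (x * Real.exp (-v))) with hk
  set q : ℝ → ℝ := fun v => (v - a) * (a + 3 - v) with hq
  set q' : ℝ → ℝ := fun v => 2 * a + 3 - 2 * v with hq'
  have hr : ∀ v ∈ Set.Icc a (a + 3), x * Real.exp (-v) ≤ Real.exp 3 * ρ := by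
    intro v hv
    rw [← hρa]
    gcongr
    exact hv.1
  have hr1 : ∀ v ∈ Set.Icc a (a + 3), x * Real.exp (-v) ≤ 1 / 2 := fun v hv =>
    (hr v hv).trans (hρa ▸ hxa)
  have hdq : ∀ v, HasDerivAt q (q' v) v := by
    intro v
    have := ((hasDerivAt_id v).sub_const a).mul ((hasDerivAt_id v).const_sub (a + 3))
    refine this.congr_deriv ?_
    simp [hq']; ring
  have hdq' : ∀ v, HasDerivAt q' (-2) v := by
    intro v
    have := ((hasDerivAt_id v).const_mul 2).const_sub (2 * a + 3)
    refine this.congr_deriv ?_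
    simp
  set E : ℝ → ℝ := fun v => Real.exp (lineArg x v * T) with hE
  have hdE : ∀ v ∈ Set.Icc a (a + 3), HasDerivAt E (E v * (k v * T)) v := fun v hv =>
    ((hasDerivAt_lineArg hx.le (by linarith [hr1 v hv])).mul_const T).exp
  have hdk : ∀ v ∈ Set.Icc a (a + 3), HasDerivAt k (-(k v * (1 + k v ^ 2))) v := fun v hv =>
    hasDerivAt_tan_arcsin hx.le (by linarith [hr1 v hv])
  set f' : ℝ → ℝ := fun v => (2 * q v * q' v + q v ^ 2 * (k v * T)) * E v with hf'
  set f'' : ℝ → ℝ := fun v => (2 * q' v ^ 2 - 4 * q v + 4 * q v * q' v * (k v * T) -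
    q v ^ 2 * (k v * (1 + k v ^ 2) * T) + q v ^ 2 * (k v * T) ^ 2) * E v with hf''
  have hkE : ContinuousOn k (Set.Icc a (a + 3)) := fun v hv =>
    (hdk v hv).continuousAt.continuousWithinAt
  have hEc : ContinuousOn E (Set.Icc a (a + 3)) := fun v hv =>
    (hdE v hv).continuousAt.continuousWithinAt
  have hqc : Continuous q := by fun_prop
  have hq'c : Continuous q' := by fun_prop
  have key : ∀ v ∈ Set.Icc a (a + 3), |bump a v * E v| + |f'' v| ≤
      106 * Real.exp 3 ^ 2 * 16 * Real.exp ((Real.pi / 2 - ρ / 2) * S) := by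
    intro v hv
    have hk0 : 0 ≤ k v := by
      simp only [hk]
      rw [Real.tan_arcsin]
      positivity
    have hk2 : k v ≤ 2 * (x * Real.exp (-v)) := by
      simp only [hk]
      rw [Real.tan_arcsin]
      have h0 : 0 ≤ x * Real.exp (-v) := by positivity
      have h1 : 1 / 2 ≤ √(1 - (x * Real.exp (-v)) ^ 2) := by
        refine Real.le_sqrt_of_sq_le ?_
        nlinarith [hr1 v hv]
      rw [div_le_iff₀ (by linarith)]
      nlinarith
    have hk1 : k v ≤ 1 := by linarith [hr1 v hv]
    have hkS : k v * |T| ≤ 2 * (Real.exp 3 * ρ * S) := by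
      calc _ ≤ 2 * (Real.exp 3 * ρ) * S := by
            refine mul_le_mul (by linarith [hr v hv]) hTS (abs_nonneg _) (by positivity)
        _ = _ := by ring
    have hq0 : 0 ≤ q v := mul_nonneg (by linarith [hv.1]) (by linarith [hv.2])
    have hq9 : q v ≤ 9 / 4 := by simp only [hq]; nlinarith [sq_nonneg (v - a - 3 / 2)]
    have hq'3 : |q' v| ≤ 3 := abs_le.2 ⟨by simp only [hq']; linarith [hv.2],
      by simp only [hq']; linarith [hv.1]⟩
    have hE0 : 0 < E v := Real.exp_pos _
    set m := Real.exp 3 * ρ * S with hm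
    have hm0 : 0 ≤ m := by positivity
    have hkT : |k v * T| ≤ 2 * m := by rwa [abs_mul, abs_of_nonneg hk0]
    have hq2 : q v ^ 2 ≤ 6 := by nlinarith
    have hk3 : k v * (1 + k v ^ 2) * |T| ≤ 4 * m := by
      have h1 : 1 + k v ^ 2 ≤ 2 := by nlinarith
      calc k v * (1 + k v ^ 2) * |T| = (1 + k v ^ 2) * (k v * |T|) := by ring
        _ ≤ 2 * (2 * m) := by gcongr
        _ = _ := by ring
    have hf2 : |f'' v| ≤ 100 * (1 + m) ^ 2 * E v := by
      simp only [hf'']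
      rw [abs_mul, abs_of_pos hE0]
      refine mul_le_mul_of_nonneg_right ?_ hE0.le
      have a1 : |2 * q' v ^ 2 - 4 * q v| ≤ 18 := by
        have : q' v ^ 2 ≤ 3 ^ 2 := sq_le_sq' (by linarith [(abs_le.1 hq'3).1]) (abs_le.1 hq'3).2
        rw [abs_le]
        constructor <;> nlinarith [sq_nonneg (q' v)]
      have a2 : |4 * q v * q' v * (k v * T)| ≤ 27 * (2 * m) := by
        rw [abs_mul, abs_mul, abs_of_nonneg (by positivity : 0 ≤ 4 * q v)]
        calc _ ≤ 4 * (9 / 4) * 3 * (2 * m) := by gcongr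
          _ = _ := by ring
      have a3 : |q v ^ 2 * (k v * (1 + k v ^ 2) * T)| ≤ 6 * (4 * m) := by
        rw [abs_mul, abs_of_nonneg (sq_nonneg _), abs_mul,
          abs_of_nonneg (by positivity : 0 ≤ k v * (1 + k v ^ 2))]
        gcongr
      have a4 : |q v ^ 2 * (k v * T) ^ 2| ≤ 6 * (2 * m) ^ 2 := by
        rw [abs_mul, abs_of_nonneg (sq_nonneg _), abs_pow]
        gcongr
      calc _ ≤ 18 + 27 * (2 * m) + 6 * (4 * m) + 6 * (2 * m) ^ 2 := by
            refine (abs_add_le _ _).trans (add_le_add ((abs_sub _ _).trans (add_le_add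
              ((abs_add_le _ _).trans (add_le_add a1 a2)) a3)) a4)
        _ ≤ _ := by nlinarith
    have hb : |bump a v * E v| ≤ 6 * (1 + m) ^ 2 * E v := by
      rw [abs_mul, abs_of_nonneg (bump_nonneg a v), abs_of_pos hE0]
      refine mul_le_mul_of_nonneg_right ((bump_le hv).trans ?_) hE0.le
      nlinarith
    have hρv : ρ ≤ x * Real.exp (-v) := by
      rw [hρ]
      gcongr
      exact hv.2
    have hEle : E v ≤ Real.exp (Real.pi / 2 * S) * Real.exp (-(ρ * S)) := by
      rw [← Real.exp_add]
      refine Real.exp_le_exp.2 ?_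
      have h1 := lineArg_le (v := v) hx.le (by linarith [hr1 v hv])
      have h2 := lineArg_nonneg x v
      calc lineArg x v * T ≤ lineArg x v * S := by
            gcongr; exact (le_abs_self T).trans hTS
        _ ≤ (Real.pi / 2 - ρ) * S := by gcongr; linarith
        _ = _ := by ring
    have hm1 : 1 + m ≤ Real.exp 3 * (1 + ρ * S) := by
      have : 1 ≤ Real.exp 3 := Real.one_le_exp (by norm_num)
      rw [hm]; linarith
    have h16 := one_add_sq_mul_exp_le (y := ρ * S) (by positivity)
    calc _ ≤ 106 * (1 + m) ^ 2 * E v := by linarith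
      _ ≤ 106 * (Real.exp 3 * (1 + ρ * S)) ^ 2 *
          (Real.exp (Real.pi / 2 * S) * Real.exp (-(ρ * S))) := by gcongr
      _ = 106 * Real.exp 3 ^ 2 * Real.exp (Real.pi / 2 * S) *
          ((1 + ρ * S) ^ 2 * Real.exp (-(ρ * S))) := by ring
      _ ≤ 106 * Real.exp 3 ^ 2 * Real.exp (Real.pi / 2 * S) *
          (16 * Real.exp (-(ρ * S / 2))) := by gcongr
      _ = 106 * Real.exp 3 ^ 2 * 16 *
          (Real.exp (Real.pi / 2 * S) * Real.exp (-(ρ * S / 2))) := by ring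
      _ = _ := by rw [← Real.exp_add]; congr 2; ring
  have hqa : q a = 0 := by simp [hq]
  have hqb : q (a + 3) = 0 := by simp [hq]
  refine (norm_integral_mul_cexp_le (f := fun v => bump a v * E v) (f' := f') (f'' := f'')
    (by linarith) (fun v hv => ?_) (fun v hv => ?_) ?_ ?_ ?_ ?_ ?_ key τ).trans (le_of_eq ?_)
  · refine (((hdq v).pow 2).mul (hdE v hv)).congr_deriv ?_
    simp only [hf', Pi.pow_apply]
    push_cast
    ring
  · refine (((((hdq v).const_mul 2).mul (hdq' v)).add (((hdq v).pow 2).mul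
      ((hdk v hv).mul_const T))).mul (hdE v hv)).congr_deriv ?_
    simp only [hf'', Pi.mul_apply, Pi.pow_apply, Pi.add_apply]
    push_cast
    ring
  · have h1 := hqc.continuousOn (s := Set.Icc a (a + 3))
    have h2 := hq'c.continuousOn (s := Set.Icc a (a + 3))
    clear_value k q q' E
    simp only [hf'']
    fun_prop
  · simp [bump]
  · simp [bump]
  · simp [hf', hqa]
  · simp [hf', hqb]
  · ring

/-- The Mellin-type integral along the line `Re z = x`, at the point with `log z = v - i φ`. -/
noncomputable def mellinLine (g : ℝ → ℂ) (x v : ℝ) : ℂ :=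
  ∫ t : ℝ, g t * (Real.exp (-(t * lineArg x v)) : ℂ) * Complex.exp (-(t * v * Complex.I))

theorem norm_mellinLine_integrand (g : ℝ → ℂ) (x v t : ℝ) :
    ‖g t * (Real.exp (-(t * lineArg x v)) : ℂ) * Complex.exp (-(t * v * Complex.I))‖ =
      ‖g t‖ * Real.exp (-(t * lineArg x v)) := by
  rw [norm_mul, norm_mul, Complex.norm_real, Real.norm_eq_abs, abs_of_pos (Real.exp_pos _)]
  have : -((t : ℂ) * v * Complex.I) = ((-(t * v) : ℝ) : ℂ) * Complex.I := by push_cast; ring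
  rw [this, Complex.norm_exp_ofReal_mul_I, mul_one]

theorem norm_mul_exp_lineArg_le {g : ℝ → ℂ} {b : ℝ → ℝ} {x a : ℝ} (hx : 0 < x)
    (hxa : x * Real.exp (-a) ≤ 1 / 2) (hb0 : ∀ t, 0 ≤ b t)
    (hgb : ∀ t, ‖g t‖ * Real.exp (Real.pi / 2 * |t|) ≤
      b t * Real.exp (x * Real.exp (-(a + 3)) / 4 * |t|))
    {v : ℝ} (hv : v ∈ Set.Icc a (a + 3)) (t : ℝ) :
    ‖g t‖ * Real.exp (-(t * lineArg x v)) ≤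
      b t * Real.exp (-(x * Real.exp (-(a + 3)) / 4 * |t|)) := by
  set ρ := x * Real.exp (-(a + 3)) with hρ
  have hρ0 : 0 < ρ := by positivity
  have hρv : ρ ≤ x * Real.exp (-v) := by
    rw [hρ]
    gcongr
    exact hv.2
  have hva : x * Real.exp (-v) ≤ 1 / 2 := by
    refine le_trans ?_ hxa
    gcongr
    exact hv.1
  have h1 := lineArg_le (v := v) hx.le (by linarith)
  have h2 := lineArg_nonneg x v
  have h3 : -(t * lineArg x v) ≤ Real.pi / 2 * |t| + -(ρ * |t|) := by
    calc -(t * lineArg x v) = (-t) * lineArg x v := by ring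
      _ ≤ |t| * lineArg x v := by gcongr; exact neg_le_abs t
      _ ≤ |t| * (Real.pi / 2 - ρ) := by gcongr; linarith
      _ = _ := by ring
  have h4 : 0 ≤ ρ * |t| := by positivity
  calc _ ≤ ‖g t‖ * Real.exp (Real.pi / 2 * |t| + -(ρ * |t|)) := by gcongr
    _ = ‖g t‖ * Real.exp (Real.pi / 2 * |t|) * Real.exp (-(ρ * |t|)) := by
      rw [Real.exp_add]; ring
    _ ≤ b t * Real.exp (ρ / 4 * |t|) * Real.exp (-(ρ * |t|)) :=
      mul_le_mul_of_nonneg_right (hgb t) (Real.exp_pos _).le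
    _ = b t * Real.exp (ρ / 4 * |t| + -(ρ * |t|)) := by rw [Real.exp_add]; ring
    _ ≤ _ := by
      refine mul_le_mul_of_nonneg_left (Real.exp_le_exp.2 ?_) (hb0 t)
      linarith

theorem continuousOn_mellinLine {g : ℝ → ℂ} {b : ℝ → ℝ} {B x a : ℝ} (hx : 0 < x)
    (hxa : x * Real.exp (-a) ≤ 1 / 2) (hg : Continuous g) (hb : Continuous b) (hb0 : ∀ t, 0 ≤ b t)
    (hB : ∀ u, ∫ t in (u - 1 / 4)..(u + 1 / 4), b t ≤ B)
    (hgb : ∀ t, ‖g t‖ * Real.exp (Real.pi / 2 * |t|) ≤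
      b t * Real.exp (x * Real.exp (-(a + 3)) / 4 * |t|)) :
    ContinuousOn (mellinLine g x) (Set.Icc a (a + 3)) := by
  have hρ1 : x * Real.exp (-(a + 3)) ≤ 1 / 2 := by
    refine le_trans ?_ hxa
    gcongr
    linarith
  have hint := (integral_mul_exp_neg_le_of_local_average_le hb hb0 hB
    (r := x * Real.exp (-(a + 3)) / 4) (by positivity) (by linarith)).1
  unfold mellinLine
  refine MeasureTheory.continuousOn_of_dominated (F := fun v t =>
    g t * (Real.exp (-(t * lineArg x v)) : ℂ) * Complex.exp (-(t * v * Complex.I)))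
    (fun v _ => ?_) (fun v hv => ?_) hint ?_
  · refine Continuous.aestronglyMeasurable ?_
    have := continuous_lineArg x
    fun_prop
  · refine Filter.Eventually.of_forall fun t => ?_
    rw [norm_mellinLine_integrand]
    exact norm_mul_exp_lineArg_le hx hxa hb0 hgb hv t
  · refine Filter.Eventually.of_forall fun t => Continuous.continuousOn ?_
    have := continuous_lineArg x
    fun_prop

theorem integral_prod_mul_inv_one_add_sq_le {h : ℝ → ℝ} {B D : ℝ}
    (hh : Continuous h) (h0 : ∀ t, 0 ≤ h t) (hint : MeasureTheory.Integrable h)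
    (hD : ∫ t, h t ≤ D) (hB0 : 0 ≤ B)
    (hB : ∀ u, ∫ t in (u - 1 / 4)..(u + 1 / 4), h t ≤ B) :
    MeasureTheory.Integrable (fun p : ℝ × ℝ => h p.1 * h p.2 * (1 + (p.1 - p.2) ^ 2)⁻¹)
      (MeasureTheory.volume.prod MeasureTheory.volume) ∧
    ∫ p : ℝ × ℝ, h p.1 * h p.2 * (1 + (p.1 - p.2) ^ 2)⁻¹
      ∂(MeasureTheory.volume.prod MeasureTheory.volume) ≤ 4 * Real.pi * B * D := by
  have hI : MeasureTheory.Integrable (fun p : ℝ × ℝ => h p.1 * h p.2 * (1 + (p.1 - p.2) ^ 2)⁻¹)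
      (MeasureTheory.volume.prod MeasureTheory.volume) := by
    refine (hint.mul_prod hint).mono' ?_ (Filter.Eventually.of_forall fun p => ?_)
    · refine Continuous.aestronglyMeasurable ?_
      refine Continuous.mul (by fun_prop) (Continuous.inv₀ (by fun_prop) fun p => ?_)
      positivity
    · have h1 : 0 ≤ h p.1 * h p.2 := mul_nonneg (h0 _) (h0 _)
      rw [Real.norm_eq_abs, abs_of_nonneg (mul_nonneg h1 (by positivity))]
      refine mul_le_of_le_one_right h1 (inv_le_one_of_one_le₀ ?_)
      nlinarith [sq_nonneg (p.1 - p.2)]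
  refine ⟨hI, ?_⟩
  rw [MeasureTheory.integral_prod _ hI]
  calc _ ≤ ∫ t, h t * (4 * Real.pi * B) := by
        refine MeasureTheory.integral_mono hI.integral_prod_left (hint.mul_const _) fun t => ?_
        have h1 := (integral_mul_inv_one_add_sq_le_of_local_average_le hh h0 hB t).2
        calc ∫ y, h t * h y * (1 + (t - y) ^ 2)⁻¹ = h t * ∫ y, h y * (1 + (y - t) ^ 2)⁻¹ := by
              rw [← MeasureTheory.integral_const_mul]
              refine MeasureTheory.integral_congr_ae (Filter.Eventually.of_forall fun y => ?_)
              simp only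
              rw [mul_assoc, ← neg_sub y t, neg_sq]
          _ ≤ _ := mul_le_mul_of_nonneg_left h1 (h0 t)
    _ = (∫ t, h t) * (4 * Real.pi * B) := MeasureTheory.integral_mul_const _ _
    _ ≤ D * (4 * Real.pi * B) := by gcongr
    _ = _ := by ring

/-- Mean square bound for Mellin-type integrals over a dyadic piece of a vertical line. -/
theorem exists_integral_bump_mul_norm_sq_mellinLine_le :
    ∃ C > 0, ∀ (x a B : ℝ) (g : ℝ → ℂ) (b : ℝ → ℝ), 0 < x → x * Real.exp (-a) ≤ 1 / 2 →
      Continuous g → Continuous b → (∀ t, 0 ≤ b t) →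
      (∀ u, ∫ t in (u - 1 / 4)..(u + 1 / 4), b t ≤ B) →
      (∀ t, ‖g t‖ * Real.exp (Real.pi / 2 * |t|) ≤
        b t * Real.exp (x * Real.exp (-(a + 3)) / 4 * |t|)) →
      ∫ v in a..(a + 3), bump a v * ‖mellinLine g x v‖ ^ 2 ≤
        C * B ^ 2 / (x * Real.exp (-(a + 3))) := by
  obtain ⟨C, hC, hker⟩ := exists_norm_integral_bump_mul_exp_le
  refine ⟨C * (4 * Real.pi * 32), by positivity, fun x a B g b hx hxa hg hb hb0 hB hgb => ?_⟩
  have hdom := fun v hv => norm_mul_exp_lineArg_le hx hxa hb0 hgb (v := v) hv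
  set ρ := x * Real.exp (-(a + 3)) with hρ
  have hρ0 : 0 < ρ := by positivity
  have hρ1 : ρ ≤ 1 / 2 := by
    refine le_trans ?_ hxa
    rw [hρ]
    gcongr
    linarith
  obtain ⟨hint, hD⟩ := integral_mul_exp_neg_le_of_local_average_le hb hb0 hB
    (r := ρ / 4) (by positivity) (by linarith)
  set h : ℝ → ℝ := fun t => b t * Real.exp (-(ρ / 4 * |t|)) with hh
  have hhc : Continuous h := by fun_prop
  have hh0 : ∀ t, 0 ≤ h t := fun t => mul_nonneg (hb0 t) (Real.exp_pos _).le
  have hB0 : 0 ≤ B := (intervalIntegral.integral_nonneg (by norm_num) fun t _ => hb0 t).trans (hB 0)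
  have hhB : ∀ u, ∫ t in (u - 1 / 4)..(u + 1 / 4), h t ≤ B := fun u => by
    refine le_trans (intervalIntegral.integral_mono_on (by linarith)
      (hhc.intervalIntegrable _ _) (hb.intervalIntegrable _ _) fun t _ => ?_) (hB u)
    refine mul_le_of_le_one_right (hb0 t) (Real.exp_le_one_iff.2 ?_)
    have : 0 ≤ ρ / 4 * |t| := by positivity
    linarith
  obtain ⟨hI2, hle2⟩ := integral_prod_mul_inv_one_add_sq_le hhc hh0 hint hD hB0 hhB
  set F : ℝ → ℝ → ℂ := fun v t =>
    g t * (Real.exp (-(t * lineArg x v)) : ℂ) * Complex.exp (-(t * v * Complex.I)) with hF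
  have hM : ∀ v, mellinLine g x v = ∫ t, F v t := fun v => rfl
  have hφ := continuous_lineArg x
  have hβ := continuous_bump a
  set G : ℝ → ℝ × ℝ → ℂ := fun v p => (bump a v : ℂ) * (F v p.1 * (starRingEnd ℂ) (F v p.2)) with hG
  have hsq : ∀ v, ((bump a v * ‖mellinLine g x v‖ ^ 2 : ℝ) : ℂ) =
      ∫ p, G v p ∂(MeasureTheory.volume.prod MeasureTheory.volume) := by
    intro v
    simp only [hG]
    rw [MeasureTheory.integral_const_mul, MeasureTheory.integral_prod_mul (F v)
      (fun t => (starRingEnd ℂ) (F v t)), integral_conj, ← hM, Complex.mul_conj,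
      Complex.normSq_eq_norm_sq]
    push_cast
    rfl
  have hGI : MeasureTheory.Integrable (Function.uncurry G)
      ((MeasureTheory.volume.restrict (Set.Ioc a (a + 3))).prod
        (MeasureTheory.volume.prod MeasureTheory.volume)) := by
    have hmaj : MeasureTheory.Integrable (fun q : ℝ × (ℝ × ℝ) => (6 : ℝ) * (h q.2.1 * h q.2.2))
        ((MeasureTheory.volume.restrict (Set.Ioc a (a + 3))).prod
        (MeasureTheory.volume.prod MeasureTheory.volume)) :=
      (MeasureTheory.integrable_const (6 : ℝ)).mul_prod (hint.mul_prod hint)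
    refine hmaj.mono' ?_ ?_
    · refine Continuous.aestronglyMeasurable ?_
      simp only [hG, hF, Function.uncurry_def]
      have h1 : Continuous (starRingEnd ℂ) := Complex.continuous_conj
      fun_prop
    · have hr : (MeasureTheory.volume.restrict (Set.Ioc a (a + 3))).prod
          ((MeasureTheory.volume : MeasureTheory.Measure ℝ).prod
            (MeasureTheory.volume : MeasureTheory.Measure ℝ)) =
          ((MeasureTheory.volume : MeasureTheory.Measure ℝ).prod
            (MeasureTheory.volume.prod MeasureTheory.volume)).restrict
            (Set.Ioc a (a + 3) ×ˢ Set.univ) := by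
        rw [← MeasureTheory.Measure.prod_restrict, MeasureTheory.Measure.restrict_univ]
      rw [hr]
      refine (MeasureTheory.ae_restrict_iff' (measurableSet_Ioc.prod MeasurableSet.univ)).2
        (Filter.Eventually.of_forall fun q hq => ?_)
      have hv : q.1 ∈ Set.Icc a (a + 3) := Set.Ioc_subset_Icc_self hq.1
      simp only [hG, hF, Function.uncurry_def]
      rw [norm_mul, norm_mul, RCLike.norm_conj, norm_mellinLine_integrand,
        norm_mellinLine_integrand, Complex.norm_real, Real.norm_eq_abs,
        abs_of_nonneg (bump_nonneg _ _)]
      have h1 := hdom q.1 hv q.2.1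
      have h2 := hdom q.1 hv q.2.2
      have h3 := bump_le hv
      have h4 := hh0 q.2.1
      gcongr
  have hswap : ((∫ v in a..(a + 3), bump a v * ‖mellinLine g x v‖ ^ 2 : ℝ) : ℂ) =
      ∫ p, (∫ v in a..(a + 3), G v p) ∂(MeasureTheory.volume.prod MeasureTheory.volume) := by
    rw [← intervalIntegral.integral_ofReal]
    simp only [hsq]
    rw [intervalIntegral.integral_of_le (by linarith), MeasureTheory.integral_integral_swap hGI]
    simp only [intervalIntegral.integral_of_le (by linarith : a ≤ a + 3)]
  have hin : ∀ p : ℝ × ℝ, ‖∫ v in a..(a + 3), G v p‖ ≤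
      C * (h p.1 * h p.2 * (1 + (p.1 - p.2) ^ 2)⁻¹) := by
    intro p
    have e1 : ∀ v, G v p = (g p.1 * (starRingEnd ℂ) (g p.2)) *
        (((bump a v * Real.exp (lineArg x v * (-(p.1 + p.2))) : ℝ) : ℂ) *
        Complex.exp (-((p.1 - p.2 : ℝ) * v * Complex.I))) := by
      intro v
      simp only [hG, hF]
      have e2 : lineArg x v * (-(p.1 + p.2)) = -(p.1 * lineArg x v) + -(p.2 * lineArg x v) := by
        ring
      have e3 : -(((p.1 - p.2 : ℝ) : ℂ) * v * Complex.I) =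
          -(p.1 * v * Complex.I) + p.2 * v * Complex.I := by push_cast; ring
      have e4 : (starRingEnd ℂ) (Complex.exp (-(p.2 * v * Complex.I))) =
          Complex.exp (p.2 * v * Complex.I) := by
        rw [← Complex.exp_conj]; simp
      rw [map_mul, map_mul, Complex.conj_ofReal, e4, e2, e3, Real.exp_add, Complex.exp_add]
      push_cast
      ring
    simp only [e1]
    rw [intervalIntegral.integral_const_mul, norm_mul, norm_mul, RCLike.norm_conj]
    have hk := hker x a hx hxa (p.1 - p.2) (-(p.1 + p.2)) (|p.1| + |p.2|)
      (by rw [abs_neg]; exact abs_add_le _ _)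
    rw [← hρ] at hk
    have hs : ∀ t, ‖g t‖ * Real.exp ((Real.pi / 2 - ρ / 2) * |t|) ≤ h t := by
      intro t
      calc _ = ‖g t‖ * Real.exp (Real.pi / 2 * |t|) * Real.exp (-(ρ / 2 * |t|)) := by
            rw [mul_assoc, ← Real.exp_add]; congr 2; ring
        _ ≤ b t * Real.exp (ρ / 4 * |t|) * Real.exp (-(ρ / 2 * |t|)) :=
          mul_le_mul_of_nonneg_right (hgb t) (Real.exp_pos _).le
        _ = h t := by
          simp only [hh]
          rw [mul_assoc, ← Real.exp_add]; congr 2; ring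
    calc _ ≤ ‖g p.1‖ * ‖g p.2‖ * (C * Real.exp ((Real.pi / 2 - ρ / 2) * (|p.1| + |p.2|)) *
          (1 + (p.1 - p.2) ^ 2)⁻¹) := by gcongr
      _ = C * ((‖g p.1‖ * Real.exp ((Real.pi / 2 - ρ / 2) * |p.1|)) *
          (‖g p.2‖ * Real.exp ((Real.pi / 2 - ρ / 2) * |p.2|)) * (1 + (p.1 - p.2) ^ 2)⁻¹) := by
        rw [mul_add, Real.exp_add]; ring
      _ ≤ _ := by
        have h1 := hs p.1
        have h2 := hs p.2
        have h3 := hh0 p.1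
        gcongr
  have hfin : ‖((∫ v in a..(a + 3), bump a v * ‖mellinLine g x v‖ ^ 2 : ℝ) : ℂ)‖ ≤
      C * (4 * Real.pi * B * (8 * B / (ρ / 4))) := by
    rw [hswap]
    refine (MeasureTheory.norm_integral_le_of_norm_le (hI2.const_mul C)
      (Filter.Eventually.of_forall hin)).trans ?_
    rw [MeasureTheory.integral_const_mul]
    gcongr
  rw [Complex.norm_real] at hfin
  refine (le_abs_self _).trans (hfin.trans (le_of_eq ?_))
  field_simp
  ring

/-- The density of the critical integral against `z ^ (-s)`. -/
noncomputable def criticalDensity (δ t : ℝ) : ℂ :=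
  ((2 * (logDeriv zetaReg ((1 / 2 + δ : ℝ) + t * Complex.I)).re : ℝ) : ℂ) *
    Complex.Gamma ((1 / 2 + δ : ℝ) + t * Complex.I)

/-- A majorant of `criticalDensity`, exponentially damped and without the factor
`exp (-π |t| / 2)`. -/
noncomputable def criticalMajorant (δ r t : ℝ) : ℝ :=
  14 * |(logDeriv zetaReg ((1 / 2 + δ : ℝ) + t * Complex.I)).re| *
    ((1 + |t|) ^ δ * Real.exp (-(r * |t|)))

theorem criticalMajorant_nonneg (δ r t : ℝ) : 0 ≤ criticalMajorant δ r t := by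
  unfold criticalMajorant; positivity

theorem RiemannHypothesis.continuous_criticalMajorant (hRH : RiemannHypothesis) {δ : ℝ}
    (hδ : 0 < δ) (r : ℝ) : Continuous (criticalMajorant δ r) := by
  have h := continuous_logDeriv_zetaReg_vertical hRH (σ := 1 / 2 + δ) (by linarith)
  have h2 : Continuous fun t : ℝ => (1 + |t|) ^ δ :=
    Continuous.rpow_const (by fun_prop) fun t => Or.inr hδ.le
  unfold criticalMajorant
  have h3 := Complex.continuous_re.comp h
  simp only [Function.comp_def] at h3
  fun_prop

theorem RiemannHypothesis.continuous_criticalDensity (hRH : RiemannHypothesis) {δ : ℝ}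
    (hδ : 0 < δ) : Continuous (criticalDensity δ) := by
  have h := continuous_logDeriv_zetaReg_vertical hRH (σ := 1 / 2 + δ) (by linarith)
  have h3 := Complex.continuous_re.comp h
  simp only [Function.comp_def] at h3
  have h4 : Continuous fun t : ℝ => Complex.Gamma ((1 / 2 + δ : ℝ) + t * Complex.I) := by
    refine continuous_iff_continuousAt.2 fun t => ?_
    have h5 : DifferentiableAt ℂ Complex.Gamma ((1 / 2 + δ : ℝ) + t * Complex.I) := by
      refine Complex.differentiableAt_Gamma _ fun m hm => ?_
      have := congrArg Complex.re hm
      simp at this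
      have : (0 : ℝ) ≤ m := Nat.cast_nonneg m
      linarith
    exact ContinuousAt.comp (f := fun t : ℝ => ((1 / 2 + δ : ℝ) : ℂ) + t * Complex.I)
      h5.continuousAt (by fun_prop)
  unfold criticalDensity
  fun_prop

theorem norm_criticalDensity_mul_exp_le {δ : ℝ} (hδ : 0 < δ) (hδ1 : δ ≤ 1) (r t : ℝ) :
    ‖criticalDensity δ t‖ * Real.exp (Real.pi / 2 * |t|) ≤
      criticalMajorant δ r t * Real.exp (r * |t|) := by
  have hΓ := Complex.norm_Gamma_le (s := ((1 / 2 + δ : ℝ) : ℂ) + t * Complex.I)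
    (by simp; linarith) (by simp; linarith)
  have e1 : (((1 / 2 + δ : ℝ) : ℂ) + t * Complex.I).re = 1 / 2 + δ := by simp
  have e2 : (((1 / 2 + δ : ℝ) : ℂ) + t * Complex.I).im = t := by simp
  rw [e1, e2, add_sub_cancel_left] at hΓ
  unfold criticalDensity criticalMajorant
  rw [norm_mul, Complex.norm_real, Real.norm_eq_abs, abs_mul, abs_two]
  set w := |(logDeriv zetaReg ((1 / 2 + δ : ℝ) + t * Complex.I)).re|
  have hw : 0 ≤ w := abs_nonneg _
  calc _ ≤ 2 * w * (7 * (1 + |t|) ^ δ * Real.exp (-(Real.pi / 2 * |t|))) *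
        Real.exp (Real.pi / 2 * |t|) := by gcongr
    _ = 14 * w * (1 + |t|) ^ δ *
        (Real.exp (-(Real.pi / 2 * |t|)) * Real.exp (Real.pi / 2 * |t|)) := by ring
    _ = 14 * w * (1 + |t|) ^ δ * (Real.exp (-(r * |t|)) * Real.exp (r * |t|)) := by
      rw [← Real.exp_add, ← Real.exp_add]; simp
    _ = _ := by ring

theorem RiemannHypothesis.exists_integral_criticalMajorant_le (hRH : RiemannHypothesis) {κ : ℝ}
    (hκ : 0 < κ) : ∃ K > 0, ∀ x : ℝ, 1 < x → 4 ≤ Real.log x → ∀ r, κ / x ≤ r → ∀ u : ℝ,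
      ∫ t in (u - 1 / 4)..(u + 1 / 4), criticalMajorant (1 / Real.log x) r t ≤
        K * Real.log x := by
  obtain ⟨A, hA, hV⟩ := hRH.exists_integral_re_logDeriv_zetaReg_le
  obtain ⟨C, hC, hr⟩ := exists_one_add_abs_rpow_mul_exp_mul_log_le hκ
  refine ⟨14 * (C * A), by positivity, fun x hx hx4 r hxr u => ?_⟩
  set L := Real.log x
  have hL : 0 < L := by linarith
  have hδ : 0 < 1 / L := by positivity
  have hδ4 : 1 / L ≤ 1 / 4 := one_div_le_one_div_of_le (by norm_num) hx4
  have hlog : 0 < Real.log (|u| + 2) := Real.log_pos (by linarith [abs_nonneg u])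
  have hVc := Complex.continuous_re.comp
    (continuous_logDeriv_zetaReg_vertical hRH (σ := 1 / 2 + 1 / L) (by linarith))
  simp only [Function.comp_def] at hVc
  calc _ ≤ ∫ t in (u - 1 / 4)..(u + 1 / 4), (14 * (C * L / Real.log (|u| + 2))) *
        |(logDeriv zetaReg ((1 / 2 + 1 / L : ℝ) + t * Complex.I)).re| := by
        refine intervalIntegral.integral_mono_on (by linarith)
          ((hRH.continuous_criticalMajorant hδ r).intervalIntegrable _ _)
          ((continuous_const.mul hVc.abs).intervalIntegrable _ _) fun t ht => ?_
        have h1 := hr x hx hx4 r hxr t u (abs_le.2 ⟨by linarith [ht.1], by linarith [ht.2]⟩)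
        rw [← le_div_iff₀ hlog] at h1
        unfold criticalMajorant
        set w := |(logDeriv zetaReg ((1 / 2 + 1 / L : ℝ) + t * Complex.I)).re|
        have hw : 0 ≤ w := abs_nonneg _
        calc _ ≤ 14 * w * (C * L / Real.log (|u| + 2)) := by gcongr
          _ = _ := by ring
    _ ≤ 14 * (C * L / Real.log (|u| + 2)) * (A * Real.log (|u| + 2)) := by
        rw [intervalIntegral.integral_const_mul]
        exact mul_le_mul_of_nonneg_left (hV _ hδ hδ4 u) (by positivity)
    _ = _ := by field_simp

theorem lineArg_log_norm {z : ℂ} (hz : 0 < z.re) (hi : z.im < 0) :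
    Complex.log z = Real.log ‖z‖ - lineArg z.re (Real.log ‖z‖) * Complex.I := by
  have h0 : 0 < ‖z‖ := norm_pos_iff.2 fun h => by simp [h] at hz
  rw [Complex.log, Complex.arg_of_im_neg hi, lineArg, Real.exp_neg, Real.exp_log h0,
    ← div_eq_mul_inv, Real.arccos_eq_pi_div_two_sub_arcsin]
  push_cast
  ring

theorem norm_criticalIntegral_eq {z : ℂ} (hz : 0 < z.re) (hi : z.im < 0) (δ : ℝ) :
    ‖criticalIntegral δ z‖ = ‖z‖ ^ (-(1 / 2 + δ)) *
      ‖mellinLine (criticalDensity δ) z.re (Real.log ‖z‖)‖ := by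
  have hz0 : z ≠ 0 := fun h => by simp [h] at hz
  have h0 : 0 < ‖z‖ := norm_pos_iff.2 hz0
  set v := Real.log ‖z‖ with hv
  set φ := lineArg z.re v with hφ
  have key : criticalIntegral δ z = Complex.exp (((-((1 / 2 + δ) * v) : ℝ) : ℂ) +
      (((1 / 2 + δ) * φ : ℝ) : ℂ) * Complex.I) * mellinLine (criticalDensity δ) z.re v := by
    unfold criticalIntegral mellinLine criticalDensity
    rw [← MeasureTheory.integral_const_mul]
    refine MeasureTheory.integral_congr_ae (Filter.Eventually.of_forall fun t => ?_)
    simp only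
    rw [Complex.cpow_def_of_ne_zero hz0, lineArg_log_norm hz hi, ← hv, ← hφ]
    have e : ((v : ℂ) - φ * Complex.I) * -((1 / 2 + δ : ℝ) + t * Complex.I) =
        (((-((1 / 2 + δ) * v) : ℝ) : ℂ) + (((1 / 2 + δ) * φ : ℝ) : ℂ) * Complex.I) +
        ((-(t * φ) : ℝ) : ℂ) + -(t * v * Complex.I) := by
      push_cast
      linear_combination ((φ : ℂ) * t) * Complex.I_sq
    rw [e, Complex.exp_add, Complex.exp_add _ ((-(t * φ) : ℝ) : ℂ), Complex.ofReal_exp]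
    ring
  rw [key, norm_mul, Complex.norm_exp]
  congr 1
  rw [Real.rpow_def_of_pos h0]
  simp
  ring

theorem RiemannHypothesis.exists_norm_sq_criticalIntegral_le_of_norm_le (hRH : RiemannHypothesis) :
    ∃ C > 0, ∀ x : ℝ, 1 < x → 4 ≤ Real.log x → ∀ z : ℂ, z.re = 1 / x → ‖z‖ ≤ 16 / x →
      ‖criticalIntegral (1 / Real.log x) z‖ ^ 2 ≤ C * x * Real.log x ^ 2 := by
  obtain ⟨K, hK, hb⟩ := hRH.exists_integral_criticalMajorant_le (κ := 1 / 32) (by norm_num)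
  refine ⟨(Real.exp 1 * (8 * K * 32)) ^ 2, by positivity, fun x hx hx4 z hz hz16 => ?_⟩
  have hx0 : 0 < x := by linarith
  have hB := hb x hx hx4 (1 / 32) (div_le_self (by norm_num) hx.le)
  set L := Real.log x with hLdef
  have hL : 0 < L := by linarith
  have hδ : 0 < 1 / L := by positivity
  have hδ4 : 1 / L ≤ 1 / 4 := one_div_le_one_div_of_le (by norm_num) hx4
  have hre : 0 < z.re := by rw [hz]; positivity
  have hz0 : z ≠ 0 := fun h => by simp [h] at hre
  have h0 : 0 < ‖z‖ := norm_pos_iff.2 hz0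
  have hgap : 1 / 16 ≤ Real.pi / 2 - |z.arg| := by
    refine le_trans ?_ (re_div_norm_le_arg_gap hre)
    rw [hz, le_div_iff₀ h0]
    calc 1 / 16 * ‖z‖ ≤ 1 / 16 * (16 / x) := by gcongr
      _ = _ := by ring
  obtain ⟨hint, hle⟩ := integral_mul_exp_neg_le_of_local_average_le
    (hRH.continuous_criticalMajorant hδ (1 / 32)) (criticalMajorant_nonneg _ _) hB
    (r := 1 / 32) (by norm_num) (by norm_num)
  have hnz : ‖z‖ ^ (-(1 / 2 + 1 / L)) ≤ √x * Real.exp 1 := by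
    have h1 : x⁻¹ ≤ ‖z‖ := by
      rw [← one_div, ← hz]
      exact (le_abs_self _).trans (Complex.abs_re_le_norm z)
    calc _ ≤ (x⁻¹) ^ (-(1 / 2 + 1 / L)) :=
          Real.rpow_le_rpow_of_nonpos (by positivity) h1 (by linarith)
      _ = _ := by
        rw [Real.inv_rpow hx0.le, Real.rpow_neg hx0.le, inv_inv, Real.rpow_add hx0,
          ← Real.sqrt_eq_rpow, hLdef, rpow_one_div_log hx]
  have hnorm : ‖criticalIntegral (1 / L) z‖ ≤
      √x * Real.exp 1 * (8 * (K * L) / (1 / 32)) := by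
    refine le_trans (MeasureTheory.norm_integral_le_of_norm_le (hint.const_mul (√x * Real.exp 1))
      (Filter.Eventually.of_forall fun t => ?_)) ?_
    · rw [← mul_assoc, norm_mul]
      have h1 := norm_cpow_neg_le hz0 ((1 / 2 + 1 / L : ℝ) + t * Complex.I)
      have e1 : (((1 / 2 + 1 / L : ℝ) : ℂ) + t * Complex.I).re = 1 / 2 + 1 / L := by simp
      have e2 : (((1 / 2 + 1 / L : ℝ) : ℂ) + t * Complex.I).im = t := by simp
      rw [e1, e2] at h1
      have h2 := norm_criticalDensity_mul_exp_le hδ (by linarith) (1 / 32) t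
      have h3 : Real.exp (|z.arg| * |t|) ≤
          Real.exp (Real.pi / 2 * |t|) * Real.exp (-(1 / 16 * |t|)) := by
        rw [← Real.exp_add]
        refine Real.exp_le_exp.2 ?_
        nlinarith [abs_nonneg t]
      have h4 : 0 ≤ ‖criticalDensity (1 / L) t‖ := norm_nonneg _
      calc _ ≤ ‖criticalDensity (1 / L) t‖ * (√x * Real.exp 1 *
            (Real.exp (Real.pi / 2 * |t|) * Real.exp (-(1 / 16 * |t|)))) := by
            refine mul_le_mul_of_nonneg_left (h1.trans ?_) h4
            gcongr
        _ = √x * Real.exp 1 * ((‖criticalDensity (1 / L) t‖ * Real.exp (Real.pi / 2 * |t|)) *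
            Real.exp (-(1 / 16 * |t|))) := by ring
        _ ≤ √x * Real.exp 1 * (criticalMajorant (1 / L) (1 / 32) t * Real.exp (1 / 32 * |t|) *
            Real.exp (-(1 / 16 * |t|))) := by gcongr
        _ = _ := by
          rw [mul_assoc (criticalMajorant _ _ _), ← Real.exp_add]
          congr 4; ring
    · rw [MeasureTheory.integral_const_mul]
      gcongr
  calc _ ≤ (√x * Real.exp 1 * (8 * (K * L) / (1 / 32))) ^ 2 := by gcongr
    _ = (√x) ^ 2 * (Real.exp 1 * (8 * K * 32)) ^ 2 * L ^ 2 := by ring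
    _ = _ := by rw [Real.sq_sqrt hx0.le]; ring

theorem zOf_re (N : ℕ) (α : ℝ) : (zOf N α).re = 1 / N := by
  simp [zOf, ← Complex.ofReal_natCast, ← Complex.ofReal_inv]

theorem zOf_im (N : ℕ) (α : ℝ) : (zOf N α).im = -(2 * Real.pi * α) := by
  simp [zOf, ← Complex.ofReal_natCast, ← Complex.ofReal_inv]

theorem norm_zOf_sq (N : ℕ) (α : ℝ) : ‖zOf N α‖ ^ 2 = (1 / N) ^ 2 + (2 * Real.pi * α) ^ 2 := by
  rw [← Complex.normSq_eq_norm_sq, Complex.normSq_apply, zOf_re, zOf_im]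
  ring

theorem norm_zOf_pos {N : ℕ} (hN : 0 < N) (α : ℝ) : 0 < ‖zOf N α‖ := by
  refine norm_pos_iff.2 fun h => ?_
  have := zOf_re N α
  rw [h, Complex.zero_re] at this
  have h2 : (0 : ℝ) < 1 / N := by positivity
  linarith

theorem norm_zOf_le (N : ℕ) (α : ℝ) : ‖zOf N α‖ ≤ 1 / N + 2 * Real.pi * |α| := by
  refine (Complex.norm_le_abs_re_add_abs_im _).trans (le_of_eq ?_)
  rw [zOf_re, zOf_im, abs_neg, abs_mul, abs_of_nonneg (by positivity : (0 : ℝ) ≤ 2 * Real.pi),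
    abs_of_nonneg (by positivity)]

theorem le_norm_zOf (N : ℕ) (α : ℝ) : 2 * Real.pi * |α| ≤ ‖zOf N α‖ := by
  have := Complex.abs_im_le_norm (zOf N α)
  rwa [zOf_im, abs_neg, abs_mul, abs_of_nonneg (by positivity : (0 : ℝ) ≤ 2 * Real.pi)] at this

theorem norm_zOf_mono (N : ℕ) {α β : ℝ} (hα : 0 ≤ α) (h : α ≤ β) : ‖zOf N α‖ ≤ ‖zOf N β‖ := by
  refine le_of_sq_le_sq ?_ (norm_nonneg _)
  rw [norm_zOf_sq, norm_zOf_sq]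
  gcongr

theorem norm_zOf_two_mul_le (N : ℕ) (α : ℝ) : ‖zOf N (2 * α)‖ ≤ 2 * ‖zOf N α‖ := by
  refine le_of_sq_le_sq ?_ (by positivity)
  rw [mul_pow, norm_zOf_sq, norm_zOf_sq]
  nlinarith [sq_nonneg (1 / (N : ℝ))]

theorem hasDerivAt_log_norm_zOf {N : ℕ} (hN : 0 < N) (α : ℝ) :
    HasDerivAt (fun α => Real.log ‖zOf N α‖) (4 * Real.pi ^ 2 * α / ‖zOf N α‖ ^ 2) α := by
  have h0 := norm_zOf_pos hN α
  have h1 : (fun α => Real.log ‖zOf N α‖) =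
      fun α => 1 / 2 * Real.log ((1 / N) ^ 2 + (2 * Real.pi * α) ^ 2) := by
    ext β
    rw [← norm_zOf_sq, Real.log_pow]
    push_cast
    ring
  rw [h1]
  have h2 : HasDerivAt (fun α : ℝ => (1 / (N : ℝ)) ^ 2 + (2 * Real.pi * α) ^ 2)
      (8 * Real.pi ^ 2 * α) α := by
    have := (((hasDerivAt_id α).const_mul (2 * Real.pi)).pow 2).const_add ((1 / (N : ℝ)) ^ 2)
    refine this.congr_deriv ?_
    simp
    ring
  have h3 := (h2.log (by rw [← norm_zOf_sq]; positivity)).const_mul (1 / 2)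
  refine h3.congr_deriv ?_
  rw [← norm_zOf_sq]
  ring

theorem continuous_zOf (N : ℕ) : Continuous (zOf N) := by
  unfold zOf
  fun_prop

set_option maxHeartbeats 1000000 in
theorem RiemannHypothesis.exists_integral_norm_sq_criticalIntegral_dyadic_le
    (hRH : RiemannHypothesis) :
    ∃ C > 0, ∀ N : ℕ, 1 < N → 4 ≤ Real.log N → ∀ ξ : ℝ, 1 / N ≤ ξ → ξ ≤ 1 / 4 →
      IntervalIntegrable (fun α => ‖criticalIntegral (1 / Real.log N) (zOf N α)‖ ^ 2)
        MeasureTheory.volume ξ (2 * ξ) ∧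
      ∫ α in ξ..(2 * ξ), ‖criticalIntegral (1 / Real.log N) (zOf N α)‖ ^ 2 ≤
        C * N * ξ * Real.log N ^ 2 := by
  obtain ⟨K, hK, hb⟩ := hRH.exists_integral_criticalMajorant_le
    (κ := 1 / (8 * Real.exp 1 ^ 2)) (by positivity)
  obtain ⟨C, hC, hM⟩ := exists_integral_bump_mul_norm_sq_mellinLine_le
  refine ⟨4 * Real.exp 1 ^ 4 * C * K ^ 2 * 8, by positivity, fun N hN hN4 ξ hξ1 hξ2 => ?_⟩
  have hN0 : 0 < N := by omega
  have hNR : (1 : ℝ) < N := by exact_mod_cast hN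
  have hNR0 : (0 : ℝ) < N := by linarith
  have hξ0 : 0 < ξ := lt_of_lt_of_le (by positivity) hξ1
  have hπ := Real.pi_gt_three
  have hπ4 := Real.pi_lt_d2
  set L := Real.log N with hL
  have hL0 : 0 < L := by linarith
  have hδ : 0 < 1 / L := by positivity
  have hδ4 : 1 / L ≤ 1 / 4 := one_div_le_one_div_of_le (by norm_num) hN4
  have hnp := norm_zOf_pos hN0
  set v : ℝ → ℝ := fun α => Real.log ‖zOf N α‖ with hv
  set a := v ξ - 1 with ha
  have hnξ : 2 * Real.pi * ξ ≤ ‖zOf N ξ‖ := by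
    have := le_norm_zOf N ξ
    rwa [abs_of_pos hξ0] at this
  have hnα : ∀ α, ξ ≤ α → ‖zOf N α‖ ≤ 8 * α := by
    intro α hα
    have := norm_zOf_le N α
    rw [abs_of_pos (hξ0.trans_le hα)] at this
    nlinarith
  have hea : Real.exp (-a) = Real.exp 1 / ‖zOf N ξ‖ := by
    rw [ha, neg_sub, Real.exp_sub, hv, Real.exp_log (hnp ξ)]
  have hea3 : Real.exp (-(a + 3)) = (Real.exp 1 ^ 2 * ‖zOf N ξ‖)⁻¹ := by
    rw [show -(a + 3) = -(1 + 1 + v ξ) by rw [ha]; ring, Real.exp_neg, Real.exp_add, Real.exp_add,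
      hv, Real.exp_log (hnp ξ), sq]
  have hxa : 1 / (N : ℝ) * Real.exp (-a) ≤ 1 / 2 := by
    rw [hea, mul_div_assoc', div_le_iff₀ (hnp ξ)]
    have := Real.exp_one_lt_d9
    calc 1 / (N : ℝ) * Real.exp 1 ≤ ξ * 3 := by gcongr; linarith
      _ ≤ _ := by nlinarith
  set ρ := 1 / (N : ℝ) * Real.exp (-(a + 3)) with hρ
  have hρ0 : 0 < ρ := by positivity
  have hρinv : 1 / ρ ≤ N * Real.exp 1 ^ 2 * (8 * ξ) := by
    have : 1 / ρ = N * Real.exp 1 ^ 2 * ‖zOf N ξ‖ := by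
      rw [hρ, hea3]; field_simp
    rw [this]
    gcongr
    exact hnα ξ le_rfl
  have hρκ : 1 / (8 * Real.exp 1 ^ 2) / N ≤ ρ / 4 := by
    have h1 : 1 / ρ ≤ 2 * (N * Real.exp 1 ^ 2) := by
      refine hρinv.trans ?_
      have : 0 < N * Real.exp 1 ^ 2 := by positivity
      nlinarith
    rw [div_le_iff₀ hρ0] at h1
    rw [div_div, div_le_iff₀ (by positivity)]
    linarith
  have hB := hb N hNR hN4 (ρ / 4) hρκ
  have hgb := norm_criticalDensity_mul_exp_le hδ (by linarith) (ρ / 4)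
  have hgc := hRH.continuous_criticalDensity hδ
  have hbc := hRH.continuous_criticalMajorant hδ (ρ / 4)
  have hb0 := criticalMajorant_nonneg (1 / L) (ρ / 4)
  have hmean := hM (1 / N) a (K * L) _ _ (by positivity) hxa hgc hbc hb0 hB hgb
  have hcont := continuousOn_mellinLine (x := 1 / N) (by positivity) hxa hgc hbc hb0 hB hgb
  set M := mellinLine (criticalDensity (1 / L)) (1 / N) with hMdef
  have hvc : Continuous v := by
    simp only [hv]
    exact (continuous_zOf N).norm.log fun α => (hnp α).ne'
  have hvmono : ∀ α, ξ ≤ α → v ξ ≤ v α := fun α h =>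
    Real.log_le_log (hnp _) (norm_zOf_mono N hξ0.le h)
  have hv2 : v (2 * ξ) ≤ v ξ + 1 := by
    calc v (2 * ξ) ≤ Real.log (2 * ‖zOf N ξ‖) :=
          Real.log_le_log (hnp _) (norm_zOf_two_mul_le N ξ)
      _ = Real.log 2 + v ξ := Real.log_mul (by norm_num) (hnp ξ).ne'
      _ ≤ _ := by linarith [Real.log_two_lt_d9]
  have hvle : ∀ α, ξ ≤ α → α ≤ 2 * ξ → v α ≤ v ξ + 1 := fun α h1 h2 =>
    (Real.log_le_log (hnp _) (norm_zOf_mono N (by linarith) h2)).trans hv2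
  have hmaps : Set.MapsTo v (Set.Icc ξ (2 * ξ)) (Set.Icc a (a + 3)) := fun α hα =>
    ⟨by linarith [hvmono α hα.1], by linarith [hvle α hα.1 hα.2]⟩
  have hMv : ContinuousOn (fun α => M (v α)) (Set.Icc ξ (2 * ξ)) :=
    hcont.comp hvc.continuousOn hmaps
  have hform : ∀ α ∈ Set.Icc ξ (2 * ξ), ‖criticalIntegral (1 / L) (zOf N α)‖ ^ 2 =
      (‖zOf N α‖ ^ (-(1 / 2 + 1 / L)) * ‖M (v α)‖) ^ 2 := by
    intro α hα
    rw [norm_criticalIntegral_eq (by rw [zOf_re]; positivity)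
      (by rw [zOf_im]; have : 0 < α := hξ0.trans_le hα.1
          have : 0 < 2 * Real.pi * α := by positivity
          linarith), zOf_re]
  have huIcc : Set.uIcc ξ (2 * ξ) = Set.Icc ξ (2 * ξ) := Set.uIcc_of_le (by linarith)
  have hI1 : IntervalIntegrable (fun α => ‖criticalIntegral (1 / L) (zOf N α)‖ ^ 2)
        MeasureTheory.volume ξ (2 * ξ) := by
    refine ContinuousOn.intervalIntegrable ?_
    rw [huIcc]
    refine ContinuousOn.congr ?_ hform
    refine ContinuousOn.pow (ContinuousOn.mul ?_ hMv.norm) 2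
    exact ((continuous_zOf N).norm.rpow_const fun α => Or.inl (hnp α).ne').continuousOn
  refine ⟨hI1, ?_⟩
  set v' : ℝ → ℝ := fun α => 4 * Real.pi ^ 2 * α / ‖zOf N α‖ ^ 2 with hv'
  have hv'c : Continuous v' := by
    simp only [hv']
    refine Continuous.div (by fun_prop) ((continuous_zOf N).norm.pow 2) fun α => ?_
    have := hnp α
    positivity
  have hpt : ∀ α ∈ Set.Icc ξ (2 * ξ), ‖criticalIntegral (1 / L) (zOf N α)‖ ^ 2 ≤
      4 * Real.exp 1 ^ 2 * (‖M (v α)‖ ^ 2 * v' α) := by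
    intro α hα
    have hα0 : 0 < α := hξ0.trans_le hα.1
    rw [hform α hα, mul_pow]
    have h1 : ‖zOf N α‖ ^ (-(1 / 2 + 1 / L)) ≤ (√ξ)⁻¹ * Real.exp 1 := by
      have h2 : ξ ≤ ‖zOf N α‖ := by
        refine le_trans ?_ (norm_zOf_mono N hξ0.le hα.1)
        nlinarith
      calc _ ≤ ξ ^ (-(1 / 2 + 1 / L)) :=
            Real.rpow_le_rpow_of_nonpos hξ0 h2 (by linarith)
        _ = (√ξ)⁻¹ * (ξ⁻¹) ^ (1 / L) := by
          rw [neg_add, Real.rpow_add hξ0, Real.rpow_neg hξ0.le, ← Real.sqrt_eq_rpow,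
            Real.rpow_neg hξ0.le, Real.inv_rpow hξ0.le]
        _ ≤ (√ξ)⁻¹ * (N : ℝ) ^ (1 / L) := by
          gcongr
          rw [one_div] at hξ1
          exact inv_le_of_inv_le₀ hNR0 hξ1
        _ = _ := by rw [hL, rpow_one_div_log hNR]
    have h3 : (‖zOf N α‖ ^ (-(1 / 2 + 1 / L))) ^ 2 ≤ ξ⁻¹ * Real.exp 1 ^ 2 := by
      calc _ ≤ ((√ξ)⁻¹ * Real.exp 1) ^ 2 := by gcongr
        _ = _ := by rw [mul_pow, inv_pow, Real.sq_sqrt hξ0.le]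
    have h4 : ξ⁻¹ ≤ 4 * v' α := by
      have h5 := hnα α hα.1
      have h6 : ‖zOf N α‖ ^ 2 ≤ (8 * α) ^ 2 := by gcongr
      have h7 : 0 < ‖zOf N α‖ ^ 2 := by have := hnp α; positivity
      simp only [hv']
      rw [mul_div_assoc', le_div_iff₀ h7, inv_mul_le_iff₀ hξ0]
      have h8 : (9 : ℝ) ≤ Real.pi ^ 2 := by nlinarith
      calc _ ≤ 64 * α * α := by linarith
        _ ≤ 64 * α * (2 * ξ) := by gcongr; exact hα.2
        _ = ξ * (4 * (4 * 8 * α)) := by ring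
        _ ≤ _ := by gcongr; linarith
    calc _ ≤ (ξ⁻¹ * Real.exp 1 ^ 2) * ‖M (v α)‖ ^ 2 := by gcongr
      _ ≤ (4 * v' α * Real.exp 1 ^ 2) * ‖M (v α)‖ ^ 2 := by gcongr
      _ = _ := by ring
  have hI2 : IntervalIntegrable (fun α => 4 * Real.exp 1 ^ 2 * (‖M (v α)‖ ^ 2 * v' α))
      MeasureTheory.volume ξ (2 * ξ) := by
    refine ContinuousOn.intervalIntegrable ?_
    rw [huIcc]
    exact continuousOn_const.mul ((hMv.norm.pow 2).mul hv'c.continuousOn)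
  have hsub : ∫ α in ξ..(2 * ξ), ‖M (v α)‖ ^ 2 * v' α = ∫ w in (v ξ)..(v (2 * ξ)), ‖M w‖ ^ 2 := by
    refine intervalIntegral.integral_comp_mul_deriv'' (f := v) (f' := v')
      (g := fun w => ‖M w‖ ^ 2) hvc.continuousOn
      (fun α _ => (hasDerivAt_log_norm_zOf hN0 α).hasDerivWithinAt) hv'c.continuousOn ?_
    rw [huIcc]
    exact (hcont.norm.pow 2).mono hmaps.image_subset
  have hle : ∫ w in (v ξ)..(v (2 * ξ)), ‖M w‖ ^ 2 ≤
      ∫ w in a..(a + 3), bump a w * ‖M w‖ ^ 2 := by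
    have hs : Set.Icc (v ξ) (v (2 * ξ)) ⊆ Set.Icc a (a + 3) :=
      Set.Icc_subset_Icc (by linarith) (by linarith)
    have hvv := hvmono (2 * ξ) (by linarith)
    have hbM : ContinuousOn (fun w => bump a w * ‖M w‖ ^ 2) (Set.Icc a (a + 3)) :=
      (continuous_bump a).continuousOn.mul (hcont.norm.pow 2)
    calc _ ≤ ∫ w in (v ξ)..(v (2 * ξ)), bump a w * ‖M w‖ ^ 2 := by
          refine intervalIntegral.integral_mono_on hvv ?_ ?_ fun w hw => ?_
          · refine ContinuousOn.intervalIntegrable ?_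
            rw [Set.uIcc_of_le hvv]
            exact (hcont.norm.pow 2).mono hs
          · refine ContinuousOn.intervalIntegrable ?_
            rw [Set.uIcc_of_le hvv]
            exact hbM.mono hs
          · exact le_mul_of_one_le_left (sq_nonneg _)
              (one_le_bump (by linarith [hw.1]) (by linarith [hw.2]))
      _ ≤ _ := by
          refine intervalIntegral.integral_mono_interval (by linarith) hvv (by linarith)
            (Filter.Eventually.of_forall fun w => mul_nonneg (bump_nonneg _ _) (sq_nonneg _)) ?_
          refine ContinuousOn.intervalIntegrable ?_
          rwa [Set.uIcc_of_le (by linarith)]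
  calc _ ≤ ∫ α in ξ..(2 * ξ), 4 * Real.exp 1 ^ 2 * (‖M (v α)‖ ^ 2 * v' α) :=
        intervalIntegral.integral_mono_on (by linarith) hI1 hI2 hpt
    _ = 4 * Real.exp 1 ^ 2 * ∫ w in (v ξ)..(v (2 * ξ)), ‖M w‖ ^ 2 := by
        rw [intervalIntegral.integral_const_mul, hsub]
    _ ≤ 4 * Real.exp 1 ^ 2 * (C * (K * L) ^ 2 / ρ) := by
        gcongr
        exact hle.trans hmean
    _ = 4 * Real.exp 1 ^ 2 * (C * (K * L) ^ 2) * (1 / ρ) := by ring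
    _ ≤ 4 * Real.exp 1 ^ 2 * (C * (K * L) ^ 2) * (N * Real.exp 1 ^ 2 * (8 * ξ)) := by gcongr
    _ = _ := by ring

theorem Stilde_eq_vonMangoldtSum (N : ℕ) (α : ℝ) : Stilde N α = vonMangoldtSum (zOf N α) := by
  unfold Stilde vonMangoldtSum vM zOf
  refine tsum_congr fun n => ?_
  rw [mul_assoc, Complex.ofReal_exp, ← Complex.exp_add]
  congr 2
  push_cast
  ring

theorem norm_Stilde_term (N n : ℕ) (α : ℝ) :
    ‖(vM n : ℂ) * Real.exp (-(n : ℝ) / N) *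
      Complex.exp (2 * (Real.pi : ℂ) * Complex.I * (n : ℂ) * (α : ℂ))‖ =
      vM n * Real.exp (-(n : ℝ) / N) := by
  have : 2 * (Real.pi : ℂ) * Complex.I * n * α = ((2 * Real.pi * n * α : ℝ) : ℂ) * Complex.I := by
    push_cast; ring
  rw [norm_mul, norm_mul, this, Complex.norm_exp_ofReal_mul_I, mul_one, Complex.norm_real,
    Complex.norm_real, Real.norm_eq_abs, Real.norm_eq_abs, abs_of_pos (Real.exp_pos _),
    abs_of_nonneg]
  exact ArithmeticFunction.vonMangoldt_nonneg

theorem continuous_Stilde {N : ℕ} (hN : 0 < N) : Continuous (Stilde N) := by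
  have hs : Summable fun n : ℕ => (n : ℝ) ^ 1 * Real.exp (-(1 / N : ℝ) * n) := by
    have h := Real.summable_pow_mul_exp_neg_nat_mul 1 (r := 1 / (N : ℝ)) (by positivity)
    exact h
  unfold Stilde
  refine continuous_tsum (u := fun n : ℕ => (n : ℝ) ^ 1 * Real.exp (-(1 / N : ℝ) * n))
    (fun n => by fun_prop) hs fun n α => ?_
  rw [norm_Stilde_term]
  have h1 : vM n ≤ n := by
    refine ArithmeticFunction.vonMangoldt_le_log.trans ?_
    exact Real.log_le_self (Nat.cast_nonneg n)
  have h2 : -(n : ℝ) / N = -(1 / N : ℝ) * n := by ring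
  rw [pow_one, h2]
  gcongr

theorem Stilde_neg (N : ℕ) (α : ℝ) : Stilde N (-α) = (starRingEnd ℂ) (Stilde N α) := by
  unfold Stilde
  rw [Complex.conj_tsum]
  refine tsum_congr fun n => ?_
  rw [map_mul, map_mul, Complex.conj_ofReal, Complex.conj_ofReal, ← Complex.exp_conj]
  congr 2
  rw [map_mul, map_mul, map_mul, map_mul, Complex.conj_I, Complex.conj_ofReal,
    Complex.conj_ofReal, Complex.conj_natCast, Complex.conj_ofNat]
  push_cast
  ring

theorem zOf_neg (N : ℕ) (α : ℝ) : zOf N (-α) = (starRingEnd ℂ) (zOf N α) := by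
  apply Complex.ext
  · rw [Complex.conj_re, zOf_re, zOf_re]
  · rw [Complex.conj_im, zOf_im, zOf_im]; ring

/-- The squared error in the approximation of `Stilde N` by `1 / z`. -/
noncomputable def stildeError (N : ℕ) (α : ℝ) : ℝ := ‖Stilde N α - 1 / zOf N α‖ ^ 2

theorem stildeError_neg (N : ℕ) (α : ℝ) : stildeError N (-α) = stildeError N α := by
  unfold stildeError
  rw [Stilde_neg, zOf_neg, ← RCLike.norm_conj (Stilde N α - 1 / zOf N α)]
  simp

theorem continuous_stildeError {N : ℕ} (hN : 0 < N) : Continuous (stildeError N) := by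
  unfold stildeError
  refine Continuous.pow (Continuous.norm ((continuous_Stilde hN).sub ?_)) 2
  exact continuous_const.div (continuous_zOf N) fun α => norm_pos_iff.1 (norm_zOf_pos hN α)

theorem RiemannHypothesis.exists_stildeError_le (hRH : RiemannHypothesis) :
    ∃ C > 0, ∀ N : ℕ, 1 < N → 4 ≤ Real.log N → ∀ α : ℝ, 0 ≤ α → α ≤ 1 / 2 →
      stildeError N α ≤ ‖criticalIntegral (1 / Real.log N) (zOf N α)‖ ^ 2 +
        C * N * Real.log N ^ 2 := by
  obtain ⟨C, hC, h⟩ := hRH.exists_norm_sq_vonMangoldtSum_sub_le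
  refine ⟨C, hC, fun N hN hN4 α h0 h1 => ?_⟩
  unfold stildeError
  rw [Stilde_eq_vonMangoldtSum]
  refine h N (by exact_mod_cast hN) hN4 _ (zOf_re N α) ?_
  have h2 := norm_zOf_le N α
  have h3 : 1 / (N : ℝ) ≤ 1 := by
    rw [div_le_one (by positivity)]
    exact_mod_cast hN.le
  rw [abs_of_nonneg h0] at h2
  nlinarith [Real.pi_lt_d2, Real.pi_pos]

theorem RiemannHypothesis.exists_integral_stildeError_le (hRH : RiemannHypothesis) :
    ∃ C > 0, ∀ N : ℕ, 1 < N → 4 ≤ Real.log N → ∀ k : ℕ, ∀ ξ : ℝ, 0 ≤ ξ → ξ ≤ 1 / 2 →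
      ξ ≤ 2 / N * 2 ^ k → ∫ α in (0 : ℝ)..ξ, stildeError N α ≤ C * N * ξ * Real.log N ^ 2 := by
  obtain ⟨C₁, hC₁, h₁⟩ := hRH.exists_stildeError_le
  obtain ⟨C₂, hC₂, h₂⟩ := hRH.exists_norm_sq_criticalIntegral_le_of_norm_le
  obtain ⟨C₃, hC₃, h₃⟩ := hRH.exists_integral_norm_sq_criticalIntegral_dyadic_le
  refine ⟨C₁ + C₂ + C₃, by positivity, fun N hN hN4 k => ?_⟩
  have hN0 : 0 < N := by omega
  have hNR : (1 : ℝ) < N := by exact_mod_cast hN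
  have hNR0 : (0 : ℝ) < N := by linarith
  set L := Real.log N with hL
  have hI : ∀ a b, IntervalIntegrable (stildeError N) MeasureTheory.volume a b :=
    fun a b => (continuous_stildeError hN0).intervalIntegrable a b
  have hcentral : ∀ ξ : ℝ, 0 ≤ ξ → ξ ≤ 1 / 2 → ξ ≤ 2 / N →
      ∫ α in (0 : ℝ)..ξ, stildeError N α ≤ (C₁ + C₂ + C₃) * N * ξ * L ^ 2 := by
    intro ξ h0 h1 h2
    calc _ ≤ ∫ α in (0 : ℝ)..ξ, (C₁ + C₂ + C₃) * N * L ^ 2 := by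
          refine intervalIntegral.integral_mono_on h0 (hI _ _) (by simp) fun α hα => ?_
          have e1 := h₁ N hN hN4 α hα.1 (hα.2.trans h1)
          have e2 := h₂ N hNR hN4 (zOf N α) (zOf_re N α) (by
            refine (norm_zOf_le N α).trans ?_
            rw [abs_of_nonneg hα.1]
            calc 1 / (N : ℝ) + 2 * Real.pi * α ≤ 1 / N + 2 * 3.15 * (2 / N) := by
                  gcongr
                  · exact hα.1
                  · exact Real.pi_lt_d2.le
                  · exact hα.2.trans h2
              _ = 13.6 / N := by ring
              _ ≤ _ := by gcongr; norm_num)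
          have e3 : 0 ≤ C₃ * N * L ^ 2 := by positivity
          linarith
      _ = _ := by
          rw [intervalIntegral.integral_const, smul_eq_mul]
          ring
  induction k with
  | zero => intro ξ h0 h1 h2; exact hcentral ξ h0 h1 (by simpa using h2)
  | succ k ih =>
    intro ξ h0 h1 h2
    by_cases h : ξ ≤ 2 / N
    · exact hcentral ξ h0 h1 h
    push Not at h
    have i1 := ih (ξ / 2) (by linarith) (by linarith) (by rw [pow_succ] at h2; linarith)
    have hξ : 1 / (N : ℝ) ≤ ξ / 2 := by
      have : 2 / (N : ℝ) = 2 * (1 / N) := by ring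
      linarith
    obtain ⟨j1, j2⟩ := h₃ N hN hN4 (ξ / 2) hξ (by linarith)
    rw [mul_div_cancel₀ ξ (by norm_num : (2 : ℝ) ≠ 0)] at j1 j2
    have i2 : ∫ α in (ξ / 2)..ξ, stildeError N α ≤
        C₃ * N * (ξ / 2) * L ^ 2 + C₁ * N * L ^ 2 * (ξ / 2) := by
      calc _ ≤ ∫ α in (ξ / 2)..ξ, (‖criticalIntegral (1 / L) (zOf N α)‖ ^ 2 +
            C₁ * N * L ^ 2) := by
            refine intervalIntegral.integral_mono_on (by linarith) (hI _ _)
              (j1.add (by simp)) fun α hα => ?_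
            exact h₁ N hN hN4 α (by linarith [hα.1]) (hα.2.trans h1)
        _ = (∫ α in (ξ / 2)..ξ, ‖criticalIntegral (1 / L) (zOf N α)‖ ^ 2) +
            C₁ * N * L ^ 2 * (ξ / 2) := by
            rw [intervalIntegral.integral_add j1 (by simp), intervalIntegral.integral_const,
              smul_eq_mul]
            ring
        _ ≤ _ := by gcongr
    rw [← intervalIntegral.integral_add_adjacent_intervals (hI 0 (ξ / 2)) (hI (ξ / 2) ξ)]
    have e3 : 0 ≤ C₂ * N * (ξ / 2) * L ^ 2 := by positivity
    linarith

theorem Stilde_L2_bound (hRH : RiemannHypothesis) :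
    ∃ C : ℝ, 0 < C ∧ ∃ N₀ : ℕ, ∀ N : ℕ, N₀ ≤ N → ∀ ξ : ℝ, 0 ≤ ξ → ξ ≤ 1/2 →
      (∫ α in (-ξ)..ξ, ‖Stilde N α - 1 / zOf N α‖ ^ 2)
        ≤ C * N * ξ * Real.log N ^ 2 := by
  obtain ⟨C, hC, h⟩ := hRH.exists_integral_stildeError_le
  refine ⟨2 * C, by positivity, ⌈Real.exp 4⌉₊ + 2, fun N hN ξ h0 h1 => ?_⟩
  have hN1 : 1 < N := by omega
  have hNR : (1 : ℝ) < N := by exact_mod_cast hN1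
  have hN4 : 4 ≤ Real.log N := by
    rw [Real.le_log_iff_exp_le (by linarith)]
    refine (Nat.le_ceil _).trans ?_
    exact_mod_cast (by omega : ⌈Real.exp 4⌉₊ ≤ N)
  have hk : ξ ≤ 2 / N * 2 ^ N := by
    have h2 : (N : ℝ) ≤ 2 ^ N := by exact_mod_cast Nat.lt_two_pow_self.le
    have h3 : 2 / (N : ℝ) * N ≤ 2 / N * 2 ^ N := by gcongr
    rw [div_mul_cancel₀ _ (by positivity)] at h3
    linarith
  have hI : ∀ a b, IntervalIntegrable (stildeError N) MeasureTheory.volume a b :=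
    fun a b => (continuous_stildeError (by omega)).intervalIntegrable a b
  have hneg : ∫ α in (-ξ)..0, stildeError N α = ∫ α in (0 : ℝ)..ξ, stildeError N α := by
    have := intervalIntegral.integral_comp_neg (stildeError N) (a := 0) (b := ξ)
    simp only [stildeError_neg, neg_zero] at this
    exact this.symm
  have hmain := h N hN1 hN4 N ξ h0 h1 hk
  change ∫ α in (-ξ)..ξ, stildeError N α ≤ _
  rw [← intervalIntegral.integral_add_adjacent_intervals (hI (-ξ) 0) (hI 0 ξ), hneg]
  linarith
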